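/- Let P ∈ ℤ[n] be a polynomial with integer coefficients of degree d ≥ 2, let p ∈ (1, ∞), fix an even integer p₀ ∈ 2ℤ₊ with p₀/(p₀−1) < p < p₀, fix α ∈ (0, (10⁶ d p₀)^{−1}), and fix a smooth even function η : ℝ → [0, 1] with 1_{[−1/4, 1/4]} ≤ η ≤ 1_{(−1/2, 1/2)}. Then there exist a constant C₀ ∈ ℤ₊ (depending on p₀ and P), a constant c_p ∈ (0, 1), and a constant C ∈ ℝ₊, such that for every integer N ≥ C₀ and every f ∈ ℓ^p(ℤ) ∩ ℓ²(ℤ): ‖ A_N^P ( f − Π_{≤ l_N, ≤ −d L_N} f ) ‖_{ℓ^p(ℤ)} ≤ C N^{−c_p} ‖f‖_{ℓ^p(ℤ)}, where l_N := ⌊α log₂ N⌋ and L_N := ⌊log₂ N⌋ − l_N. -/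

import Mathlib

open MeasureTheory Filter
open scoped ENNReal Real

/-- `e(x) = e^{2πix}`. -/
noncomputable def e2pi (x : ℝ) : ℂ := Complex.exp (2 * Real.pi * Complex.I * x)

/-- The discrete polynomial average `A_N^P f (x) = (1/N) ∑_{n=1}^N f (x - P(n))`. -/
noncomputable def discPolyAvg (P : Polynomial ℤ) (N : ℕ) (f : ℤ → ℂ) (x : ℤ) : ℂ :=
  (N : ℂ)⁻¹ * ∑ n ∈ Finset.Icc 1 N, f (x - P.eval (n : ℤ))

/-- The `ℓ^p(ℤ)` norm `( ∑_{x ∈ ℤ} ‖g x‖^p )^{1/p}`, valued in `ℝ≥0∞`. -/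
noncomputable def lpNormZ (p : ℝ) (g : ℤ → ℂ) : ℝ≥0∞ :=
  (∑' x : ℤ, (‖g x‖₊ : ℝ≥0∞) ^ p) ^ (1 / p)

/-- The set of canonical fractions `R_{≤Q}`, encoded as the finset of pairs `(a, q)`
with `1 ≤ q ≤ Q`, `0 ≤ a < q` and `gcd(a, q) = 1` (the fraction being `a/q`). -/
noncomputable def canonicalFractions (Q : ℝ) : Finset (ℕ × ℕ) :=
  (Finset.range (⌊Q⌋₊ + 1) ×ˢ Finset.Icc 1 ⌊Q⌋₊).filter
    (fun aq => aq.1 < aq.2 ∧ Nat.gcd aq.1 aq.2 = 1)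

/-- The Ionescu–Wainger multiplier symbol
`ξ ↦ ∑_{θ ∈ R_{≤N₁}} η (N₂⁻¹ (ξ - θ))`, where `ξ - θ` is evaluated on the real
representative of minimal absolute value (so the symbol is `1`-periodic). -/
noncomputable def iwSymbol (η : ℝ → ℝ) (N₁ N₂ : ℝ) (ξ : ℝ) : ℝ :=
  ∑ aq ∈ canonicalFractions N₁,
    η (N₂⁻¹ * ((ξ - (aq.1 : ℝ) / aq.2) - round (ξ - (aq.1 : ℝ) / aq.2)))

/-- The convolution kernel of the Ionescu–Wainger projection `Π[≤N₁, ≤N₂]`. -/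
noncomputable def iwKernel (η : ℝ → ℝ) (N₁ N₂ : ℝ) (m : ℤ) : ℂ :=
  ∫ ξ in Set.Ioc (0 : ℝ) 1, (iwSymbol η N₁ N₂ ξ : ℂ) * e2pi (-(ξ * m))

/-- The Ionescu–Wainger projection `Π[≤N₁, ≤N₂]`, realized as convolution with its
kernel; the dyadic projection `Π_{≤l, ≤m}` is `Π[≤ 2^l, ≤ 2^m]`. -/
noncomputable def iwProj (η : ℝ → ℝ) (N₁ N₂ : ℝ) (f : ℤ → ℂ) (x : ℤ) : ℂ :=
  ∑' y : ℤ, iwKernel η N₁ N₂ y * f (x - y)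

section Finner

theorem sum_prod_le_prod_sqrt_sum_sq {ι X : Type*} [DecidableEq ι] [Fintype X]
    (I : Finset ι) (hI : 2 ≤ I.card) (g : ι → X → ℝ) (hg : ∀ i t, 0 ≤ g i t) :
    ∑ t, ∏ i ∈ I, g i t ≤ ∏ i ∈ I, √(∑ t, g i t ^ 2) := by
  obtain ⟨i₀, h₀, i₁, h₁, hne⟩ := Finset.one_lt_card.mp hI
  have h₁' : i₁ ∈ I.erase i₀ := Finset.mem_erase.mpr ⟨hne.symm, h₁⟩
  have hsplit : ∀ F : ι → ℝ, ∏ i ∈ I, F i = F i₀ * (F i₁ * ∏ i ∈ (I.erase i₀).erase i₁, F i) := by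
    intro F
    rw [Finset.mul_prod_erase _ _ h₁', Finset.mul_prod_erase _ _ h₀]
  rw [hsplit]
  set R := ∏ i ∈ (I.erase i₀).erase i₁, √(∑ t, g i t ^ 2)
  have hR : ∀ t, ∏ i ∈ (I.erase i₀).erase i₁, g i t ≤ R := by
    intro t
    refine Finset.prod_le_prod (fun i _ => hg i t) fun i _ => ?_
    refine Real.le_sqrt_of_sq_le ?_
    exact Finset.single_le_sum (f := fun t => g i t ^ 2) (fun _ _ => sq_nonneg _) (Finset.mem_univ t)
  calc ∑ t, ∏ i ∈ I, g i t
      ≤ ∑ t, g i₀ t * g i₁ t * R := by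
        refine Finset.sum_le_sum fun t _ => ?_
        rw [hsplit, ← mul_assoc]
        exact mul_le_mul_of_nonneg_left (hR t) (mul_nonneg (hg _ _) (hg _ _))
    _ = (∑ t, g i₀ t * g i₁ t) * R := by rw [Finset.sum_mul]
    _ ≤ (√(∑ t, g i₀ t ^ 2) * √(∑ t, g i₁ t ^ 2)) * R := by
        refine mul_le_mul_of_nonneg_right (Real.sum_mul_le_sqrt_mul_sqrt _ _ _) ?_
        exact Finset.prod_nonneg fun _ _ => Real.sqrt_nonneg _
    _ = _ := by ring

theorem finner_inequality {ι X : Type*} [Fintype ι] [DecidableEq ι] [Fintype X] [DecidableEq X]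
    (x₀ : X) : ∀ (n : ℕ) (f : ι → (Fin n → X) → ℝ) (_ : ∀ i x, 0 ≤ f i x)
    (S : ι → Finset (Fin n)) (_ : ∀ i x y, (∀ v ∈ S i, x v = y v) → f i x = f i y)
    (_ : ∀ v, 2 ≤ (Finset.univ.filter fun i => v ∈ S i).card),
    ∑ x, ∏ i, f i x ≤ ∏ i, √(∑ x with ∀ v, v ∉ S i → x v = x₀, f i x ^ 2) := by
  intro n
  induction n with
  | zero =>
    intro f hf S _ _
    simp only [Finset.univ_unique, Finset.sum_singleton]
    refine Finset.prod_le_prod (fun i _ => hf i _) fun i _ => ?_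
    rw [Finset.filter_true_of_mem (by intro x _ v; exact v.elim0)]
    simp [Real.sqrt_sq (hf i _)]
  | succ n ih =>
    intro f hf S hdep hcov
    have hsum : ∀ F : (Fin (n + 1) → X) → ℝ,
        ∑ x, F x = ∑ t, ∑ x : Fin n → X, F (Fin.cons t x) := by
      intro F
      rw [← (Fin.consEquiv fun _ => X).sum_comp, Fintype.sum_prod_type]
      rfl
    let N : ι → X → ℝ := fun i t =>
      √(∑ x : Fin n → X with ∀ v, v.succ ∉ S i → x v = x₀, f i (Fin.cons t x) ^ 2)
    have hN : ∀ i t, 0 ≤ N i t := fun i t => Real.sqrt_nonneg _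
    have hNconst : ∀ i, (0 : Fin (n + 1)) ∉ S i → ∀ t, N i t = N i x₀ := by
      intro i hi t
      simp only [N]
      congr 1
      refine Finset.sum_congr rfl fun x _ => ?_
      rw [hdep i (Fin.cons t x) (Fin.cons x₀ x)]
      intro v hv
      refine Fin.cases (fun h => absurd h hi) (fun w _ => by simp) v hv
    have hfin : ∀ i, √(∑ x with ∀ v, v ∉ S i → x v = x₀, f i x ^ 2)
        = if (0 : Fin (n + 1)) ∈ S i then √(∑ t, N i t ^ 2) else N i x₀ := by
      intro i
      have e1 : ∑ x with ∀ v, v ∉ S i → x v = x₀, f i x ^ 2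
          = ∑ t, if (0 ∉ S i → t = x₀) then N i t ^ 2 else 0 := by
        rw [Finset.sum_filter, hsum]
        refine Finset.sum_congr rfl fun t _ => ?_
        simp only [N]
        rw [Real.sq_sqrt (Finset.sum_nonneg fun _ _ => sq_nonneg _), Finset.sum_filter]
        simp only [Fin.forall_fin_succ, Fin.cons_zero, Fin.cons_succ]
        by_cases h : 0 ∉ S i → t = x₀
        · rw [if_pos h]
          exact Finset.sum_congr rfl fun x _ => if_congr (and_iff_right h) rfl rfl
        · rw [if_neg h]
          exact Finset.sum_eq_zero fun x _ => if_neg fun hx => h hx.1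
      rw [e1]
      split_ifs with h
      · simp [h]
      · simp only [h, not_false_eq_true, forall_const, Finset.sum_ite_eq', Finset.mem_univ, if_true]
        exact Real.sqrt_sq (hN _ _)
    calc ∑ x, ∏ i, f i x = ∑ t, ∑ x : Fin n → X, ∏ i, f i (Fin.cons t x) := hsum _
      _ ≤ ∑ t, ∏ i, N i t := by
        refine Finset.sum_le_sum fun t _ => ?_
        have := ih (fun i x => f i (Fin.cons t x)) (fun i x => hf _ _)
          (fun i => Finset.univ.filter fun v => v.succ ∈ S i) ?_ ?_
        · simpa [N] using this
        · intro i x y hxy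
          refine hdep i _ _ fun v => ?_
          refine Fin.cases (fun _ => rfl) (fun w hw => ?_) v
          simpa using hxy w (by simpa using hw)
        · intro v
          simpa using hcov v.succ
      _ = ∑ t, (∏ i with (0 : Fin (n + 1)) ∈ S i, N i t) *
            ∏ i with ¬ (0 : Fin (n + 1)) ∈ S i, N i x₀ := by
        refine Finset.sum_congr rfl fun t _ => ?_
        rw [← Finset.prod_filter_mul_prod_filter_not Finset.univ
          (fun i => (0 : Fin (n + 1)) ∈ S i)]
        congr 1
        refine Finset.prod_congr rfl fun i hi => hNconst i (by simpa using hi) t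
      _ ≤ (∏ i with (0 : Fin (n + 1)) ∈ S i, √(∑ t, N i t ^ 2)) *
            ∏ i with ¬ (0 : Fin (n + 1)) ∈ S i, N i x₀ := by
        rw [← Finset.sum_mul]
        refine mul_le_mul_of_nonneg_right ?_ (Finset.prod_nonneg fun i _ => hN _ _)
        exact sum_prod_le_prod_sqrt_sum_sq _ (hcov 0) _ hN
      _ = _ := by
        rw [← Finset.prod_filter_mul_prod_filter_not Finset.univ
          (fun i => (0 : Fin (n + 1)) ∈ S i)]
        congr 1
        · refine Finset.prod_congr rfl fun i hi => ?_
          rw [hfin, if_pos (by simpa using hi)]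
        · refine Finset.prod_congr rfl fun i hi => ?_
          rw [hfin, if_neg (by simpa using hi)]

end Finner

section Admissible

/-- Every prime power dividing one entry of the tuple divides another entry. -/
def PrimePowersRepeat {ι : Type*} (q : ι → ℕ) : Prop :=
  ∀ p k : ℕ, p.Prime → 1 ≤ k → ∀ i, p ^ k ∣ q i → ∃ j, j ≠ i ∧ p ^ k ∣ q j

theorem PrimePowersRepeat.exists_factorization {ι : Type*} [Fintype ι] [DecidableEq ι] :
    ∀ (m : ℕ) (q : ι → ℕ), ∏ i, q i = m → (∀ i, 0 < q i) → PrimePowersRepeat q →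
    ∃ d : Finset ι → ℕ, (∀ A, 0 < d A) ∧ (∀ A, d A ≠ 1 → 2 ≤ A.card) ∧
      ∀ i, q i = ∏ A with i ∈ A, d A := by
  intro m
  induction m using Nat.strong_induction_on with
  | _ m ih =>
  intro q hm hpos hq
  by_cases hall : ∀ i, q i = 1
  · exact ⟨fun _ => 1, by simp, by simp, by simpa using hall⟩
  push Not at hall
  obtain ⟨i₀, hi₀⟩ := hall
  obtain ⟨p, hp, hpi⟩ := Nat.exists_prime_and_dvd hi₀
  set A₀ : Finset ι := Finset.univ.filter fun i => p ∣ q i with hA₀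
  set q' : ι → ℕ := fun i => if p ∣ q i then q i / p else q i with hq'
  have hqq' : ∀ i, q i = q' i * (if i ∈ A₀ then p else 1) := by
    intro i
    by_cases h : p ∣ q i
    · simp [hq', hA₀, h, Nat.div_mul_cancel h]
    · simp [hq', hA₀, h]
  have hq'pos : ∀ i, 0 < q' i := by
    intro i
    have := hpos i
    rw [hqq' i] at this
    exact Nat.pos_of_mul_pos_right this
  have hlt : ∏ i, q' i < m := by
    rw [← hm]
    refine Finset.prod_lt_prod (fun i _ => hq'pos i) (fun i _ => ?_) ⟨i₀, Finset.mem_univ _, ?_⟩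
    · rw [hqq' i]
      refine Nat.le_mul_of_pos_right _ ?_
      split_ifs
      · exact hp.pos
      · exact one_pos
    · simp only [hq', hpi, if_true]
      exact Nat.div_lt_self (hpos _) hp.one_lt
  have hpow : ∀ l k i, l.Prime → (l ^ k ∣ q' i ↔ if l = p ∧ p ∣ q i then l ^ (k + 1) ∣ q i
      else l ^ k ∣ q i) := by
    intro l k i hl
    by_cases h : p ∣ q i
    · by_cases hlp : l = p
      · subst hlp
        simp only [hq', h, if_true, and_self, pow_succ]
        exact Nat.dvd_div_iff_mul_dvd h |>.trans (by rw [mul_comm])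
      · simp only [hlp, false_and, if_false]
        have hc : Nat.Coprime (l ^ k) p := (Nat.coprime_primes hl hp).mpr hlp |>.pow_left k
        rw [hqq' i]
        simp only [hA₀, Finset.mem_filter, Finset.mem_univ, true_and, h, if_true]
        exact (hc.dvd_mul_right).symm
    · simp [hq', h]
  have hrep : PrimePowersRepeat q' := by
    intro l k hl hk i hi
    rw [hpow l k i hl] at hi
    by_cases hlp : l = p
    · subst hlp
      have hdv : l ∣ q i := by
        by_contra hcon
        simp only [hcon, and_false, if_false] at hi
        exact hcon ((dvd_pow_self l (by omega)).trans hi)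
      simp only [hdv, and_self, if_true] at hi
      obtain ⟨j, hj, hj'⟩ := hq l (k + 1) hl (by omega) i hi
      refine ⟨j, hj, ?_⟩
      rw [hpow l k j hl, if_pos ⟨rfl, (dvd_pow_self l (by omega)).trans hj'⟩]
      exact hj'
    · simp only [hlp, false_and, if_false] at hi
      obtain ⟨j, hj, hj'⟩ := hq l k hl hk i hi
      exact ⟨j, hj, by rw [hpow l k j hl]; simpa [hlp] using hj'⟩
  obtain ⟨d, hd1, hd2, hd3⟩ := ih _ hlt q' rfl hq'pos hrep
  refine ⟨fun A => d A * (if A = A₀ then p else 1), fun A => ?_, fun A hA => ?_, fun i => ?_⟩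
  · have := hd1 A
    have := hp.pos
    beta_reduce
    split_ifs <;> positivity
  · by_cases hAA : A = A₀
    · obtain ⟨j, hj, hj'⟩ := hq p 1 hp le_rfl i₀ (by simpa using hpi)
      rw [hAA]
      refine Finset.one_lt_card.mpr ⟨i₀, by simpa [hA₀] using hpi, j, by simpa [hA₀] using hj',
        hj.symm⟩
    · simp only [hAA, if_false, mul_one] at hA
      exact hd2 A hA
  · rw [hqq' i, hd3 i, Finset.prod_mul_distrib, Finset.prod_ite_eq']
    simp

theorem card_factorizations_le {n Q : ℕ} (hQ : 0 < Q) (S : Finset (Fin n)) {k : ℕ} (hk : k ≠ 0) :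
    (Finset.univ.filter fun x : Fin n → Fin Q => (∀ v, v ∉ S → x v = ⟨0, hQ⟩) ∧
      ∏ v ∈ S, ((x v : ℕ) + 1) = k).card ≤ k.divisors.card ^ n := by
  rw [← Fintype.card_piFinset_const]
  refine Finset.card_le_card_of_injOn (fun (x : Fin n → Fin Q) v => ((x v : ℕ) + 1)) ?_ ?_
  · intro x hx
    have hx' := (Finset.mem_filter.mp hx).2
    rw [Finset.mem_coe, Fintype.mem_piFinset]
    intro v
    refine Nat.mem_divisors.mpr ⟨?_, hk⟩
    by_cases hv : v ∈ S
    · rw [← hx'.2]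
      exact Finset.dvd_prod_of_mem (fun v => ((x v : ℕ) + 1)) hv
    · simp [hx'.1 v hv]
  · intro x _ y _ h
    funext v
    exact Fin.ext (Nat.succ_injective (congrFun h v))

open Classical in
theorem sum_primePowersRepeat_le {ι : Type*} [Fintype ι] [DecidableEq ι] (Q : ℕ) (T : ℕ)
    (hT : ∀ k ∈ Finset.Icc 1 Q, k.divisors.card ≤ T) (a : ℕ → ℝ) (ha : ∀ k, 0 ≤ a k) :
    ∑ q ∈ (Fintype.piFinset fun _ : ι => Finset.Icc 1 Q) with PrimePowersRepeat q, ∏ i, a (q i)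
      ≤ √((T : ℝ) ^ (2 ^ Fintype.card ι) * ∑ k ∈ Finset.Icc 1 Q, a k ^ 2) ^ Fintype.card ι := by
  rcases Nat.eq_zero_or_pos Q with hQ | hQ
  · subst hQ
    rcases isEmpty_or_nonempty ι with h | h
    · simp
      refine Finset.card_le_one.mpr fun a _ b _ => Subsingleton.elim _ _
    · obtain ⟨i⟩ := h
      rw [Finset.sum_eq_zero]
      · positivity
      · intro q hq
        have := Fintype.mem_piFinset.mp (Finset.mem_filter.mp hq).1 i
        simp at this
  have hT1 : 1 ≤ T := by simpa using hT 1 (by simp; omega)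
  let V := {A : Finset ι // 2 ≤ A.card}
  obtain ⟨n, hnV⟩ : ∃ n, Fintype.card V = n := ⟨_, rfl⟩
  let e : Fin n ≃ V := (Fintype.equivFinOfCardEq hnV).symm
  let x₀ : Fin Q := ⟨0, hQ⟩
  have : Nonempty (Fin n → Fin Q) := ⟨fun _ => x₀⟩
  let S : ι → Finset (Fin n) := fun i => Finset.univ.filter fun v => i ∈ (e v).1
  let b : ℕ → ℝ := fun k => if k ∈ Finset.Icc 1 Q then a k else 0
  have hb : ∀ k, 0 ≤ b k := fun k => by simp only [b]; split_ifs; exacts [ha k, le_rfl]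
  let f : ι → (Fin n → Fin Q) → ℝ := fun i x => b (∏ v ∈ S i, ((x v : ℕ) + 1))
  have hfin := finner_inequality x₀ n f (fun i x => hb _) S
    (fun i x y hxy => by
      simp only [f]
      congr 1
      exact Finset.prod_congr rfl fun v hv => by rw [hxy v hv])
    (fun v => by
      have : (Finset.univ.filter fun i => v ∈ S i) = (e v).1 := by
        ext i; simp [S]
      rw [this]; exact (e v).2)
  -- factor every admissible tuple
  have hex : ∀ q : ι → ℕ, q ∈ (Fintype.piFinset fun _ : ι => Finset.Icc 1 Q).filter
      PrimePowersRepeat → ∃ x : Fin n → Fin Q, ∀ i, q i = ∏ v ∈ S i, ((x v : ℕ) + 1) := by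
    intro q hq
    rw [Finset.mem_filter, Fintype.mem_piFinset] at hq
    obtain ⟨hq1, hq2⟩ := hq
    have hq1' : ∀ i, 1 ≤ q i ∧ q i ≤ Q := fun i => by simpa using hq1 i
    obtain ⟨d, hd1, hd2, hd3⟩ := PrimePowersRepeat.exists_factorization _ q rfl
      (fun i => (hq1' i).1) hq2
    have hdle : ∀ A : Finset ι, d A ≤ Q := by
      intro A
      by_cases hA : d A = 1
      · omega
      · obtain ⟨i, hi⟩ := Finset.card_pos.mp (by have := hd2 A hA; omega : 0 < A.card)
        refine le_trans ?_ (hq1' i).2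
        refine Nat.le_of_dvd (hq1' i).1 ?_
        rw [hd3 i]
        exact Finset.dvd_prod_of_mem d (by simpa using hi)
    refine ⟨fun v => ⟨d (e v).1 - 1, by have := hd1 (e v).1; have := hdle (e v).1; omega⟩, fun i => ?_⟩
    have h0 : ∀ v, d (e v).1 - 1 + 1 = d (e v).1 := fun v => Nat.sub_add_cancel (hd1 _)
    rw [hd3 i]
    simp only [S, h0]
    have h1 : ∏ v with i ∈ (e v).1, d (e v).1 = ∏ A : V with i ∈ A.1, d A.1 := by
      refine Finset.prod_equiv e (by simp) (by simp)
    rw [h1]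
    have h2 : ∏ A : V with i ∈ A.1, d A.1
        = ∏ A ∈ (Finset.univ.filter fun A : Finset ι => i ∈ A) with 2 ≤ A.card, d A := by
      refine Finset.prod_bij (fun A _ => A.1) ?_ ?_ ?_ ?_
      · intro A hA; simpa using ⟨by simpa using hA, A.2⟩
      · intro A _ B _ h; exact Subtype.ext h
      · intro A hA
        simp only [Finset.mem_filter, Finset.mem_univ, true_and] at hA
        exact ⟨⟨A, hA.2⟩, by simpa using hA.1, rfl⟩
      · intro A _; rfl
    rw [h2]
    symm
    refine Finset.prod_subset (Finset.filter_subset _ _) ?_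
    intro A hA hA'
    by_contra hcon
    exact hA' (Finset.mem_filter.mpr ⟨hA, hd2 A hcon⟩)
  choose! φ hφ using hex
  have hle1 : ∑ q ∈ (Fintype.piFinset fun _ : ι => Finset.Icc 1 Q) with PrimePowersRepeat q,
      ∏ i, a (q i) ≤ ∑ x, ∏ i, f i x := by
    have hinj : Set.InjOn φ ((Fintype.piFinset fun _ : ι => Finset.Icc 1 Q).filter
        PrimePowersRepeat : Finset (ι → ℕ)) := by
      intro q hq q' hq' h
      funext i
      rw [hφ q hq i, hφ q' hq' i, h]
    calc _ = ∑ q ∈ (Fintype.piFinset fun _ : ι => Finset.Icc 1 Q) with PrimePowersRepeat q,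
          ∏ i, f i (φ q) := by
          refine Finset.sum_congr rfl fun q hq => Finset.prod_congr rfl fun i _ => ?_
          simp only [f]
          rw [← hφ q hq i]
          simp only [b]
          rw [if_pos]
          exact Fintype.mem_piFinset.mp (Finset.mem_filter.mp hq).1 i
      _ = ∑ x ∈ Finset.image φ ((Fintype.piFinset fun _ : ι => Finset.Icc 1 Q).filter
          PrimePowersRepeat), ∏ i, f i x := by
          rw [Finset.sum_image hinj]
      _ ≤ _ := Finset.sum_le_sum_of_subset_of_nonneg (Finset.subset_univ _)
          fun x _ _ => Finset.prod_nonneg fun i _ => hb _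
  have hl2 : ∀ i, ∑ x with ∀ v, v ∉ S i → x v = x₀, f i x ^ 2
      ≤ (T : ℝ) ^ (2 ^ Fintype.card ι) * ∑ k ∈ Finset.Icc 1 Q, a k ^ 2 := by
    intro i
    have hn : n ≤ 2 ^ Fintype.card ι := by
      calc n ≤ Fintype.card (Finset ι) := hnV ▸ Fintype.card_subtype_le _
        _ = _ := Fintype.card_finset
    have h0 : ∀ x : Fin n → Fin Q, f i x ^ 2 = ∑ k ∈ Finset.Icc 1 Q,
        if ∏ v ∈ S i, ((x v : ℕ) + 1) = k then a k ^ 2 else 0 := by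
      intro x
      rw [Finset.sum_ite_eq]
      simp only [f, b]
      split_ifs <;> simp
    calc _ = ∑ k ∈ Finset.Icc 1 Q, ∑ x : Fin n → Fin Q with ∀ v, v ∉ S i → x v = x₀,
          if ∏ v ∈ S i, ((x v : ℕ) + 1) = k then a k ^ 2 else 0 := by
          rw [Finset.sum_comm]
          exact Finset.sum_congr rfl fun x _ => h0 x
      _ ≤ ∑ k ∈ Finset.Icc 1 Q, (T : ℝ) ^ (2 ^ Fintype.card ι) * a k ^ 2 := by
          refine Finset.sum_le_sum fun k hk => ?_
          rw [← Finset.sum_filter, Finset.sum_const, nsmul_eq_mul]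
          refine mul_le_mul_of_nonneg_right ?_ (sq_nonneg _)
          have hcard := card_factorizations_le hQ (S i) (k := k)
            (by have := (Finset.mem_Icc.mp hk).1; omega)
          rw [← Finset.filter_filter] at hcard
          have : k.divisors.card ^ n ≤ T ^ (2 ^ Fintype.card ι) :=
            (Nat.pow_le_pow_left (hT k hk) n).trans (Nat.pow_le_pow_right hT1 hn)
          exact_mod_cast hcard.trans this
      _ = _ := by rw [Finset.mul_sum]
  calc _ ≤ _ := hle1
    _ ≤ _ := hfin
    _ ≤ ∏ _i : ι, √((T : ℝ) ^ (2 ^ Fintype.card ι) * ∑ k ∈ Finset.Icc 1 Q, a k ^ 2) :=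
        Finset.prod_le_prod (fun i _ => Real.sqrt_nonneg _)
          fun i _ => Real.sqrt_le_sqrt (hl2 i)
    _ = _ := by simp

end Admissible

section FiniteGroup

theorem Nat.Prime.pow_dvd_lcm_iff {p k a b : ℕ} (hp : p.Prime) (ha : a ≠ 0) (hb : b ≠ 0) :
    p ^ k ∣ Nat.lcm a b ↔ p ^ k ∣ a ∨ p ^ k ∣ b := by
  rw [hp.pow_dvd_iff_le_factorization (Nat.lcm_ne_zero ha hb), Nat.factorization_lcm ha hb,
    hp.pow_dvd_iff_le_factorization ha, hp.pow_dvd_iff_le_factorization hb, Finsupp.sup_apply,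
    le_sup_iff]

theorem Nat.Prime.exists_pow_dvd_of_pow_dvd_lcm {ι : Type*} {p k : ℕ} (hp : p.Prime) (hk : 1 ≤ k)
    (s : Finset ι) (q : ι → ℕ) (hq : ∀ i ∈ s, q i ≠ 0) (h : p ^ k ∣ s.lcm q) :
    ∃ i ∈ s, p ^ k ∣ q i := by
  classical
  induction s using Finset.induction_on with
  | empty =>
    simp only [Finset.lcm_empty, Nat.dvd_one] at h
    exact absurd h (Nat.one_lt_pow (by omega) hp.one_lt).ne'
  | insert a s ha ih =>
    rw [Finset.lcm_insert] at h
    have hs : ∀ i ∈ s, q i ≠ 0 := fun i hi => hq i (Finset.mem_insert_of_mem hi)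
    have hl : s.lcm q ≠ 0 := by
      rw [Ne, Finset.lcm_eq_zero_iff]
      simpa using hs
    rcases (hp.pow_dvd_lcm_iff (hq a (Finset.mem_insert_self _ _)) hl).mp h with h | h
    · exact ⟨a, Finset.mem_insert_self _ _, h⟩
    · obtain ⟨i, hi, hi'⟩ := ih hs h
      exact ⟨i, Finset.mem_insert_of_mem hi, hi'⟩

variable {Y : Type*} [AddCommGroup Y]

theorem invariant_of_dvd {E : Type*} {F : Y → E} {q ℓ : ℕ} (hF : ∀ y t, F (y + q • t) = F y)
    (h : q ∣ ℓ) (y t : Y) : F (y + ℓ • t) = F y := by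
  obtain ⟨c, rfl⟩ := h
  rw [mul_smul]
  exact hF y _

variable [Fintype Y]

theorem card_mul_sum_mul_eq {E : Type*} [CommRing E] (F R : Y → E) {ℓ : ℕ}
    (hR : ∀ y t, R (y + ℓ • t) = R y) :
    (Fintype.card Y : E) * ∑ y, F y * R y = ∑ y, (∑ t, F (y + ℓ • t)) * R y := by
  have h : ∀ t : Y, ∑ y, F y * R y = ∑ y, F (y + ℓ • t) * R y := by
    intro t
    rw [← Equiv.sum_comp (Equiv.addRight (ℓ • t))]
    exact Finset.sum_congr rfl fun y _ => by simp [hR]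
  calc (Fintype.card Y : E) * ∑ y, F y * R y = ∑ _t : Y, ∑ y, F y * R y := by simp
    _ = ∑ t : Y, ∑ y, F (y + ℓ • t) * R y := Finset.sum_congr rfl fun t _ => h t
    _ = _ := by rw [Finset.sum_comm]; simp_rw [Finset.sum_mul]

/-- Square function estimate: components of different exact periods are almost orthogonal in
`ℓ^{2r}`. -/
theorem sum_norm_pow_le_sum_square_function (F : ℕ → Y → ℂ) (Q r T : ℕ)
    (hT : ∀ k ∈ Finset.Icc 1 Q, k.divisors.card ≤ T)
    (hF : ∀ q ∈ Finset.Icc 1 Q, ∀ y t, F q (y + q • t) = F q y)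
    (hF0 : ∀ q ∈ Finset.Icc 1 Q, ∀ ℓ : ℕ, ¬ q ∣ ℓ → ∀ y, ∑ t, F q (y + ℓ • t) = 0) :
    ∑ y, ‖∑ q ∈ Finset.Icc 1 Q, F q y‖ ^ (2 * r)
      ≤ ((T : ℝ) ^ (2 ^ (2 * r))) ^ r * ∑ y, (∑ q ∈ Finset.Icc 1 Q, ‖F q y‖ ^ 2) ^ r := by
  classical
  let ι := Fin r ⊕ Fin r
  let G : ι → ℕ → Y → ℂ := fun i q y => Sum.elim (fun _ => F q y) (fun _ => star (F q y)) i
  have hGn : ∀ i q y, ‖G i q y‖ = ‖F q y‖ := by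
    rintro (i | i) q y <;> simp [G]
  have hGp : ∀ i, ∀ q ∈ Finset.Icc 1 Q, ∀ y t, G i q (y + q • t) = G i q y := by
    rintro (i | i) q hq y t <;> simp [G, hF q hq]
  have hG0 : ∀ i, ∀ q ∈ Finset.Icc 1 Q, ∀ ℓ : ℕ, ¬ q ∣ ℓ → ∀ y, ∑ t, G i q (y + ℓ • t) = 0 := by
    rintro (i | i) q hq ℓ hℓ y
    · exact hF0 q hq ℓ hℓ y
    · have := congrArg star (hF0 q hq ℓ hℓ y)
      simpa [G, star_sum] using this
  have hexp : ∀ y, ((‖∑ q ∈ Finset.Icc 1 Q, F q y‖ ^ (2 * r) : ℝ) : ℂ)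
      = ∑ q ∈ Fintype.piFinset fun _ : ι => Finset.Icc 1 Q, ∏ i, G i (q i) y := by
    intro y
    rw [← Finset.prod_univ_sum (fun _ : ι => Finset.Icc 1 Q) (fun i q => G i q y),
      Fintype.prod_sum_type]
    simp only [G, Sum.elim_inl, Sum.elim_inr, Finset.prod_const, Finset.card_univ,
      Fintype.card_fin, ← star_sum]
    rw [← mul_pow, pow_mul, Complex.ofReal_pow, Complex.ofReal_pow]
    congr 1
    exact (Complex.mul_conj' _).symm
  have hvan : ∀ q ∈ Fintype.piFinset fun _ : ι => Finset.Icc 1 Q, ¬ PrimePowersRepeat q →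
      ∑ y, ∏ i, G i (q i) y = 0 := by
    intro q hq hnot
    rw [Fintype.mem_piFinset] at hq
    have hq0 : ∀ i, q i ≠ 0 := fun i => by have := Finset.mem_Icc.mp (hq i); omega
    unfold PrimePowersRepeat at hnot
    push Not at hnot
    obtain ⟨p, k, hp, hk, i, hi, hj⟩ := hnot
    set ℓ := (Finset.univ.erase i).lcm q
    have hℓ : ¬ q i ∣ ℓ := by
      intro hd
      obtain ⟨j, hj1, hj2⟩ := hp.exists_pow_dvd_of_pow_dvd_lcm hk _ q (fun j _ => hq0 j)
        (hi.trans hd)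
      exact hj j (Finset.ne_of_mem_erase hj1) hj2
    have hkey := card_mul_sum_mul_eq (G i (q i)) (fun y => ∏ j ∈ Finset.univ.erase i, G j (q j) y)
      (ℓ := ℓ) (fun y t => Finset.prod_congr rfl fun j hj =>
        invariant_of_dvd (hGp j _ (hq j)) (Finset.dvd_lcm hj) y t)
    simp only [hG0 i _ (hq i) ℓ hℓ, zero_mul, Finset.sum_const_zero] at hkey
    have hc : (Fintype.card Y : ℂ) ≠ 0 := by
      exact_mod_cast (Fintype.card_pos_iff.mpr ⟨(0 : Y)⟩).ne'
    rw [← (mul_eq_zero.mp hkey).resolve_left hc]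
    exact Finset.sum_congr rfl fun y _ =>
      (Finset.mul_prod_erase _ (fun j => G j (q j) y) (Finset.mem_univ i)).symm
  have hmain : ((∑ y, ‖∑ q ∈ Finset.Icc 1 Q, F q y‖ ^ (2 * r) : ℝ) : ℂ)
      = ∑ y, ∑ q ∈ (Fintype.piFinset fun _ : ι => Finset.Icc 1 Q) with PrimePowersRepeat q,
        ∏ i, G i (q i) y := by
    rw [Complex.ofReal_sum, Finset.sum_congr rfl fun y _ => hexp y, Finset.sum_comm,
      Finset.sum_comm (s := Finset.univ), Finset.sum_filter]
    refine Finset.sum_congr rfl fun q hq => ?_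
    split_ifs with h
    · rfl
    · exact hvan q hq h
  have h0 : 0 ≤ ∑ y, ‖∑ q ∈ Finset.Icc 1 Q, F q y‖ ^ (2 * r) :=
    Finset.sum_nonneg fun _ _ => by positivity
  rw [← abs_of_nonneg h0, ← Real.norm_eq_abs, ← Complex.norm_real, hmain, Finset.mul_sum]
  refine (norm_sum_le _ _).trans (Finset.sum_le_sum fun y _ => ?_)
  calc _ ≤ ∑ q ∈ (Fintype.piFinset fun _ : ι => Finset.Icc 1 Q) with PrimePowersRepeat q,
        ∏ i, ‖F (q i) y‖ := by
        refine (norm_sum_le _ _).trans (Finset.sum_le_sum fun q _ => ?_)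
        rw [norm_prod]
        simp [hGn]
    _ ≤ _ := sum_primePowersRepeat_le Q T hT (fun q => ‖F q y‖) fun q => norm_nonneg _
    _ = _ := by
        have hc : Fintype.card ι = 2 * r := by simp [ι, two_mul]
        rw [hc, pow_mul, Real.sq_sqrt, mul_pow]
        exact mul_nonneg (by positivity) (Finset.sum_nonneg fun _ _ => by positivity)

/-- The average of `F` over translates by multiples of `g`. -/
noncomputable def mulAverage (g : ℕ) (F : Y → ℝ) (y : Y) : ℝ :=
  (Fintype.card Y : ℝ)⁻¹ * ∑ t, F (y + g • t)

theorem mulAverage_nonneg (g : ℕ) {F : Y → ℝ} (hF : ∀ y, 0 ≤ F y) (y : Y) :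
    0 ≤ mulAverage g F y :=
  mul_nonneg (by positivity) (Finset.sum_nonneg fun _ _ => hF _)

theorem mulAverage_of_invariant {g : ℕ} {F : Y → ℝ} (hF : ∀ y t, F (y + g • t) = F y) (y : Y) :
    mulAverage g F y = F y := by
  have : (Fintype.card Y : ℝ) ≠ 0 := by
    exact_mod_cast (Fintype.card_pos_iff.mpr ⟨(0 : Y)⟩).ne'
  simp [mulAverage, hF, this]

theorem mulAverage_invariant (g : ℕ) (F : Y → ℝ) (y t : Y) :
    mulAverage g F (y + g • t) = mulAverage g F y := by
  unfold mulAverage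
  rw [← Equiv.sum_comp (Equiv.addLeft t) fun s => F (y + g • s)]
  simp [add_assoc]

theorem mulAverage_comm (g h : ℕ) (F : Y → ℝ) (y : Y) :
    mulAverage g (mulAverage h F) y = mulAverage h (mulAverage g F) y := by
  unfold mulAverage
  simp_rw [← Finset.mul_sum]
  rw [Finset.sum_comm]
  simp_rw [add_right_comm y]

theorem mulAverage_eq_gcd {q ℓ : ℕ} {F : Y → ℝ} (hF : ∀ y t, F (y + q • t) = F y) (y : Y) :
    mulAverage ℓ F y = mulAverage (Nat.gcd q ℓ) F y := by
  set g := Nat.gcd q ℓ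
  have hq : ∀ y t, mulAverage ℓ F (y + q • t) = mulAverage ℓ F y := by
    intro y t
    unfold mulAverage
    simp_rw [add_right_comm y (q • t), hF]
  have hg : ∀ y t, mulAverage ℓ F (y + g • t) = mulAverage ℓ F y := by
    intro y t
    have : g • t = q • ((Nat.gcdA q ℓ) • t) + ℓ • ((Nat.gcdB q ℓ) • t) := by
      rw [← natCast_zsmul, Nat.gcd_eq_gcd_ab, add_smul, mul_smul, mul_smul, natCast_zsmul,
        natCast_zsmul]
    rw [this, ← add_assoc, mulAverage_invariant, hq]
  rw [← mulAverage_of_invariant hg y, mulAverage_comm]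
  exact mulAverage_of_invariant (invariant_of_dvd (mulAverage_invariant g F)
    (Nat.gcd_dvd_right q ℓ)) y

theorem sum_mul_eq_sum_mulAverage_mul {q ℓ : ℕ} {F R : Y → ℝ}
    (hF : ∀ y t, F (y + q • t) = F y) (hR : ∀ y t, R (y + ℓ • t) = R y) :
    ∑ y, F y * R y = ∑ y, mulAverage (Nat.gcd q ℓ) F y * R y := by
  have hc : (Fintype.card Y : ℝ) ≠ 0 := by
    exact_mod_cast (Fintype.card_pos_iff.mpr ⟨(0 : Y)⟩).ne'
  simp_rw [← mulAverage_eq_gcd hF]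
  have := card_mul_sum_mul_eq F R hR
  unfold mulAverage
  simp_rw [mul_assoc, ← Finset.mul_sum]
  rw [← this, inv_mul_cancel_left₀ hc]

theorem mul_pow_le_half_pow_succ_add {S H : ℝ} (hS : 0 ≤ S) (hH : 0 ≤ H) (m : ℕ) :
    H * S ^ m ≤ S ^ (m + 1) / 2 + 2 ^ m * H ^ (m + 1) := by
  rcases le_total S (2 * H) with h | h
  · have : H * S ^ m ≤ H * (2 * H) ^ m := by gcongr
    have h2 : 0 ≤ S ^ (m + 1) := by positivity
    have h3 : H * (2 * H) ^ m = 2 ^ m * H ^ (m + 1) := by rw [mul_pow]; ring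
    linarith
  · have : H * S ^ m ≤ S / 2 * S ^ m := by
      have : H ≤ S / 2 := by linarith
      gcongr
    have h2 : 0 ≤ 2 ^ m * H ^ (m + 1) := by positivity
    have h3 : S / 2 * S ^ m = S ^ (m + 1) / 2 := by ring
    linarith

/-- Reduction of powers of a sum of functions with various periods to powers of averages. -/
theorem sum_pow_le_sum_mulAverage_pow (G : ℕ → Y → ℝ) (Q m T : ℕ)
    (hT : ∀ k ∈ Finset.Icc 1 (Q ^ m), k.divisors.card ≤ T)
    (hG : ∀ q y, 0 ≤ G q y) (hGp : ∀ q ∈ Finset.Icc 1 Q, ∀ y t, G q (y + q • t) = G q y) :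
    ∑ y, (∑ q ∈ Finset.Icc 1 Q, G q y) ^ (m + 1) ≤ 2 ^ (m + 1) * (T : ℝ) ^ (m + 1) *
      ∑ g ∈ Finset.Icc 1 Q, ∑ y,
        (∑ q ∈ Finset.Icc 1 Q with g ∣ q, mulAverage g (G q) y) ^ (m + 1) := by
  classical
  rcases Nat.eq_zero_or_pos Q with hQ | hQ
  · simp [hQ]
  set H : ℕ → Y → ℝ := fun g y => ∑ q ∈ Finset.Icc 1 Q with g ∣ q, mulAverage g (G q) y
  have hH : ∀ g y, 0 ≤ H g y := fun g y => Finset.sum_nonneg fun q _ => mulAverage_nonneg _ (hG q) y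
  have hmax : ∀ y, ∃ M : ℝ, 0 ≤ M ∧ (∀ g ∈ Finset.Icc 1 Q, H g y ≤ M) ∧
      M ^ (m + 1) ≤ ∑ g ∈ Finset.Icc 1 Q, H g y ^ (m + 1) := by
    intro y
    obtain ⟨g, hg, hg'⟩ := Finset.exists_max_image (Finset.Icc 1 Q) (fun g => H g y)
      ⟨1, by simp; omega⟩
    exact ⟨H g y, hH g y, hg', Finset.single_le_sum (f := fun g => H g y ^ (m + 1))
      (fun g _ => pow_nonneg (hH g y) _) hg⟩
  choose M hM0 hM1 hM2 using hmax
  set S : Y → ℝ := fun y => ∑ q ∈ Finset.Icc 1 Q, G q y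
  have hS : ∀ y, 0 ≤ S y := fun y => Finset.sum_nonneg fun q _ => hG q y
  have hpow : ∀ y, S y ^ m = ∑ q' ∈ Fintype.piFinset fun _ : Fin m => Finset.Icc 1 Q,
      ∏ j, G (q' j) y := by
    intro y
    rw [← Finset.prod_univ_sum (fun _ : Fin m => Finset.Icc 1 Q) (fun _ q => G q y)]
    simp [S]
  have hstep : ∀ q' ∈ Fintype.piFinset fun _ : Fin m => Finset.Icc 1 Q,
      ∑ y, S y * ∏ j, G (q' j) y ≤ ∑ y, (T * M y) * ∏ j, G (q' j) y := by
    intro q' hq'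
    rw [Fintype.mem_piFinset] at hq'
    have hq1 : ∀ i, 1 ≤ q' i ∧ q' i ≤ Q := fun i => Finset.mem_Icc.mp (hq' i)
    set ℓ := Finset.univ.lcm q'
    have hR : ∀ y t, ∏ j, G (q' j) (y + ℓ • t) = ∏ j, G (q' j) y := fun y t =>
      Finset.prod_congr rfl fun j _ =>
        invariant_of_dvd (hGp _ (hq' j)) (Finset.dvd_lcm (Finset.mem_univ j)) y t
    have hℓ0 : ℓ ≠ 0 := by
      simp only [ℓ, Ne, Finset.lcm_eq_zero_iff]
      simpa using fun i => (by have := hq1 i; omega : q' i ≠ 0)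
    have hℓle : ℓ ≤ Q ^ m := by
      refine (Nat.le_of_dvd (Finset.prod_pos fun i _ => (hq1 i).1)
        (Finset.lcm_dvd fun i hi => Finset.dvd_prod_of_mem q' hi)).trans ?_
      calc ∏ i, q' i ≤ ∏ _i : Fin m, Q := Finset.prod_le_prod' fun i _ => (hq1 i).2
        _ = Q ^ m := by simp
    have hpt : ∀ y, ∑ q ∈ Finset.Icc 1 Q, mulAverage (Nat.gcd q ℓ) (G q) y ≤ T * M y := by
      intro y
      calc ∑ q ∈ Finset.Icc 1 Q, mulAverage (Nat.gcd q ℓ) (G q) y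
          = ∑ g ∈ ℓ.divisors, ∑ q ∈ Finset.Icc 1 Q with Nat.gcd q ℓ = g,
              mulAverage (Nat.gcd q ℓ) (G q) y := by
            rw [Finset.sum_fiberwise_of_maps_to]
            exact fun q _ => Nat.mem_divisors.mpr ⟨Nat.gcd_dvd_right _ _, hℓ0⟩
        _ ≤ ∑ g ∈ ℓ.divisors, M y := by
            refine Finset.sum_le_sum fun g hg => ?_
            by_cases hgQ : g ≤ Q
            · have hg1 : 1 ≤ g := Nat.pos_of_mem_divisors hg
              refine le_trans ?_ (hM1 y g (Finset.mem_Icc.mpr ⟨hg1, hgQ⟩))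
              calc _ = ∑ q ∈ Finset.Icc 1 Q with Nat.gcd q ℓ = g, mulAverage g (G q) y :=
                    Finset.sum_congr rfl fun q hq => by rw [(Finset.mem_filter.mp hq).2]
                _ ≤ _ := by
                    refine Finset.sum_le_sum_of_subset_of_nonneg ?_
                      fun q _ _ => mulAverage_nonneg _ (hG q) y
                    intro q hq
                    rw [Finset.mem_filter] at hq ⊢
                    exact ⟨hq.1, hq.2 ▸ Nat.gcd_dvd_left _ _⟩
            · rw [Finset.sum_eq_zero]
              · exact hM0 y
              · intro q hq
                rw [Finset.mem_filter, Finset.mem_Icc] at hq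
                have := Nat.le_of_dvd (by omega) (Nat.gcd_dvd_left q ℓ)
                omega
        _ ≤ T * M y := by
            rw [Finset.sum_const, nsmul_eq_mul]
            refine mul_le_mul_of_nonneg_right ?_ (hM0 y)
            exact_mod_cast hT ℓ (Finset.mem_Icc.mpr ⟨Nat.pos_of_ne_zero hℓ0, hℓle⟩)
    calc ∑ y, S y * ∏ j, G (q' j) y
        = ∑ q ∈ Finset.Icc 1 Q, ∑ y, G q y * ∏ j, G (q' j) y := by
          rw [Finset.sum_comm]
          simp_rw [← Finset.sum_mul]
          rfl
      _ = ∑ q ∈ Finset.Icc 1 Q, ∑ y, mulAverage (Nat.gcd q ℓ) (G q) y * ∏ j, G (q' j) y :=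
          Finset.sum_congr rfl fun q hq => sum_mul_eq_sum_mulAverage_mul (hGp q hq) hR
      _ = ∑ y, (∑ q ∈ Finset.Icc 1 Q, mulAverage (Nat.gcd q ℓ) (G q) y) * ∏ j, G (q' j) y := by
          rw [Finset.sum_comm]
          simp_rw [← Finset.sum_mul]
      _ ≤ _ := Finset.sum_le_sum fun y _ =>
          mul_le_mul_of_nonneg_right (hpt y) (Finset.prod_nonneg fun _ _ => hG _ _)
  have h1 : ∑ y, S y ^ (m + 1) ≤ ∑ y, (T * M y) * S y ^ m := by
    have e1 : ∀ U : Y → ℝ, ∑ y, U y * S y ^ m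
        = ∑ q' ∈ Fintype.piFinset fun _ : Fin m => Finset.Icc 1 Q, ∑ y, U y * ∏ j, G (q' j) y := by
      intro U
      rw [Finset.sum_comm]
      simp_rw [← Finset.mul_sum, hpow]
    simp_rw [pow_succ']
    rw [e1, e1]
    exact Finset.sum_le_sum hstep
  have h2 : ∑ y, (T * M y) * S y ^ m
      ≤ ∑ y, (S y ^ (m + 1) / 2 + 2 ^ m * (T * M y) ^ (m + 1)) :=
    Finset.sum_le_sum fun y _ =>
      mul_pow_le_half_pow_succ_add (hS y) (mul_nonneg (by positivity) (hM0 y)) m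
  rw [Finset.sum_add_distrib, ← Finset.sum_div, ← Finset.mul_sum] at h2
  have h3 : ∑ y, (T * M y) ^ (m + 1)
      ≤ (T : ℝ) ^ (m + 1) * ∑ g ∈ Finset.Icc 1 Q, ∑ y, H g y ^ (m + 1) := by
    rw [Finset.sum_comm, Finset.mul_sum]
    refine Finset.sum_le_sum fun y _ => ?_
    rw [mul_pow]
    exact mul_le_mul_of_nonneg_left (hM2 y) (by positivity)
  have h4 : ∑ y, S y ^ (m + 1) ≤ 2 ^ (m + 1) * ∑ y, (T * M y) ^ (m + 1) := by
    rw [pow_succ (2 : ℝ)]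
    linarith
  rw [mul_assoc]
  exact h4.trans (mul_le_mul_of_nonneg_left h3 (by positivity))

end FiniteGroup

section Characters

theorem sum_divisors_moebius_eq_ite (n : ℕ) :
    ∑ d ∈ n.divisors, ArithmeticFunction.moebius d = if n = 1 then 1 else 0 := by
  rw [← ArithmeticFunction.coe_mul_zeta_apply, ArithmeticFunction.moebius_mul_coe_zeta,
    ArithmeticFunction.one_apply]

open Classical in
theorem orderOf_eq_indicator {G : Type*} [Group G] (x : G) {q : ℕ} (hq : q ≠ 0) :
    (if orderOf x = q then (1 : ℤ) else 0)
      = ∑ d ∈ q.divisors, if x ^ (q / d) = 1 then ArithmeticFunction.moebius d else 0 := by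
  rw [← Finset.sum_filter]
  by_cases hx : orderOf x ∣ q
  · have hx0 : orderOf x ≠ 0 := ne_zero_of_dvd_ne_zero hq hx
    obtain ⟨e, rfl⟩ := hx
    have he : e ≠ 0 := right_ne_zero_of_mul hq
    have hset : (orderOf x * e).divisors.filter (fun d => x ^ (orderOf x * e / d) = 1)
        = e.divisors := by
      ext d
      rw [Finset.mem_filter, Nat.mem_divisors, Nat.mem_divisors, ← orderOf_dvd_iff_pow_eq_one]
      constructor
      · rintro ⟨⟨⟨c, hc⟩, -⟩, h2⟩
        have hd0 : 0 < d := by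
          rcases Nat.eq_zero_or_pos d with h | h
          · rw [h, zero_mul] at hc; exact absurd hc hq
          · exact h
        rw [hc, Nat.mul_div_cancel_left _ hd0] at h2
        obtain ⟨k, rfl⟩ := h2
        refine ⟨⟨k, ?_⟩, he⟩
        have : orderOf x * e = orderOf x * (d * k) := by rw [hc]; ring
        exact Nat.eq_of_mul_eq_mul_left (Nat.pos_of_ne_zero hx0) this
      · rintro ⟨⟨k, rfl⟩, -⟩
        have hd0 : 0 < d := Nat.pos_of_ne_zero (left_ne_zero_of_mul he)
        refine ⟨⟨⟨orderOf x * k, by ring⟩, hq⟩, ⟨k, ?_⟩⟩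
        rw [show orderOf x * (d * k) = d * (orderOf x * k) by ring, Nat.mul_div_cancel_left _ hd0]
    rw [hset, sum_divisors_moebius_eq_ite e]
    congr 1
    simp [hx0]
  · rw [if_neg (fun h : orderOf x = q => hx (dvd_of_eq h)), Finset.sum_eq_zero]
    intro d hd
    rw [Finset.mem_filter, Nat.mem_divisors] at hd
    exact absurd ((orderOf_dvd_of_pow_eq_one hd.2).trans (Nat.div_dvd_of_dvd hd.1.1)) hx

variable {Y : Type*} [AddCommGroup Y] [Fintype Y]

theorem sum_normSq_character_sum (X : AddChar Y ℂ → ℂ) :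
    ∑ y, ‖∑ κ, X κ * κ y‖ ^ 2 = Fintype.card Y * ∑ κ, ‖X κ‖ ^ 2 := by
  classical
  have h : ((∑ y, ‖∑ κ, X κ * κ y‖ ^ 2 : ℝ) : ℂ) = (Fintype.card Y * ∑ κ, ‖X κ‖ ^ 2 : ℝ) := by
    push_cast
    have h1 : ∀ y, ((‖∑ κ, X κ * κ y‖ : ℝ) : ℂ) ^ 2
        = ∑ κ, ∑ κ', X κ * (starRingEnd ℂ) (X κ') * (κ * κ'⁻¹) y := by
      intro y
      rw [← Complex.mul_conj', map_sum, Finset.sum_mul_sum]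
      refine Finset.sum_congr rfl fun κ _ => Finset.sum_congr rfl fun κ' _ => ?_
      rw [map_mul, ← AddChar.map_neg_eq_conj, AddChar.mul_apply, AddChar.inv_apply]
      ring
    simp_rw [h1]
    rw [Finset.sum_comm, Finset.mul_sum]
    refine Finset.sum_congr rfl fun κ _ => ?_
    rw [Finset.sum_comm, Finset.sum_eq_single κ]
    · simp [Complex.mul_conj', mul_comm]
    · intro κ' _ hne
      rw [← Finset.mul_sum, AddChar.sum_eq_zero_of_ne_one, mul_zero]
      rw [Ne, mul_inv_eq_one]
      exact hne.symm
    · simp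
  exact_mod_cast h

/-- The part of a character expansion carried by the characters of order `q`. -/
noncomputable def orderPart (c : AddChar Y ℂ → ℂ) (q : ℕ) (y : Y) : ℂ :=
  ∑ ψ with orderOf ψ = q, c ψ * ψ y

open Classical in
/-- The part of a character expansion carried by the characters whose `g`-th power is `κ`. -/
noncomputable def fiberPart (c : AddChar Y ℂ → ℂ) (g : ℕ) (κ : AddChar Y ℂ) (y : Y) : ℂ :=
  ∑ ψ with ψ ^ g = κ, c ψ * ψ y

theorem orderPart_invariant (c : AddChar Y ℂ → ℂ) (q : ℕ) (y t : Y) :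
    orderPart c q (y + q • t) = orderPart c q y := by
  refine Finset.sum_congr rfl fun ψ hψ => ?_
  have : ψ ^ q = 1 := by rw [← (Finset.mem_filter.mp hψ).2]; exact pow_orderOf_eq_one ψ
  rw [AddChar.map_add_eq_mul, AddChar.map_nsmul_eq_pow, ← AddChar.pow_apply, this]
  simp

theorem sum_orderPart_eq_zero (c : AddChar Y ℂ → ℂ) (q ℓ : ℕ) (h : ¬ q ∣ ℓ) (y : Y) :
    ∑ t, orderPart c q (y + ℓ • t) = 0 := by
  unfold orderPart
  rw [Finset.sum_comm]
  refine Finset.sum_eq_zero fun ψ hψ => ?_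
  have hne : ψ ^ ℓ ≠ 1 := fun h1 => h ((Finset.mem_filter.mp hψ).2 ▸ orderOf_dvd_of_pow_eq_one h1)
  simp_rw [AddChar.map_add_eq_mul, AddChar.map_nsmul_eq_pow, ← AddChar.pow_apply, ← mul_assoc]
  rw [← Finset.mul_sum, AddChar.sum_eq_zero_of_ne_one hne, mul_zero]

theorem sum_normSq_orderPart (c : AddChar Y ℂ → ℂ) (q : ℕ) :
    ∑ y, ‖orderPart c q y‖ ^ 2 = Fintype.card Y * ∑ ψ with orderOf ψ = q, ‖c ψ‖ ^ 2 := by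
  have := sum_normSq_character_sum fun ψ => if orderOf ψ = q then c ψ else 0
  simp only [orderPart, Finset.sum_filter]
  convert this using 5
  · simp only [ite_mul, zero_mul]
  · split_ifs <;> simp

theorem sum_mulAverage (g : ℕ) (F : Y → ℝ) : ∑ y, mulAverage g F y = ∑ y, F y := by
  have hc : (Fintype.card Y : ℝ) ≠ 0 := by
    exact_mod_cast (Fintype.card_pos_iff.mpr ⟨(0 : Y)⟩).ne'
  have := card_mul_sum_mul_eq F (fun _ => (1 : ℝ)) (ℓ := g) (fun _ _ => rfl)
  simp only [mul_one] at this
  unfold mulAverage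
  rw [← Finset.mul_sum, ← this, inv_mul_cancel_left₀ hc]

open Classical in
theorem mulAverage_normSq_orderPart (c : AddChar Y ℂ → ℂ) (g q : ℕ) (y : Y) :
    mulAverage g (fun y => ‖orderPart c q y‖ ^ 2) y
      = ∑ κ, ‖∑ ψ with orderOf ψ = q ∧ ψ ^ g = κ, c ψ * ψ y‖ ^ 2 := by
  have hc : (Fintype.card Y : ℝ) ≠ 0 := by
    exact_mod_cast (Fintype.card_pos_iff.mpr ⟨(0 : Y)⟩).ne'
  have h := sum_normSq_character_sum fun κ : AddChar Y ℂ =>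
    ∑ ψ with orderOf ψ = q ∧ ψ ^ g = κ, c ψ * ψ y
  have h2 : ∀ t, orderPart c q (y + g • t)
      = ∑ κ : AddChar Y ℂ, (∑ ψ with orderOf ψ = q ∧ ψ ^ g = κ, c ψ * ψ y) * κ t := by
    intro t
    unfold orderPart
    rw [← Finset.sum_fiberwise (Finset.univ.filter fun ψ : AddChar Y ℂ => orderOf ψ = q)
      (fun ψ => ψ ^ g)]
    refine Finset.sum_congr rfl fun κ _ => ?_
    rw [Finset.filter_filter, Finset.sum_mul]
    refine Finset.sum_congr rfl fun ψ hψ => ?_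
    rw [← (Finset.mem_filter.mp hψ).2.2, AddChar.map_add_eq_mul, AddChar.map_nsmul_eq_pow,
      AddChar.pow_apply, mul_assoc]
  unfold mulAverage
  simp_rw [h2]
  rw [h, inv_mul_cancel_left₀ hc]

open Classical in
theorem normSq_sum_pow_eq_le (c : AddChar Y ℂ → ℂ) {g m Q : ℕ} (hg : 0 < g) (hm : 1 ≤ m)
    (hmQ : m ≤ Q) (κ : AddChar Y ℂ) (y : Y) :
    ‖∑ ψ with ψ ^ g = κ ∧ ψ ^ m = 1, c ψ * ψ y‖ ^ 2
      ≤ ∑ g' ∈ g.divisors, ∑ μ : AddChar Y ℂ with orderOf μ ≤ Q ∧ μ ^ (g / g') = κ,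
        ‖fiberPart c g' μ y‖ ^ 2 := by
  rcases Finset.eq_empty_or_nonempty
    (Finset.univ.filter fun ψ : AddChar Y ℂ => ψ ^ g = κ ∧ ψ ^ m = 1) with h | ⟨ψ₀, h₀⟩
  · rw [h]
    simp only [Finset.sum_empty, norm_zero, ne_eq, OfNat.ofNat_ne_zero, not_false_eq_true,
      zero_pow]
    exact Finset.sum_nonneg fun _ _ => Finset.sum_nonneg fun _ _ => by positivity
  · obtain ⟨h1, h2⟩ := (Finset.mem_filter.mp h₀).2
    set g' := Nat.gcd g m
    have hg'g : g' ∣ g := Nat.gcd_dvd_left _ _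
    have hg'm : g' ∣ m := Nat.gcd_dvd_right _ _
    have hset : (Finset.univ.filter fun ψ : AddChar Y ℂ => ψ ^ g = κ ∧ ψ ^ m = 1)
        = Finset.univ.filter fun ψ : AddChar Y ℂ => ψ ^ g' = ψ₀ ^ g' := by
      ext ψ
      simp only [Finset.mem_filter, Finset.mem_univ, true_and]
      constructor
      · rintro ⟨h3, h4⟩
        have key : ∀ χ : AddChar Y ℂ, χ ^ g = κ → χ ^ m = 1 →
            χ ^ g' = κ ^ Nat.gcdA g m := by
          intro χ hχ1 hχ2
          rw [← zpow_natCast, Nat.gcd_eq_gcd_ab, zpow_add, zpow_mul, zpow_mul, zpow_natCast,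
            zpow_natCast, hχ1, hχ2, one_zpow, mul_one]
        rw [key ψ h3 h4, key ψ₀ h1 h2]
      · intro h3
        constructor
        · rw [← h1, ← Nat.mul_div_cancel' hg'g, pow_mul, pow_mul, h3]
        · rw [← h2, ← Nat.mul_div_cancel' hg'm, pow_mul, pow_mul, h3]
    rw [hset]
    have hmem : ψ₀ ^ g' ∈ Finset.univ.filter fun μ : AddChar Y ℂ =>
        orderOf μ ≤ Q ∧ μ ^ (g / g') = κ := by
      rw [Finset.mem_filter]
      refine ⟨Finset.mem_univ _, ?_, ?_⟩
      · refine (Nat.le_of_dvd hm (orderOf_dvd_of_pow_eq_one ?_)).trans hmQ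
        rw [← pow_mul, mul_comm, pow_mul, h2, one_pow]
      · rw [← pow_mul, Nat.mul_div_cancel' hg'g, h1]
    refine le_trans ?_ (Finset.single_le_sum (f := fun g' =>
      ∑ μ : AddChar Y ℂ with orderOf μ ≤ Q ∧ μ ^ (g / g') = κ, ‖fiberPart c g' μ y‖ ^ 2)
      (fun _ _ => Finset.sum_nonneg fun _ _ => by positivity)
      (Nat.mem_divisors.mpr ⟨hg'g, hg.ne'⟩))
    exact Finset.single_le_sum (f := fun μ => ‖fiberPart c g' μ y‖ ^ 2)
      (fun _ _ => by positivity) hmem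

open Classical in
theorem normSq_sum_orderOf_eq_le (c : AddChar Y ℂ → ℂ) {g q Q T : ℕ} (hg : 0 < g) (hq : 1 ≤ q)
    (hqQ : q ≤ Q) (hT : q.divisors.card ≤ T) (κ : AddChar Y ℂ) (y : Y) :
    ‖∑ ψ with orderOf ψ = q ∧ ψ ^ g = κ, c ψ * ψ y‖ ^ 2
      ≤ (T : ℝ) ^ 2 * ∑ g' ∈ g.divisors, ∑ μ : AddChar Y ℂ with orderOf μ ≤ Q ∧ μ ^ (g / g') = κ,
        ‖fiberPart c g' μ y‖ ^ 2 := by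
  set B := ∑ g' ∈ g.divisors, ∑ μ : AddChar Y ℂ with orderOf μ ≤ Q ∧ μ ^ (g / g') = κ,
        ‖fiberPart c g' μ y‖ ^ 2
  have hB : 0 ≤ B := Finset.sum_nonneg fun _ _ => Finset.sum_nonneg fun _ _ => by positivity
  have hX : ∑ ψ with orderOf ψ = q ∧ ψ ^ g = κ, c ψ * ψ y
      = ∑ d ∈ q.divisors, (ArithmeticFunction.moebius d : ℂ) *
        ∑ ψ with ψ ^ g = κ ∧ ψ ^ (q / d) = 1, c ψ * ψ y := by
    simp_rw [Finset.mul_sum, Finset.sum_filter]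
    rw [Finset.sum_comm]
    refine Finset.sum_congr rfl fun ψ _ => ?_
    by_cases h : ψ ^ g = κ
    · have := congrArg (fun z : ℤ => (z : ℂ) * (c ψ * ψ y))
        (orderOf_eq_indicator ψ (by omega : q ≠ 0))
      simp only [Int.cast_sum, Finset.sum_mul] at this
      simp only [h, and_true, true_and]
      convert this using 2
      · split_ifs <;> simp
      · split_ifs <;> simp
    · simp [h]
  have hn : ‖∑ ψ with orderOf ψ = q ∧ ψ ^ g = κ, c ψ * ψ y‖
      ≤ ∑ d ∈ q.divisors, ‖∑ ψ with ψ ^ g = κ ∧ ψ ^ (q / d) = 1, c ψ * ψ y‖ := by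
    rw [hX]
    refine (norm_sum_le _ _).trans (Finset.sum_le_sum fun d _ => ?_)
    rw [norm_mul]
    refine mul_le_of_le_one_left (norm_nonneg _) ?_
    rw [Complex.norm_intCast]
    exact_mod_cast ArithmeticFunction.abs_moebius_le_one
  calc _ ≤ (∑ d ∈ q.divisors, ‖∑ ψ with ψ ^ g = κ ∧ ψ ^ (q / d) = 1, c ψ * ψ y‖) ^ 2 :=
        pow_le_pow_left₀ (norm_nonneg _) hn 2
    _ ≤ q.divisors.card * ∑ d ∈ q.divisors,
          ‖∑ ψ with ψ ^ g = κ ∧ ψ ^ (q / d) = 1, c ψ * ψ y‖ ^ 2 := sq_sum_le_card_mul_sum_sq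
    _ ≤ q.divisors.card * ∑ d ∈ q.divisors, B := by
        gcongr with d hd
        have hd' := Nat.mem_divisors.mp hd
        refine normSq_sum_pow_eq_le c hg ?_ ?_ κ y
        · exact Nat.div_pos (Nat.le_of_dvd hq hd'.1) (Nat.pos_of_mem_divisors hd)
        · exact (Nat.div_le_self _ _).trans hqQ
    _ ≤ (T : ℝ) * (T * B) := by
        rw [Finset.sum_const, nsmul_eq_mul]
        gcongr
    _ = _ := by ring

theorem sum_mulAverage_orderPart_le (c : AddChar Y ℂ → ℂ) {g Q T : ℕ} (hg : 0 < g)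
    (hT : ∀ k ∈ Finset.Icc 1 Q, k.divisors.card ≤ T) (y : Y) :
    ∑ q ∈ Finset.Icc 1 Q with g ∣ q, mulAverage g (fun y => ‖orderPart c q y‖ ^ 2) y
      ≤ (T : ℝ) ^ 2 * ∑ g' ∈ g.divisors, ∑ μ : AddChar Y ℂ with orderOf μ ≤ Q,
        ‖fiberPart c g' μ y‖ ^ 2 := by
  classical
  simp_rw [mulAverage_normSq_orderPart]
  rw [Finset.sum_comm]
  have hR : ∑ g' ∈ g.divisors, ∑ μ : AddChar Y ℂ with orderOf μ ≤ Q, ‖fiberPart c g' μ y‖ ^ 2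
      = ∑ κ : AddChar Y ℂ, ∑ g' ∈ g.divisors,
        ∑ μ : AddChar Y ℂ with orderOf μ ≤ Q ∧ μ ^ (g / g') = κ, ‖fiberPart c g' μ y‖ ^ 2 := by
    rw [Finset.sum_comm (s := Finset.univ) (t := g.divisors)]
    refine Finset.sum_congr rfl fun g' _ => ?_
    rw [← Finset.sum_fiberwise (Finset.univ.filter fun μ : AddChar Y ℂ => orderOf μ ≤ Q)
      (fun μ => μ ^ (g / g'))]
    simp_rw [Finset.filter_filter]
  rw [hR, Finset.mul_sum]
  refine Finset.sum_le_sum fun κ _ => ?_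
  set R := (T : ℝ) ^ 2 * ∑ g' ∈ g.divisors,
    ∑ μ : AddChar Y ℂ with orderOf μ ≤ Q ∧ μ ^ (g / g') = κ, ‖fiberPart c g' μ y‖ ^ 2 with hRdef
  have hR0 : 0 ≤ R := mul_nonneg (by positivity)
    (Finset.sum_nonneg fun _ _ => Finset.sum_nonneg fun _ _ => by positivity)
  have hz : ∀ q ∈ (Finset.Icc 1 Q).filter (fun q => g ∣ q), q ≠ g * orderOf κ →
      ‖∑ ψ with orderOf ψ = q ∧ ψ ^ g = κ, c ψ * ψ y‖ ^ 2 = 0 := by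
    intro q hq hne
    rw [Finset.sum_eq_zero]
    · simp
    · intro ψ hψ
      obtain ⟨-, h1, h2⟩ := Finset.mem_filter.mp hψ
      refine absurd ?_ hne
      have hgq := (Finset.mem_filter.mp hq).2
      rw [← h2, orderOf_pow_of_dvd hg.ne' (h1.symm ▸ hgq), h1, Nat.mul_div_cancel' hgq]
  by_cases hmem : g * orderOf κ ∈ (Finset.Icc 1 Q).filter (fun q => g ∣ q)
  · rw [Finset.sum_eq_single_of_mem _ hmem hz]
    have h1 := (Finset.mem_filter.mp hmem).1
    have h2 := Finset.mem_Icc.mp h1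
    exact normSq_sum_orderOf_eq_le c hg h2.1 h2.2 (hT _ h1) κ y
  · rw [Finset.sum_eq_zero fun q hq => hz q hq fun h => hmem (h ▸ hq)]
    exact hR0

end Characters

section LargeSieve

theorem tsum_int_add_right {E : Type*} [AddCommMonoid E] [TopologicalSpace E] (f : ℤ → E) (c : ℤ) :
    ∑' u, f (u + c) = ∑' u, f u :=
  (Equiv.addRight c).tsum_eq f

theorem tsum_int_const_sub {E : Type*} [AddCommMonoid E] [TopologicalSpace E] (f : ℤ → E) (c : ℤ) :
    ∑' u, f (c - u) = ∑' u, f u :=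
  (Equiv.subLeft c).tsum_eq f

theorem Summable.int_const_sub {E : Type*} [AddCommMonoid E] [TopologicalSpace E] {f : ℤ → E}
    (hf : Summable f) (c : ℤ) : Summable fun u => f (c - u) :=
  (Equiv.subLeft c).summable_iff.mpr hf

theorem Summable.int_add_right {E : Type*} [AddCommMonoid E] [TopologicalSpace E] {f : ℤ → E}
    (hf : Summable f) (c : ℤ) : Summable fun u => f (u + c) :=
  (Equiv.addRight c).summable_iff.mpr hf

/-- The total variation of a function on the integers. -/
noncomputable def totalVariation (W : ℤ → ℝ) : ℝ := ∑' u, |W u - W (u - 1)|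

theorem summable_abs_sub_shift {W : ℤ → ℝ} (hW : Summable W) (j : ℤ) :
    Summable fun u => |W u - W (u - j)| :=
  (hW.sub (by simpa [sub_eq_add_neg] using hW.int_add_right (-j))).abs

theorem tsum_abs_sub_shift_le {W : ℤ → ℝ} (hW : Summable W) (j : ℕ) :
    ∑' u, |W u - W (u - j)| ≤ j * totalVariation W := by
  induction j with
  | zero => simp
  | succ j ih =>
    have h1 := summable_abs_sub_shift hW j
    have h2 : Summable fun u : ℤ => |W (u - j) - W (u - j - 1)| := by
      have := (summable_abs_sub_shift hW 1).int_add_right (-j)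
      simpa [sub_eq_add_neg] using this
    have h3 : ∑' u : ℤ, |W (u - j) - W (u - j - 1)| = totalVariation W := by
      have := tsum_int_add_right (fun u : ℤ => |W u - W (u - 1)|) (-j)
      simpa [sub_eq_add_neg, totalVariation] using this
    calc ∑' u : ℤ, |W u - W (u - (j + 1 : ℕ))|
        ≤ ∑' u : ℤ, (|W u - W (u - j)| + |W (u - j) - W (u - j - 1)|) := by
          refine Summable.tsum_le_tsum (fun u => ?_) (summable_abs_sub_shift hW _) (h1.add h2)
          have : u - ((j + 1 : ℕ) : ℤ) = u - j - 1 := by push_cast; ring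
          rw [this]
          exact abs_sub_le _ _ _
      _ = ∑' u : ℤ, |W u - W (u - j)| + totalVariation W := by rw [h1.tsum_add h2, h3]
      _ ≤ _ := by push_cast; linarith

theorem totalVariation_nonneg (W : ℤ → ℝ) : 0 ≤ totalVariation W :=
  tsum_nonneg fun _ => abs_nonneg _

theorem summable_ite {E : Type*} [NormedAddCommGroup E] [CompleteSpace E] {W : ℤ → E}
    (hW : Summable fun u => ‖W u‖) (p : ℤ → Prop) [DecidablePred p] :
    Summable fun u => if p u then W u else 0 := by
  refine Summable.of_norm_bounded hW fun u => ?_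
  split_ifs <;> simp

theorem sum_range_ite_dvd {g : ℕ} (hg : 0 < g) (z : ℤ) (a : ℝ) :
    ∑ j ∈ Finset.range g, (if (g : ℤ) ∣ z - j then a else 0) = a := by
  have hg' : (g : ℤ) ≠ 0 := by omega
  have h0 := Int.emod_nonneg z hg'
  have h1 := Int.emod_lt_of_pos z (by omega : (0 : ℤ) < g)
  rw [Finset.sum_eq_single (z % g).toNat]
  · rw [if_pos]
    rw [Int.toNat_of_nonneg h0]
    exact Int.dvd_self_sub_emod
  · intro j hj hne
    rw [if_neg]
    intro hd
    apply hne
    have hj' := Finset.mem_range.mp hj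
    have : z % g = (j : ℤ) % g := (Int.modEq_iff_dvd.mpr hd).symm
    rw [this, Int.emod_eq_of_lt (by omega) (by omega)]
    simp
  · intro h
    exact absurd (Finset.mem_range.mpr (by omega)) h

theorem tsum_ite_dvd_le {W : ℤ → ℝ} (hW : Summable W) {g : ℕ} (hg : 0 < g)
    (x y : ℤ) :
    g * ∑' u, (if (g : ℤ) ∣ y - u then W (x - u) else 0)
      ≤ ∑' u, W u + g ^ 2 * totalVariation W := by
  have hWx := hW.int_const_sub x
  have hs : ∀ j : ℕ, Summable fun u : ℤ => if (g : ℤ) ∣ y - u then W (x - u - j) else 0 := by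
    intro j
    refine summable_ite ?_ _
    have := (hW.int_const_sub (x - j)).norm
    convert this using 3 with u
    ring_nf
  have hs0 : Summable fun u : ℤ => if (g : ℤ) ∣ y - u then W (x - u) else 0 := by
    simpa using hs 0
  have h1 : ∀ j ∈ Finset.range g, ∑' u, (if (g : ℤ) ∣ y - u then W (x - u) else 0)
      ≤ ∑' u, (if (g : ℤ) ∣ y - u then W (x - u - j) else 0) + g * totalVariation W := by
    intro j hj
    have hj' : (j : ℝ) ≤ g := by exact_mod_cast (Finset.mem_range.mp hj).le
    have hsab : Summable fun u : ℤ => |W (x - u) - W (x - u - j)| :=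
      (summable_abs_sub_shift hW j).int_const_sub x
    have h2 : ∑' u : ℤ, |W (x - u) - W (x - u - j)| ≤ j * totalVariation W :=
      (tsum_int_const_sub (fun u => |W u - W (u - j)|) x).trans_le (tsum_abs_sub_shift_le hW j)
    have h3 : j * totalVariation W ≤ g * totalVariation W :=
      mul_le_mul_of_nonneg_right hj' (totalVariation_nonneg W)
    have h4 := Summable.tsum_le_tsum (f := fun u : ℤ => if (g : ℤ) ∣ y - u then W (x - u) else 0)
      (g := fun u : ℤ => (if (g : ℤ) ∣ y - u then W (x - u - j) else 0)
        + |W (x - u) - W (x - u - j)|) (fun u => ?_) hs0 ((hs j).add hsab)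
    · rw [(hs j).tsum_add hsab] at h4
      linarith
    · split_ifs
      · linarith [le_abs_self (W (x - u) - W (x - u - j))]
      · simp
  have h5 : ∑ j ∈ Finset.range g, ∑' u, (if (g : ℤ) ∣ y - u then W (x - u - j) else 0)
      = ∑' u, W u := by
    have h6 : ∀ j : ℕ, ∑' u, (if (g : ℤ) ∣ y - u then W (x - u - j) else 0)
        = ∑' u, (if (g : ℤ) ∣ (y - u) + j then W (x - u) else 0) := by
      intro j
      rw [← tsum_int_add_right _ (-(j : ℤ))]
      refine tsum_congr fun u => ?_
      rw [show y - (u + -(j : ℤ)) = y - u + j by ring, show x - (u + -(j : ℤ)) - j = x - u by ring]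
    have h7 : ∀ j : ℕ, Summable fun u : ℤ => if (g : ℤ) ∣ (y - u) + j then W (x - u) else 0 :=
      fun j => summable_ite hWx.norm _
    simp_rw [h6]
    rw [← Summable.tsum_finsetSum fun j _ => h7 j, ← tsum_int_const_sub W x]
    refine tsum_congr fun u => ?_
    refine Eq.trans ?_ (sum_range_ite_dvd hg (-(y - u)) (W (x - u)))
    refine Finset.sum_congr rfl fun j _ => if_congr ?_ rfl rfl
    rw [← dvd_neg]
    ring_nf
  have h8 := Finset.sum_le_sum h1
  rw [Finset.sum_add_distrib, h5, Finset.sum_const, Finset.sum_const, Finset.card_range,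
    nsmul_eq_mul, nsmul_eq_mul] at h8
  linarith

theorem norm_one_sub_ge_of_pow_eq_one {ζ : ℂ} {n : ℕ} (hn : 0 < n) (h : ζ ^ n = 1) (h1 : ζ ≠ 1) :
    1 ≤ n * ‖1 - ζ‖ := by
  have hζ : ‖ζ‖ = 1 := Complex.norm_eq_one_of_pow_eq_one h hn.ne'
  have hg : ∑ j ∈ Finset.range n, ζ ^ j = 0 := by
    have := geom_sum_mul ζ n
    rw [h, sub_self] at this
    exact (mul_eq_zero.mp this).resolve_right (sub_ne_zero.mpr h1)
  have hb : ∀ j ∈ Finset.range n, ‖1 - ζ ^ j‖ ≤ n * ‖1 - ζ‖ := by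
    intro j hj
    have : 1 - ζ ^ j = (∑ i ∈ Finset.range j, ζ ^ i) * (1 - ζ) := (geom_sum_mul_neg ζ j).symm
    rw [this, norm_mul]
    refine mul_le_mul_of_nonneg_right ?_ (norm_nonneg _)
    refine (norm_sum_le _ _).trans ?_
    simp only [norm_pow, hζ, one_pow, Finset.sum_const, Finset.card_range, nsmul_eq_mul, mul_one]
    exact_mod_cast (Finset.mem_range.mp hj).le
  have h2 : (n : ℂ) = ∑ j ∈ Finset.range n, (1 - ζ ^ j) := by
    rw [Finset.sum_sub_distrib, hg]; simp
  have h3 : (n : ℝ) ≤ n * (n * ‖1 - ζ‖) := by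
    calc (n : ℝ) = ‖(n : ℂ)‖ := by simp
      _ ≤ ∑ j ∈ Finset.range n, ‖1 - ζ ^ j‖ := by rw [h2]; exact norm_sum_le _ _
      _ ≤ ∑ j ∈ Finset.range n, n * ‖1 - ζ‖ := Finset.sum_le_sum hb
      _ = _ := by simp
  have hn' : (0 : ℝ) < n := by exact_mod_cast hn
  exact le_of_mul_le_mul_left (by linarith) hn'

/-- Duality form of the large sieve: almost orthogonality of bounded functions gives a Bessel
inequality. -/
theorem sum_normSq_le_of_row_sum_le {Λ : Type*} (s : Finset Λ) {w : ℤ → ℝ} (hw : Summable w)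
    (hw0 : ∀ u, 0 ≤ w u) (b : Λ → ℤ → ℂ) (hb : ∀ i u, ‖b i u‖ ≤ 1) {R : ℝ}
    (hR0 : 0 ≤ R)
    (hR : ∀ i ∈ s, ∑ j ∈ s, ‖∑' u, (w u : ℂ) * (b i u * (starRingEnd ℂ) (b j u))‖ ≤ R)
    (U : Finset ℤ) (v : ℤ → ℂ) (V : ℤ → ℝ) (hV : ∀ u ∈ U, 0 ≤ V u)
    (hv : ∀ u ∈ U, ‖v u‖ ^ 2 ≤ V u * w u) :
    ∑ i ∈ s, ‖∑ u ∈ U, v u * b i u‖ ^ 2 ≤ R * ∑ u ∈ U, V u := by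
  set a : Λ → ℂ := fun i => ∑ u ∈ U, v u * b i u
  set S := ∑ i ∈ s, ‖a i‖ ^ 2
  have hS0 : 0 ≤ S := Finset.sum_nonneg fun _ _ => by positivity
  set B : ℤ → ℂ := fun u => ∑ i ∈ s, (starRingEnd ℂ) (a i) * b i u
  have hsum2 : ∀ i j, Summable fun u => (w u : ℂ) * (b i u * (starRingEnd ℂ) (b j u)) := by
    intro i j
    refine Summable.of_norm_bounded hw fun u => ?_
    rw [norm_mul, norm_mul, RCLike.norm_conj, Complex.norm_real, Real.norm_eq_abs,
      abs_of_nonneg (hw0 u)]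
    refine mul_le_of_le_one_right (hw0 u) ?_
    exact mul_le_one₀ (hb i u) (norm_nonneg _) (hb j u)
  have h1 : (S : ℂ) = ∑ u ∈ U, v u * B u := by
    simp only [S, B, Complex.ofReal_sum, Finset.mul_sum]
    rw [Finset.sum_comm]
    refine Finset.sum_congr rfl fun i _ => ?_
    push_cast
    rw [← Complex.mul_conj']
    conv_lhs => rw [show a i = ∑ u ∈ U, v u * b i u from rfl, Finset.sum_mul]
    exact Finset.sum_congr rfl fun u _ => by ring
  have hBexp : ∀ u, ((w u * ‖B u‖ ^ 2 : ℝ) : ℂ) = ∑ i ∈ s, ∑ j ∈ s,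
      ((starRingEnd ℂ) (a i) * a j) * ((w u : ℂ) * (b i u * (starRingEnd ℂ) (b j u))) := by
    intro u
    push_cast
    rw [← Complex.mul_conj', map_sum, Finset.sum_mul_sum, Finset.mul_sum]
    refine Finset.sum_congr rfl fun i _ => ?_
    rw [Finset.mul_sum]
    refine Finset.sum_congr rfl fun j _ => ?_
    rw [map_mul, Complex.conj_conj]
    ring
  have hsB' : Summable fun u => ((w u * ‖B u‖ ^ 2 : ℝ) : ℂ) := by
    simp_rw [hBexp]
    exact summable_sum fun i _ => summable_sum fun j _ => (hsum2 i j).mul_left _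
  have hsB : Summable fun u => w u * ‖B u‖ ^ 2 := Complex.summable_ofReal.mp hsB'
  have h2 : ∑ u ∈ U, w u * ‖B u‖ ^ 2 ≤ R * S := by
    calc ∑ u ∈ U, w u * ‖B u‖ ^ 2 ≤ ∑' u, w u * ‖B u‖ ^ 2 :=
          hsB.sum_le_tsum _ fun u _ => mul_nonneg (hw0 u) (by positivity)
      _ = ‖((∑' u, w u * ‖B u‖ ^ 2 : ℝ) : ℂ)‖ := by
          rw [Complex.norm_real, Real.norm_eq_abs, abs_of_nonneg]
          exact tsum_nonneg fun u => mul_nonneg (hw0 u) (by positivity)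
      _ = ‖∑ i ∈ s, ∑ j ∈ s, ((starRingEnd ℂ) (a i) * a j) *
            ∑' u, (w u : ℂ) * (b i u * (starRingEnd ℂ) (b j u))‖ := by
          rw [Complex.ofReal_tsum]
          simp_rw [hBexp]
          rw [Summable.tsum_finsetSum
            fun i _ => summable_sum fun j _ => (hsum2 i j).mul_left _]
          congr 1
          refine Finset.sum_congr rfl fun i _ => ?_
          rw [Summable.tsum_finsetSum fun j _ => (hsum2 i j).mul_left _]
          exact Finset.sum_congr rfl fun j _ => tsum_mul_left
      _ ≤ ∑ i ∈ s, ∑ j ∈ s, (‖a i‖ ^ 2 / 2 + ‖a j‖ ^ 2 / 2) *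
            ‖∑' u, (w u : ℂ) * (b i u * (starRingEnd ℂ) (b j u))‖ := by
          refine (norm_sum_le _ _).trans (Finset.sum_le_sum fun i _ => ?_)
          refine (norm_sum_le _ _).trans (Finset.sum_le_sum fun j _ => ?_)
          rw [norm_mul, norm_mul, RCLike.norm_conj]
          refine mul_le_mul_of_nonneg_right ?_ (norm_nonneg _)
          nlinarith [sq_nonneg (‖a i‖ - ‖a j‖)]
      _ = ∑ i ∈ s, ‖a i‖ ^ 2 *
            ∑ j ∈ s, ‖∑' u, (w u : ℂ) * (b i u * (starRingEnd ℂ) (b j u))‖ := by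
          simp_rw [add_mul, Finset.sum_add_distrib]
          have hsym : ∀ i j, ‖∑' u, (w u : ℂ) * (b i u * (starRingEnd ℂ) (b j u))‖
              = ‖∑' u, (w u : ℂ) * (b j u * (starRingEnd ℂ) (b i u))‖ := by
            intro i j
            rw [← RCLike.norm_conj, Complex.conj_tsum]
            congr 1
            refine tsum_congr fun u => ?_
            simp only [map_mul, Complex.conj_ofReal, Complex.conj_conj]
            ring
          have : ∑ i ∈ s, ∑ j ∈ s, ‖a j‖ ^ 2 / 2 *
                ‖∑' u, (w u : ℂ) * (b i u * (starRingEnd ℂ) (b j u))‖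
              = ∑ i ∈ s, ∑ j ∈ s, ‖a i‖ ^ 2 / 2 *
                ‖∑' u, (w u : ℂ) * (b i u * (starRingEnd ℂ) (b j u))‖ := by
            rw [Finset.sum_comm]
            exact Finset.sum_congr rfl fun i _ => Finset.sum_congr rfl fun j _ => by rw [hsym]
          rw [this, ← Finset.sum_add_distrib]
          refine Finset.sum_congr rfl fun i _ => ?_
          rw [← Finset.mul_sum, ← add_mul, add_halves]
      _ ≤ ∑ i ∈ s, ‖a i‖ ^ 2 * R :=
          Finset.sum_le_sum fun i hi => mul_le_mul_of_nonneg_left (hR i hi) (by positivity)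
      _ = R * S := by rw [← Finset.sum_mul, mul_comm]
  have h3 : S ^ 2 ≤ (∑ u ∈ U, V u) * (R * S) := by
    have hV0 : 0 ≤ ∑ u ∈ U, V u := Finset.sum_nonneg hV
    have h4 : S ≤ ∑ u ∈ U, √(V u) * (√(w u) * ‖B u‖) := by
      calc S = ‖(S : ℂ)‖ := by rw [Complex.norm_real, Real.norm_eq_abs, abs_of_nonneg hS0]
        _ ≤ ∑ u ∈ U, ‖v u‖ * ‖B u‖ := by
            rw [h1]
            exact (norm_sum_le _ _).trans (le_of_eq (Finset.sum_congr rfl fun u _ => norm_mul _ _))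
        _ ≤ _ := by
            refine Finset.sum_le_sum fun u hu => ?_
            rw [← mul_assoc, ← Real.sqrt_mul (hV u hu)]
            exact mul_le_mul_of_nonneg_right (Real.le_sqrt_of_sq_le (hv u hu)) (norm_nonneg _)
    calc S ^ 2 ≤ (∑ u ∈ U, √(V u) * (√(w u) * ‖B u‖)) ^ 2 := pow_le_pow_left₀ hS0 h4 2
      _ ≤ (∑ u ∈ U, √(V u) ^ 2) * ∑ u ∈ U, (√(w u) * ‖B u‖) ^ 2 :=
          Finset.sum_mul_sq_le_sq_mul_sq _ _ _
      _ = (∑ u ∈ U, V u) * ∑ u ∈ U, w u * ‖B u‖ ^ 2 := by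
          congr 1
          · exact Finset.sum_congr rfl fun u hu => Real.sq_sqrt (hV u hu)
          · exact Finset.sum_congr rfl fun u _ => by rw [mul_pow, Real.sq_sqrt (hw0 u)]
      _ ≤ _ := mul_le_mul_of_nonneg_left h2 hV0
  rcases hS0.eq_or_lt with h | h
  · rw [← h]
    exact mul_nonneg hR0 (Finset.sum_nonneg hV)
  · have : S * S ≤ (R * ∑ u ∈ U, V u) * S := by nlinarith
    exact le_of_mul_le_mul_right this h

end LargeSieve

section LargeSieveCharacters

theorem norm_tsum_dvd_char_mul_le {W : ℤ → ℝ} (hW : Summable W) {D : ℕ} [NeZero D]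
    (χ : AddChar (ZMod D) ℂ) (g : ℕ) (x y : ℤ) :
    ‖∑' u : ℤ, ((if (g : ℤ) ∣ y - u then W (x - u) else 0 : ℝ) : ℂ) * χ (u : ZMod D)‖
      * ‖1 - χ (g : ZMod D)‖ ≤ g * totalVariation W := by
  have hWx := hW.int_const_sub x
  set F : ℤ → ℂ := fun u => ((if (g : ℤ) ∣ y - u then W (x - u) else 0 : ℝ) : ℂ) * χ (u : ZMod D)
    with hF
  set G : ℤ → ℂ := fun u => ((if (g : ℤ) ∣ y - u then W (x - u - g) else 0 : ℝ) : ℂ)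
    * χ ((u + g : ℤ) : ZMod D) with hG
  have hnorm : ∀ (a : ℝ) (z : ZMod D), ‖(a : ℂ) * χ z‖ = |a| := fun a z => by
    rw [norm_mul, AddChar.norm_apply, mul_one, Complex.norm_real, Real.norm_eq_abs]
  have hFs : Summable F := by
    refine Summable.of_norm_bounded hWx.abs fun u => ?_
    rw [hnorm]
    split_ifs <;> simp
  have hGF : G = fun u => F (u + g) := by
    funext u
    simp only [hF, hG]
    have h1 : x - (u + g) = x - u - g := by ring
    have h2 : y - (u + g) = y - u - g := by ring
    rw [h1, h2]
    simp_rw [dvd_sub_self_right]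
  have hGs : Summable G := by
    rw [hGF]; exact hFs.int_add_right _
  have hGt : ∑' u, G u = ∑' u, F u := by
    rw [hGF]; exact tsum_int_add_right F _
  rw [← norm_mul, mul_sub, mul_one, ← tsum_mul_right]
  conv_lhs => rw [← hGt]
  rw [← Summable.tsum_sub hGs (hFs.mul_right _)]
  have hb : ∀ u, ‖G u - F u * χ (g : ZMod D)‖ ≤ |W (x - u) - W (x - u - g)| := by
    intro u
    have : G u - F u * χ (g : ZMod D)
        = (((if (g : ℤ) ∣ y - u then W (x - u - g) - W (x - u) else 0) : ℝ) : ℂ)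
          * χ ((u + g : ℤ) : ZMod D) := by
      simp only [hF, hG]
      push_cast
      rw [AddChar.map_add_eq_mul]
      split_ifs
      · push_cast
        ring
      · simp
    rw [this, hnorm]
    split_ifs
    · rw [abs_sub_comm]
    · simp
  have hsab : Summable fun u : ℤ => |W (x - u) - W (x - u - g)| :=
    (summable_abs_sub_shift hW g).int_const_sub x
  refine (tsum_of_norm_bounded hsab.hasSum hb).trans ?_
  exact (tsum_int_const_sub (fun u => |W u - W (u - g)|) x).trans_le (tsum_abs_sub_shift_le hW g)

open Classical in
theorem card_addChar_pow_eq_one_le (D : ℕ) [NeZero D] {g : ℕ} (hg : 0 < g) :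
    (Finset.univ.filter fun χ : AddChar (ZMod D) ℂ => χ ^ g = 1).card ≤ g := by
  refine le_trans (Finset.card_le_card_of_injOn (t := (Polynomial.nthRoots g (1 : ℂ)).toFinset)
    (fun χ => χ 1) ?_ ?_) ((Multiset.toFinset_card_le _).trans (Polynomial.card_nthRoots _ _))
  · intro χ hχ
    have hχ' : χ ^ g = 1 := by simpa using hχ
    simp only [Finset.mem_coe, Multiset.mem_toFinset,
      Polynomial.mem_nthRoots hg]
    rw [← AddChar.pow_apply, hχ', AddChar.one_apply]
  · intro χ _ ψ _ h
    by_contra hne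
    have h1 : χ * ψ⁻¹ ≠ 1 := fun h => hne (mul_inv_eq_one.mp h)
    refine (AddChar.zmod_char_ne_one_iff D _).mp h1 ?_
    have h2 : ψ (1 : ZMod D) ≠ 0 := by
      intro h0
      have := AddChar.norm_apply ψ 1
      rw [h0] at this
      simp at this
    rw [AddChar.mul_apply, AddChar.inv_apply, AddChar.map_neg_eq_inv]
    rw [show χ 1 = ψ 1 from h, mul_inv_cancel₀ h2]

open Classical in
theorem sum_addChar_pow_eq_one {D : ℕ} [NeZero D] {g : ℕ} (hgD : g ∣ D) (z : ℤ) :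
    ∑ χ : AddChar (ZMod D) ℂ with χ ^ g = 1, χ (z : ZMod D)
      = if (g : ℤ) ∣ z then
        ((Finset.univ.filter fun χ : AddChar (ZMod D) ℂ => χ ^ g = 1).card : ℂ) else 0 := by
  split_ifs with h
  · rw [Finset.sum_congr rfl (g := fun _ => (1 : ℂ))]
    · simp
    · intro χ hχ
      obtain ⟨k, rfl⟩ := h
      have hχ' : χ ^ g = 1 := by simpa using hχ
      have : ((g * k : ℤ) : ZMod D) = g • (k : ZMod D) := by push_cast; simp
      rw [this, AddChar.map_nsmul_eq_pow, ← AddChar.pow_apply, hχ', AddChar.one_apply]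
  · obtain ⟨m, hm⟩ := hgD
    have hD : D ≠ 0 := NeZero.ne D
    have hm0 : (m : ℤ) ≠ 0 := by rintro h; apply hD; rw [hm]; simp_all
    set χ₀ : AddChar (ZMod D) ℂ := ZMod.stdAddChar ^ m with hχ₀
    have h1 : χ₀ ^ g = 1 := by
      rw [hχ₀, ← pow_mul, mul_comm m g, ← hm]
      ext z
      rw [AddChar.pow_apply, ← AddChar.map_nsmul_eq_pow]
      simp
    have h2 : χ₀ (z : ZMod D) ≠ 1 := by
      rw [hχ₀, AddChar.pow_apply, ← AddChar.map_nsmul_eq_pow]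
      intro h3
      rw [← AddChar.map_zero_eq_one (ZMod.stdAddChar : AddChar (ZMod D) ℂ)] at h3
      have h4 := ZMod.injective_stdAddChar h3
      have h5 : ((m * z : ℤ) : ZMod D) = 0 := by push_cast; simpa using h4
      rw [ZMod.intCast_zmod_eq_zero_iff_dvd, hm] at h5
      push_cast at h5
      rw [mul_comm] at h5
      exact h ((mul_dvd_mul_iff_left hm0).mp h5)
    have h3 : χ₀ (z : ZMod D) * ∑ χ : AddChar (ZMod D) ℂ with χ ^ g = 1, χ (z : ZMod D)
        = ∑ χ : AddChar (ZMod D) ℂ with χ ^ g = 1, χ (z : ZMod D) := by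
      rw [Finset.mul_sum]
      refine Finset.sum_bij (fun χ _ => χ₀ * χ) ?_ ?_ ?_ ?_
      · intro χ hχ
        simp only [Finset.mem_filter, Finset.mem_univ, true_and] at hχ ⊢
        rw [mul_pow, h1, hχ, one_mul]
      · intro a _ b _ hab
        exact mul_left_cancel hab
      · intro χ hχ
        simp only [Finset.mem_filter, Finset.mem_univ, true_and] at hχ
        refine ⟨χ₀⁻¹ * χ, ?_, by simp⟩
        simp only [Finset.mem_filter, Finset.mem_univ, true_and]
        rw [mul_pow, inv_pow, h1, hχ]; simp
      · intro χ _
        rw [AddChar.mul_apply]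
    have h4 : (χ₀ (z : ZMod D) - 1) *
        ∑ χ : AddChar (ZMod D) ℂ with χ ^ g = 1, χ (z : ZMod D) = 0 := by
      rw [sub_mul, h3, one_mul, sub_self]
    exact (mul_eq_zero.mp h4).resolve_left (sub_ne_zero.mpr h2)

open Classical in
theorem card_addChar_orderOf_le (D : ℕ) [NeZero D] (Q : ℕ) :
    (Finset.univ.filter fun χ : AddChar (ZMod D) ℂ => orderOf χ ≤ Q).card ≤ Q ^ 2 := by
  have hsub : (Finset.univ.filter fun χ : AddChar (ZMod D) ℂ => orderOf χ ≤ Q) ⊆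
      (Finset.Icc 1 Q).biUnion fun n =>
        Finset.univ.filter fun χ : AddChar (ZMod D) ℂ => χ ^ n = 1 := by
    intro χ hχ
    simp only [Finset.mem_filter, Finset.mem_univ, true_and] at hχ
    simp only [Finset.mem_biUnion, Finset.mem_Icc, Finset.mem_filter, Finset.mem_univ, true_and]
    exact ⟨orderOf χ, ⟨orderOf_pos χ, hχ⟩, pow_orderOf_eq_one χ⟩
  refine (Finset.card_le_card hsub).trans (Finset.card_biUnion_le.trans ?_)
  calc _ ≤ ∑ n ∈ Finset.Icc 1 Q, Q := Finset.sum_le_sum fun n hn =>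
        (card_addChar_pow_eq_one_le D (Finset.mem_Icc.mp hn).1).trans (Finset.mem_Icc.mp hn).2
    _ = Q ^ 2 := by simp [sq]

theorem fiberPart_eq_sum {D : ℕ} [NeZero D] {g : ℕ} (hg : 0 < g) (hgD : g ∣ D)
    (U : Finset ℤ) (a : ℤ → ℂ) (ψ : AddChar (ZMod D) ℂ) (y : ℤ) :
    ‖fiberPart (fun φ => ∑ u ∈ U, a u * φ (-(u : ZMod D))) g (ψ ^ g) (y : ZMod D)‖
      ≤ g * ‖∑ u ∈ U with (g : ℤ) ∣ y - u, a u * ψ (-(u : ZMod D))‖ := by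
  classical
  set n := (Finset.univ.filter fun χ : AddChar (ZMod D) ℂ => χ ^ g = 1).card with hn
  have key : fiberPart (fun φ => ∑ u ∈ U, a u * φ (-(u : ZMod D))) g (ψ ^ g) (y : ZMod D)
      = n * ψ (y : ZMod D) * ∑ u ∈ U with (g : ℤ) ∣ y - u, a u * ψ (-(u : ZMod D)) := by
    have h1 : fiberPart (fun φ => ∑ u ∈ U, a u * φ (-(u : ZMod D))) g (ψ ^ g) (y : ZMod D)
        = ∑ χ : AddChar (ZMod D) ℂ with χ ^ g = 1,
          (∑ u ∈ U, a u * (ψ * χ) (-(u : ZMod D))) * (ψ * χ) (y : ZMod D) := by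
      rw [fiberPart]
      refine Finset.sum_bij (fun φ _ => ψ⁻¹ * φ) ?_ ?_ ?_ ?_
      · intro φ hφ
        simp only [Finset.mem_filter, Finset.mem_univ, true_and] at hφ ⊢
        rw [mul_pow, inv_pow, hφ, inv_mul_cancel]
      · intro _ _ _ _ hab
        exact mul_left_cancel hab
      · intro χ hχ
        simp only [Finset.mem_filter, Finset.mem_univ, true_and] at hχ
        refine ⟨ψ * χ, ?_, by simp⟩
        simp only [Finset.mem_filter, Finset.mem_univ, true_and]
        rw [mul_pow, hχ, mul_one]
      · intro φ _
        rw [mul_inv_cancel_left]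
    rw [h1]
    simp_rw [Finset.sum_mul]
    rw [Finset.sum_comm, Finset.mul_sum, Finset.sum_filter]
    refine Finset.sum_congr rfl fun u _ => ?_
    have h2 : ∀ χ : AddChar (ZMod D) ℂ, a u * (ψ * χ) (-(u : ZMod D)) * (ψ * χ) (y : ZMod D)
        = a u * ψ (-(u : ZMod D)) * ψ (y : ZMod D) * χ ((y - u : ℤ) : ZMod D) := by
      intro χ
      rw [AddChar.mul_apply, AddChar.mul_apply]
      push_cast
      rw [sub_eq_add_neg, AddChar.map_add_eq_mul]
      ring
    simp_rw [h2]
    rw [← Finset.mul_sum, sum_addChar_pow_eq_one hgD]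
    split_ifs
    · ring
    · simp
  rw [key, norm_mul, norm_mul, AddChar.norm_apply, mul_one, Complex.norm_natCast]
  refine mul_le_mul_of_nonneg_right ?_ (norm_nonneg _)
  exact_mod_cast card_addChar_pow_eq_one_le D hg

/-- Large sieve inequality in a residue class, for coefficients localized by a slowly varying
kernel. -/
theorem sum_normSq_fiberPart_le {W : ℤ → ℝ} (hW : Summable W) (hW0 : ∀ u, 0 ≤ W u)
    {K : ℤ → ℂ} (hKW : ∀ u, ‖K u‖ ≤ W u) {A : ℝ} (hA : ∑' u, W u ≤ A)
    {Q : ℕ} (hQ : ((Q : ℝ) ^ 2 + (Q : ℝ) ^ 6) * totalVariation W ≤ A)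
    {D : ℕ} [NeZero D] {g : ℕ} (hg : 0 < g) (hgQ : g ≤ Q) (hgD : g ∣ D)
    (U : Finset ℤ) (f : ℤ → ℂ) (x y : ℤ) :
    ∑ μ : AddChar (ZMod D) ℂ with orderOf μ ≤ Q,
      ‖fiberPart (fun φ => ∑ u ∈ U, (f u * K (x - u)) * φ (-(u : ZMod D))) g μ (y : ZMod D)‖ ^ 2
      ≤ 2 * A * (g * ∑ u ∈ U with (g : ℤ) ∣ y - u, ‖f u‖ ^ 2 * W (x - u)) := by
  classical
  have hg' : (0 : ℝ) < g := by exact_mod_cast hg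
  have hA0 : 0 ≤ A := (tsum_nonneg hW0).trans hA
  have hTV := totalVariation_nonneg W
  set S : Finset (AddChar (ZMod D) ℂ) := Finset.univ.filter fun μ => orderOf μ ≤ Q with hS
  set S' := S.filter fun μ => ∃ ψ, ψ ^ g = μ with hS'
  have hS'card : S'.card ≤ Q ^ 2 :=
    (Finset.card_filter_le _ _).trans (card_addChar_orderOf_le D Q)
  have hroot : ∀ μ : AddChar (ZMod D) ℂ, ∃ ψ : AddChar (ZMod D) ℂ, μ ∈ S' → ψ ^ g = μ := by
    intro μ
    by_cases h : μ ∈ S'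
    · obtain ⟨ψ, hψ⟩ := (Finset.mem_filter.mp h).2
      exact ⟨ψ, fun _ => hψ⟩
    · exact ⟨1, fun h' => absurd h' h⟩
  choose ρ hρ using hroot
  set U' := U.filter fun u => (g : ℤ) ∣ y - u with hU'
  set w : ℤ → ℝ := fun u => if (g : ℤ) ∣ y - u then W (x - u) else 0 with hw
  have hws : Summable w := summable_ite (hW.int_const_sub x).norm _
  have hw0 : ∀ u, 0 ≤ w u := fun u => by simp only [hw]; split_ifs; exacts [hW0 _, le_rfl]
  set b : AddChar (ZMod D) ℂ → ℤ → ℂ := fun μ u => ρ μ (-(u : ZMod D)) with hb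
  have hLS := sum_normSq_le_of_row_sum_le S' hws hw0 b
    (fun i u => (AddChar.norm_apply _ _).le) (R := 2 * A / g) (by positivity) ?_ U'
    (fun u => f u * K (x - u)) (fun u => ‖f u‖ ^ 2 * W (x - u))
    (fun u _ => mul_nonneg (by positivity) (hW0 _)) ?_
  · have h1 : ∀ μ ∈ S, μ ∉ S' →
        ‖fiberPart (fun φ => ∑ u ∈ U, (f u * K (x - u)) * φ (-(u : ZMod D))) g μ
          (y : ZMod D)‖ ^ 2 = 0 := by
      intro μ hμ hμ'
      have : fiberPart (fun φ => ∑ u ∈ U, (f u * K (x - u)) * φ (-(u : ZMod D))) g μ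
          (y : ZMod D) = 0 := by
        rw [fiberPart, Finset.sum_eq_zero]
        intro ψ hψ
        exact absurd (Finset.mem_filter.mpr ⟨hμ, ψ, (Finset.mem_filter.mp hψ).2⟩) hμ'
      rw [this]; simp
    have h1' := Finset.sum_subset (Finset.filter_subset _ _ : S' ⊆ S) h1
    rw [← h1']
    calc _ ≤ ∑ μ ∈ S', (g : ℝ) ^ 2 * ‖∑ u ∈ U', f u * K (x - u) * b μ u‖ ^ 2 := by
          refine Finset.sum_le_sum fun μ hμ => ?_
          rw [← mul_pow]
          refine pow_le_pow_left₀ (norm_nonneg _) ?_ 2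
          have := fiberPart_eq_sum hg hgD U (fun u => f u * K (x - u)) (ρ μ) y
          rwa [hρ μ hμ] at this
      _ ≤ (g : ℝ) ^ 2 * (2 * A / g * ∑ u ∈ U', ‖f u‖ ^ 2 * W (x - u)) := by
          rw [← Finset.mul_sum]
          exact mul_le_mul_of_nonneg_left hLS (by positivity)
      _ = _ := by field_simp
  · intro i hi
    have hbb : ∀ j, ∑' u, (w u : ℂ) * (b i u * (starRingEnd ℂ) (b j u))
        = ∑' u : ℤ, ((if (g : ℤ) ∣ y - u then W (x - u) else 0 : ℝ) : ℂ)
          * (ρ j * (ρ i)⁻¹) (u : ZMod D) := by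
      intro j
      refine tsum_congr fun u => ?_
      simp only [hb]
      rw [AddChar.mul_apply, AddChar.inv_apply, AddChar.map_neg_eq_conj (ρ j), Complex.conj_conj,
        mul_comm (ρ j _)]
    have hdiag : ‖∑' u, (w u : ℂ) * (b i u * (starRingEnd ℂ) (b i u))‖
        ≤ (A + g ^ 2 * totalVariation W) / g := by
      have h1 : ∀ u, (w u : ℂ) * (b i u * (starRingEnd ℂ) (b i u)) = (w u : ℂ) := by
        intro u
        rw [Complex.mul_conj', AddChar.norm_apply]; simp
      simp_rw [h1]
      rw [← Complex.ofReal_tsum, Complex.norm_real, Real.norm_eq_abs,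
        abs_of_nonneg (tsum_nonneg hw0), le_div_iff₀ hg', mul_comm]
      exact (tsum_ite_dvd_le hW hg x y).trans (by linarith)
    have hoff : ∀ j ∈ S', j ≠ i → ‖∑' u, (w u : ℂ) * (b i u * (starRingEnd ℂ) (b j u))‖
        ≤ Q ^ 2 * (g * totalVariation W) := by
      intro j hj hji
      rw [hbb]
      set χ := ρ j * (ρ i)⁻¹ with hχ
      have h1 := norm_tsum_dvd_char_mul_le hW χ g x y
      have hχg : χ (g : ZMod D) = (j * i⁻¹) 1 := by
        have : (g : ZMod D) = g • (1 : ZMod D) := by simp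
        rw [this, AddChar.map_nsmul_eq_pow, ← AddChar.pow_apply, hχ, mul_pow, inv_pow, hρ j hj,
          hρ i hi]
      have hji' : j * i⁻¹ ≠ 1 := fun h => hji (mul_inv_eq_one.mp h)
      have hne : χ (g : ZMod D) ≠ 1 := by
        rw [hχg]
        exact (AddChar.zmod_char_ne_one_iff D _).mp hji'
      have hpow : χ (g : ZMod D) ^ (orderOf j * orderOf i) = 1 := by
        have : (j * i⁻¹) ^ (orderOf j * orderOf i) = 1 := by
          rw [mul_pow, pow_mul, pow_orderOf_eq_one, inv_pow, mul_comm (orderOf j), pow_mul,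
            pow_orderOf_eq_one]
          simp
        rw [hχg, ← AddChar.pow_apply, this, AddChar.one_apply]
      have h2 := norm_one_sub_ge_of_pow_eq_one
        (Nat.mul_pos (orderOf_pos j) (orderOf_pos i)) hpow hne
      have hordj : orderOf j ≤ Q := (Finset.mem_filter.mp (Finset.mem_filter.mp hj).1).2
      have hordi : orderOf i ≤ Q := (Finset.mem_filter.mp (Finset.mem_filter.mp hi).1).2
      have h3 : ((orderOf j * orderOf i : ℕ) : ℝ) ≤ (Q : ℝ) ^ 2 := by
        rw [sq]; exact_mod_cast Nat.mul_le_mul hordj hordi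
      set X := ‖∑' u : ℤ, ((if (g : ℤ) ∣ y - u then W (x - u) else 0 : ℝ) : ℂ)
        * χ (u : ZMod D)‖
      have hX : 0 ≤ X := norm_nonneg _
      calc X = X * 1 := (mul_one _).symm
        _ ≤ X * ((Q : ℝ) ^ 2 * ‖1 - χ (g : ZMod D)‖) :=
            mul_le_mul_of_nonneg_left (h2.trans
              (mul_le_mul_of_nonneg_right h3 (norm_nonneg _))) hX
        _ = Q ^ 2 * (X * ‖1 - χ (g : ZMod D)‖) := by ring
        _ ≤ _ := mul_le_mul_of_nonneg_left h1 (by positivity)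
    have hgQ' : (g : ℝ) ≤ Q := by exact_mod_cast hgQ
    rw [← Finset.add_sum_erase _ _ hi]
    calc _ ≤ (A + g ^ 2 * totalVariation W) / g + Q ^ 2 * (Q ^ 2 * (g * totalVariation W)) := by
          refine add_le_add hdiag ?_
          refine (Finset.sum_le_sum fun j hj => hoff j (Finset.mem_of_mem_erase hj)
            (Finset.ne_of_mem_erase hj)).trans ?_
          rw [Finset.sum_const, nsmul_eq_mul]
          refine mul_le_mul_of_nonneg_right ?_ (by positivity)
          exact_mod_cast (Finset.card_le_card (Finset.erase_subset _ _)).trans hS'card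
      _ = (A + (g ^ 2 + Q ^ 4 * g ^ 2) * totalVariation W) / g := by field_simp; ring
      _ ≤ 2 * A / g := by
          refine div_le_div_of_nonneg_right ?_ hg'.le
          have hg2 : (g : ℝ) ^ 2 ≤ (Q : ℝ) ^ 2 := pow_le_pow_left₀ hg'.le hgQ' 2
          have : ((g : ℝ) ^ 2 + Q ^ 4 * g ^ 2) * totalVariation W
              ≤ ((Q : ℝ) ^ 2 + (Q : ℝ) ^ 6) * totalVariation W := by
            refine mul_le_mul_of_nonneg_right ?_ hTV
            have h4 : (Q : ℝ) ^ 4 * g ^ 2 ≤ Q ^ 4 * Q ^ 2 :=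
              mul_le_mul_of_nonneg_left hg2 (by positivity)
            nlinarith
          linarith
  · intro u hu
    have : w u = W (x - u) := if_pos (Finset.mem_filter.mp hu).2
    rw [this, norm_mul, mul_pow, mul_assoc]
    refine mul_le_mul_of_nonneg_left ?_ (by positivity)
    rw [sq]
    exact mul_le_mul (hKW _) (hKW _) (norm_nonneg _) (hW0 _)

end LargeSieveCharacters

section Interpolation

theorem sum_four_zpow_pow_le (K : Finset ℤ) {m : ℕ} (hm : 1 ≤ m) {a : ℝ} :
    ∑ k ∈ K with (2 : ℝ) ^ k < a, ((4 : ℝ) ^ k) ^ m ≤ 4 / 3 * (a ^ 2) ^ m := by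
  rcases (K.filter fun k : ℤ => (2 : ℝ) ^ k < a).eq_empty_or_nonempty with h | h
  · rw [h, Finset.sum_empty]; positivity
  set K' := K.filter fun k : ℤ => (2 : ℝ) ^ k < a with hK'
  set k₀ := K'.max' h with hk₀
  have hk₀a : (2 : ℝ) ^ k₀ < a := (Finset.mem_filter.mp (K'.max'_mem h)).2
  have hle : ∀ k ∈ K', k ≤ k₀ := fun k hk => K'.le_max' k hk
  set q : ℝ := (1 / 4) ^ m with hq
  have hq0 : 0 ≤ q := by positivity
  have hq1 : q ≤ 1 / 4 := by
    calc q ≤ (1 / 4 : ℝ) ^ 1 := pow_le_pow_of_le_one (by norm_num) (by norm_num) hm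
      _ = _ := pow_one _
  have h1 : ∀ k ∈ K', ((4 : ℝ) ^ k) ^ m = ((4 : ℝ) ^ k₀) ^ m * q ^ (k₀ - k).toNat := by
    intro k hk
    have h2 : (4 : ℝ) ^ k = (4 : ℝ) ^ k₀ * (1 / 4) ^ (k₀ - k).toNat := by
      have h3 : (4 : ℝ) ^ k₀ = (4 : ℝ) ^ k * (4 : ℝ) ^ (k₀ - k).toNat := by
        rw [← zpow_natCast, Int.toNat_of_nonneg (sub_nonneg.mpr (hle k hk)),
          ← zpow_add₀ (by norm_num)]
        congr 1; ring
      rw [h3, mul_assoc, ← mul_pow]; norm_num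
    rw [h2, mul_pow, hq, ← pow_mul, ← pow_mul, mul_comm m]
  rw [Finset.sum_congr rfl h1, ← Finset.mul_sum]
  have hinj : Set.InjOn (fun k : ℤ => (k₀ - k).toNat) K' := by
    intro i hi j hj hij
    have := hle i hi
    have := hle j hj
    simp only at hij
    omega
  have h4 : ∑ k ∈ K', q ^ (k₀ - k).toNat ≤ 4 / 3 := by
    rw [← Finset.sum_image (f := fun j => q ^ j) hinj]
    have hq1' : q < 1 := by linarith
    refine ((summable_geometric_of_lt_one hq0 hq1').sum_le_tsum _ fun _ _ => by positivity).trans ?_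
    rw [tsum_geometric_of_lt_one hq0 hq1', inv_le_comm₀ (by linarith) (by norm_num)]
    linarith
  have h5 : ((4 : ℝ) ^ k₀) ^ m ≤ (a ^ 2) ^ m := by
    refine pow_le_pow_left₀ (by positivity) ?_ m
    have : (4 : ℝ) ^ k₀ = ((2 : ℝ) ^ k₀) ^ 2 := by
      rw [← zpow_natCast, ← zpow_mul, mul_comm k₀, zpow_mul]; norm_num
    rw [this]
    exact pow_le_pow_left₀ (by positivity) hk₀a.le 2
  calc _ ≤ (a ^ 2) ^ m * (4 / 3) := mul_le_mul h5 h4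
        (Finset.sum_nonneg fun _ _ => by positivity) (by positivity)
    _ = _ := mul_comm _ _

/-- Marcinkiewicz interpolation between `ℓ²` and `ℓ^∞` for the square of a sublinear operator. -/
theorem sum_pow_le_of_interpolation {Ω ι : Type*} (S : Finset Ω) (U : Finset ι)
    (H : (ι → ℂ) → Ω → ℝ) (hH0 : ∀ f ω, 0 ≤ H f ω)
    (hadd : ∀ f₁ f₂ ω, H (f₁ + f₂) ω ≤ 2 * H f₁ ω + 2 * H f₂ ω) {B B₂ : ℝ} (hB : 0 < B)
    (hB₂ : 0 ≤ B₂)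
    (hinf : ∀ f (a : ℝ), (∀ u, ‖f u‖ ≤ a) → ∀ ω ∈ S, H f ω ≤ B * a ^ 2)
    (h2 : ∀ f, ∑ ω ∈ S, H f ω ≤ B₂ * ∑ u ∈ U, ‖f u‖ ^ 2) {m : ℕ} (hm : 1 ≤ m) (f : ι → ℂ) :
    ∑ ω ∈ S, H f ω ^ (m + 1)
      ≤ 16 / 3 * (16 * B) ^ m * B₂ * ∑ u ∈ U, ‖f u‖ ^ (2 * (m + 1)) := by
  classical
  have hk : ∀ ω, ∃ k : ℤ, 0 < H f ω → 4 * B * (4 : ℝ) ^ k ≤ H f ω ∧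
      H f ω ≤ 16 * B * (4 : ℝ) ^ k := by
    intro ω
    by_cases h : 0 < H f ω
    · obtain ⟨k, hk⟩ := exists_mem_Ico_zpow (x := H f ω / (4 * B)) (y := (4 : ℝ)) (by positivity)
        (by norm_num)
      refine ⟨k, fun _ => ⟨?_, ?_⟩⟩
      · have := hk.1
        rw [le_div_iff₀ (by positivity)] at this
        linarith
      · have := hk.2
        rw [div_lt_iff₀ (by positivity), zpow_add_one₀ (by norm_num)] at this
        linarith
    · exact ⟨0, fun h' => absurd h' h⟩
  choose κ hκ using hk
  set K := S.image κ with hK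
  set hi : ℤ → ι → ℂ := fun k u => if (2 : ℝ) ^ k < ‖f u‖ then f u else 0 with hhi
  have hpt : ∀ ω ∈ S, H f ω ^ (m + 1)
      ≤ ∑ k ∈ K, 4 * (16 * B) ^ m * (((4 : ℝ) ^ k) ^ m * H (hi k) ω) := by
    intro ω hω
    have hnn : ∀ k ∈ K, 0 ≤ 4 * (16 * B) ^ m * (((4 : ℝ) ^ k) ^ m * H (hi k) ω) := by
      intro k _
      have := hH0 (hi k) ω
      positivity
    rcases (hH0 f ω).eq_or_lt with h | h
    · rw [← h, zero_pow (by omega)]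
      exact Finset.sum_nonneg hnn
    · obtain ⟨hk1, hk2⟩ := hκ ω h
      set k := κ ω with hkdef
      have hsplit : f = (fun u => if (2 : ℝ) ^ k < ‖f u‖ then 0 else f u) + hi k := by
        funext u
        simp only [hhi, Pi.add_apply]
        split_ifs <;> simp
      have h3 := hadd (fun u => if (2 : ℝ) ^ k < ‖f u‖ then 0 else f u) (hi k) ω
      rw [← hsplit] at h3
      have h4 := hinf (fun u => if (2 : ℝ) ^ k < ‖f u‖ then 0 else f u) ((2 : ℝ) ^ k) (by
        intro u
        split_ifs with h5
        · rw [norm_zero]; positivity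
        · exact not_lt.mp h5) ω hω
      have h5 : ((2 : ℝ) ^ k) ^ 2 = (4 : ℝ) ^ k := by
        rw [← zpow_natCast, ← zpow_mul, mul_comm k, zpow_mul]; norm_num
      rw [h5] at h4
      have h6 : H f ω ≤ 4 * H (hi k) ω := by nlinarith
      calc H f ω ^ (m + 1) = H f ω ^ m * H f ω := pow_succ _ _
        _ ≤ (16 * B * (4 : ℝ) ^ k) ^ m * (4 * H (hi k) ω) :=
            mul_le_mul (pow_le_pow_left₀ h.le hk2 m) h6 h.le (by positivity)
        _ = 4 * (16 * B) ^ m * (((4 : ℝ) ^ k) ^ m * H (hi k) ω) := by rw [mul_pow]; ring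
        _ ≤ _ := Finset.single_le_sum hnn (Finset.mem_image_of_mem κ hω)
  calc _ ≤ ∑ ω ∈ S, ∑ k ∈ K, 4 * (16 * B) ^ m * (((4 : ℝ) ^ k) ^ m * H (hi k) ω) :=
        Finset.sum_le_sum hpt
    _ = 4 * (16 * B) ^ m * ∑ k ∈ K, ((4 : ℝ) ^ k) ^ m * ∑ ω ∈ S, H (hi k) ω := by
        rw [Finset.sum_comm]
        simp_rw [Finset.mul_sum]
    _ ≤ 4 * (16 * B) ^ m * ∑ k ∈ K, ((4 : ℝ) ^ k) ^ m * (B₂ * ∑ u ∈ U, ‖hi k u‖ ^ 2) := by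
        refine mul_le_mul_of_nonneg_left (Finset.sum_le_sum fun k _ =>
          mul_le_mul_of_nonneg_left (h2 _) (by positivity)) (by positivity)
    _ = 4 * (16 * B) ^ m * B₂ * ∑ u ∈ U,
          (∑ k ∈ K with (2 : ℝ) ^ k < ‖f u‖, ((4 : ℝ) ^ k) ^ m) * ‖f u‖ ^ 2 := by
        simp_rw [Finset.sum_mul, Finset.sum_filter]
        rw [Finset.sum_comm, mul_assoc (4 * (16 * B) ^ m)]
        congr 1
        rw [Finset.mul_sum]
        refine Finset.sum_congr rfl fun k _ => ?_
        simp_rw [Finset.mul_sum]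
        refine Finset.sum_congr rfl fun u _ => ?_
        simp only [hhi]
        split_ifs
        · ring
        · simp
    _ ≤ 4 * (16 * B) ^ m * B₂ * ∑ u ∈ U, 4 / 3 * ‖f u‖ ^ (2 * (m + 1)) := by
        refine mul_le_mul_of_nonneg_left (Finset.sum_le_sum fun u _ => ?_) (by positivity)
        refine (mul_le_mul_of_nonneg_right (sum_four_zpow_pow_le K hm)
          (by positivity)).trans_eq ?_
        rw [← pow_mul]; ring
    _ = _ := by rw [← Finset.mul_sum]; ring

end Interpolation

section DiscreteLargeSieve

variable {D : ℕ}

/-- The coefficients of a localized character expansion of a function on the integers. -/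
noncomputable def localCoeff (K : ℤ → ℂ) (U : Finset ℤ) (f : ℤ → ℂ) (x : ℤ)
    (φ : AddChar (ZMod D) ℂ) : ℂ :=
  ∑ u ∈ U, (f u * K (x - u)) * φ (-(u : ZMod D))

theorem localCoeff_add (K : ℤ → ℂ) (U : Finset ℤ) (f₁ f₂ : ℤ → ℂ) (x : ℤ)
    (φ : AddChar (ZMod D) ℂ) :
    localCoeff K U (f₁ + f₂) x φ = localCoeff K U f₁ x φ + localCoeff K U f₂ x φ := by
  simp only [localCoeff, ← Finset.sum_add_distrib, Pi.add_apply]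
  exact Finset.sum_congr rfl fun u _ => by ring

variable [NeZero D]

/-- The averaged square function of the localized character expansion. -/
noncomputable def localSquare (D : ℕ) [NeZero D] (K : ℤ → ℂ) (U : Finset ℤ) (Q : ℕ) (f : ℤ → ℂ)
    (ω : ℕ × ℤ × ZMod D) : ℝ :=
  ∑ q ∈ Finset.Icc 1 Q with ω.1 ∣ q,
    mulAverage ω.1 (fun y => ‖orderPart (localCoeff K U f ω.2.1) q y‖ ^ 2) ω.2.2

theorem localSquare_nonneg (K : ℤ → ℂ) (U : Finset ℤ) (Q : ℕ) (f : ℤ → ℂ) (ω : ℕ × ℤ × ZMod D) :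
    0 ≤ localSquare D K U Q f ω :=
  Finset.sum_nonneg fun _ _ => mulAverage_nonneg _ (fun _ => by positivity) _

theorem localSquare_add_le (K : ℤ → ℂ) (U : Finset ℤ) (Q : ℕ) (f₁ f₂ : ℤ → ℂ)
    (ω : ℕ × ℤ × ZMod D) :
    localSquare D K U Q (f₁ + f₂) ω
      ≤ 2 * localSquare D K U Q f₁ ω + 2 * localSquare D K U Q f₂ ω := by
  unfold localSquare
  rw [Finset.mul_sum, Finset.mul_sum, ← Finset.sum_add_distrib]
  refine Finset.sum_le_sum fun q _ => ?_
  unfold mulAverage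
  have : ∀ t, ‖orderPart (localCoeff K U (f₁ + f₂) ω.2.1) q (ω.2.2 + ω.1 • t)‖ ^ 2
      ≤ 2 * ‖orderPart (localCoeff K U f₁ ω.2.1) q (ω.2.2 + ω.1 • t)‖ ^ 2
        + 2 * ‖orderPart (localCoeff K U f₂ ω.2.1) q (ω.2.2 + ω.1 • t)‖ ^ 2 := by
    intro t
    have h1 : orderPart (localCoeff K U (f₁ + f₂) ω.2.1) q (ω.2.2 + ω.1 • t)
        = orderPart (localCoeff K U f₁ ω.2.1) q (ω.2.2 + ω.1 • t)
          + orderPart (localCoeff K U f₂ ω.2.1) q (ω.2.2 + ω.1 • t) := by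
      simp only [orderPart, localCoeff_add, add_mul, Finset.sum_add_distrib]
    rw [h1]
    have h2 := norm_add_le (orderPart (localCoeff K U f₁ ω.2.1) q (ω.2.2 + ω.1 • t))
      (orderPart (localCoeff K U f₂ ω.2.1) q (ω.2.2 + ω.1 • t))
    have h3 := pow_le_pow_left₀ (norm_nonneg _) h2 2
    nlinarith [sq_nonneg (‖orderPart (localCoeff K U f₁ ω.2.1) q (ω.2.2 + ω.1 • t)‖
      - ‖orderPart (localCoeff K U f₂ ω.2.1) q (ω.2.2 + ω.1 • t)‖)]
  have h4 := Finset.sum_le_sum fun t (_ : t ∈ Finset.univ) => this t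
  rw [Finset.sum_add_distrib, ← Finset.mul_sum, ← Finset.mul_sum] at h4
  have h5 : (0 : ℝ) ≤ (Fintype.card (ZMod D) : ℝ)⁻¹ := by positivity
  nlinarith [mul_le_mul_of_nonneg_left h4 h5]

variable {W : ℤ → ℝ} (hW : Summable W) (hW0 : ∀ u, 0 ≤ W u) {K : ℤ → ℂ} (hKW : ∀ u, ‖K u‖ ≤ W u)
  {A : ℝ} (hA : ∑' u, W u ≤ A) {Q T : ℕ}
  (hQ : ((Q : ℝ) ^ 2 + (Q : ℝ) ^ 6) * totalVariation W ≤ A)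
  (hD : ∀ q ∈ Finset.Icc 1 Q, q ∣ D)
  (U : Finset ℤ)

theorem localSquare_le_sum_fiberPart {g : ℕ} (hg : 0 < g)
    (hT : ∀ k ∈ Finset.Icc 1 Q, k.divisors.card ≤ T) (f : ℤ → ℂ) (x : ℤ) (y : ZMod D) :
    localSquare D K U Q f (g, x, y) ≤ (T : ℝ) ^ 2 * ∑ g' ∈ g.divisors,
      ∑ μ : AddChar (ZMod D) ℂ with orderOf μ ≤ Q,
        ‖fiberPart (localCoeff K U f x) g' μ y‖ ^ 2 := by
  have := sum_mulAverage_orderPart_le (localCoeff K U f x) hg hT y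
  simp only [localSquare]
  convert this

include hW hW0 hKW hA hQ in
theorem sum_normSq_fiberPart_localCoeff_le {g : ℕ} (hg : 0 < g) (hgQ : g ≤ Q) (hgD : g ∣ D)
    (f : ℤ → ℂ) (x y : ℤ) :
    ∑ μ : AddChar (ZMod D) ℂ with orderOf μ ≤ Q,
      ‖fiberPart (localCoeff K U f x) g μ (y : ZMod D)‖ ^ 2
      ≤ 2 * A * (g * ∑ u ∈ U with (g : ℤ) ∣ y - u, ‖f u‖ ^ 2 * W (x - u)) :=
  sum_normSq_fiberPart_le hW hW0 hKW hA hQ hg hgQ hgD U f x y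

include hW hW0 hKW hA hQ hD in
theorem localSquare_le_of_bounded (hT : ∀ k ∈ Finset.Icc 1 Q, k.divisors.card ≤ T)
    (f : ℤ → ℂ) {a : ℝ} (hf : ∀ u, ‖f u‖ ≤ a)
    (ω : ℕ × ℤ × ZMod D) (hω : ω.1 ∈ Finset.Icc 1 Q) :
    localSquare D K U Q f ω ≤ (4 * A ^ 2 * T ^ 3) * a ^ 2 := by
  obtain ⟨g, x, y⟩ := ω
  have hA0 : 0 ≤ A := (tsum_nonneg hW0).trans hA
  have hTV := totalVariation_nonneg W
  simp only at hω
  have hg := Finset.mem_Icc.mp hω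
  obtain ⟨y, rfl⟩ := ZMod.intCast_surjective y
  have h0 : localSquare D K U Q f (g, x, (y : ZMod D)) ≤ (T : ℝ) ^ 2 * ∑ g' ∈ g.divisors,
      ∑ μ : AddChar (ZMod D) ℂ with orderOf μ ≤ Q,
        ‖fiberPart (localCoeff K U f x) g' μ (y : ZMod D)‖ ^ 2 := by
    have := localSquare_le_sum_fiberPart (K := K) U hg.1 hT f x (y : ZMod D)
    exact this
  refine h0.trans ?_
  have h1 : ∀ g' ∈ g.divisors, ∑ μ : AddChar (ZMod D) ℂ with orderOf μ ≤ Q,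
      ‖fiberPart (localCoeff K U f x) g' μ (y : ZMod D)‖ ^ 2 ≤ 4 * A ^ 2 * a ^ 2 := by
    intro g' hg'
    have hg'g := Nat.dvd_of_mem_divisors hg'
    have hg'0 : 0 < g' := Nat.pos_of_mem_divisors hg'
    have hg'Q : g' ≤ Q := (Nat.le_of_dvd hg.1 hg'g).trans hg.2
    refine (sum_normSq_fiberPart_localCoeff_le hW hW0 hKW hA hQ U hg'0 hg'Q
      (hD g' (Finset.mem_Icc.mpr ⟨hg'0, hg'Q⟩)) f x y).trans ?_
    have h2 : ∑ u ∈ U with (g' : ℤ) ∣ y - u, ‖f u‖ ^ 2 * W (x - u)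
        ≤ a ^ 2 * ∑' u, (if (g' : ℤ) ∣ y - u then W (x - u) else 0) := by
      rw [Finset.sum_filter]
      have hs : Summable fun u : ℤ => if (g' : ℤ) ∣ y - u then W (x - u) else 0 :=
        summable_ite (hW.int_const_sub x).norm _
      refine le_trans ?_ (mul_le_mul_of_nonneg_left (hs.sum_le_tsum U fun u _ => ?_)
        (by positivity))
      · rw [Finset.mul_sum]
        refine Finset.sum_le_sum fun u _ => ?_
        split_ifs
        · exact mul_le_mul_of_nonneg_right (pow_le_pow_left₀ (norm_nonneg _) (hf u) 2) (hW0 _)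
        · simp
      · split_ifs; exacts [hW0 _, le_rfl]
    have h3 := tsum_ite_dvd_le hW hg'0 x y
    have hgQ' : (g' : ℝ) ^ 2 ≤ (Q : ℝ) ^ 2 :=
      pow_le_pow_left₀ (by positivity) (by exact_mod_cast hg'Q) 2
    have h4 : (g' : ℝ) ^ 2 * totalVariation W ≤ A := by
      have : (g' : ℝ) ^ 2 * totalVariation W ≤ ((Q : ℝ) ^ 2 + (Q : ℝ) ^ 6) * totalVariation W :=
        mul_le_mul_of_nonneg_right (hgQ'.trans (le_add_of_nonneg_right (by positivity))) hTV
      linarith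
    calc _ ≤ 2 * A * (g' * (a ^ 2 * ∑' u, (if (g' : ℤ) ∣ y - u then W (x - u) else 0))) := by
          gcongr
      _ = 2 * A * a ^ 2 * (g' * ∑' u, (if (g' : ℤ) ∣ y - u then W (x - u) else 0)) := by ring
      _ ≤ 2 * A * a ^ 2 * (2 * A) := by
          refine mul_le_mul_of_nonneg_left (by linarith) (by positivity)
      _ = _ := by ring
  have h5 := Finset.sum_le_sum h1
  rw [Finset.sum_const, nsmul_eq_mul] at h5
  have h6 : (g.divisors.card : ℝ) ≤ T := by exact_mod_cast hT g hω
  calc _ ≤ (T : ℝ) ^ 2 * (T * (4 * A ^ 2 * a ^ 2)) := by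
        refine mul_le_mul_of_nonneg_left (h5.trans ?_) (by positivity)
        exact mul_le_mul_of_nonneg_right h6 (by positivity)
    _ = _ := by ring

include hW hW0 hKW hA hQ in
theorem sum_normSq_localCoeff_le (hQ1 : 1 ≤ Q) (f : ℤ → ℂ) (x : ℤ) :
    ∑ ψ : AddChar (ZMod D) ℂ with orderOf ψ ≤ Q, ‖localCoeff K U f x ψ‖ ^ 2
      ≤ 2 * A * ∑ u ∈ U, ‖f u‖ ^ 2 * W (x - u) := by
  have h := sum_normSq_fiberPart_localCoeff_le hW hW0 hKW hA hQ (D := D) U one_pos hQ1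
    (one_dvd _) f x 0
  simp only [Nat.cast_one, one_dvd, Finset.filter_true, one_mul] at h
  refine le_trans (le_of_eq ?_) h
  refine Finset.sum_congr rfl fun ψ _ => ?_
  classical
  have : fiberPart (localCoeff K U f x) 1 ψ ((0 : ℤ) : ZMod D) = localCoeff K U f x ψ := by
    rw [fiberPart, Finset.sum_eq_single ψ]
    · simp
    · intro φ hφ hne
      simp at hφ
      exact absurd hφ hne
    · intro hψ
      simp at hψ
  rw [← this]

include hW hW0 hKW hA hQ in
theorem sum_localSquare_le (hT : ∀ k ∈ Finset.Icc 1 Q, k.divisors.card ≤ T) (hQ1 : 1 ≤ Q)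
    (X : Finset ℤ) (f : ℤ → ℂ) :
    ∑ ω ∈ Finset.Icc 1 Q ×ˢ X ×ˢ (Finset.univ : Finset (ZMod D)), localSquare D K U Q f ω
      ≤ (2 * A ^ 2 * T * D) * ∑ u ∈ U, ‖f u‖ ^ 2 := by
  classical
  have hA0 : 0 ≤ A := (tsum_nonneg hW0).trans hA
  have h1 : ∀ g x, ∑ y : ZMod D, localSquare D K U Q f (g, x, y)
      = ∑ q ∈ Finset.Icc 1 Q, if g ∣ q then
        D * ∑ ψ : AddChar (ZMod D) ℂ with orderOf ψ = q, ‖localCoeff K U f x ψ‖ ^ 2 else 0 := by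
    intro g x
    simp only [localSquare]
    rw [Finset.sum_comm, Finset.sum_filter]
    refine Finset.sum_congr rfl fun q _ => ?_
    split_ifs
    · rw [sum_mulAverage, sum_normSq_orderPart, ZMod.card]
    · rfl
  have h2 : ∀ x, ∑ g ∈ Finset.Icc 1 Q, ∑ y : ZMod D, localSquare D K U Q f (g, x, y)
      ≤ T * (D * (2 * A * ∑ u ∈ U, ‖f u‖ ^ 2 * W (x - u))) := by
    intro x
    simp_rw [h1]
    rw [Finset.sum_comm]
    calc _ ≤ ∑ q ∈ Finset.Icc 1 Q, (T : ℝ) * (D *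
            ∑ ψ : AddChar (ZMod D) ℂ with orderOf ψ = q, ‖localCoeff K U f x ψ‖ ^ 2) := by
          refine Finset.sum_le_sum fun q hq => ?_
          rw [← Finset.sum_filter, Finset.sum_const, nsmul_eq_mul]
          refine mul_le_mul_of_nonneg_right ?_ (by positivity)
          have : (Finset.Icc 1 Q).filter (fun g => g ∣ q) ⊆ q.divisors := fun g hg =>
            Nat.mem_divisors.mpr ⟨(Finset.mem_filter.mp hg).2,
              by have := (Finset.mem_Icc.mp hq).1; omega⟩
          exact_mod_cast (Finset.card_le_card this).trans (hT q hq)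
      _ = T * (D * ∑ ψ : AddChar (ZMod D) ℂ with orderOf ψ ≤ Q,
            ‖localCoeff K U f x ψ‖ ^ 2) := by
          rw [← Finset.mul_sum, ← Finset.mul_sum]
          congr 2
          rw [← Finset.sum_fiberwise_of_maps_to (t := Finset.Icc 1 Q) (g := orderOf)
            (s := Finset.univ.filter fun ψ : AddChar (ZMod D) ℂ => orderOf ψ ≤ Q)]
          · refine Finset.sum_congr rfl fun q hq => Finset.sum_congr ?_ fun _ _ => rfl
            ext ψ
            simp only [Finset.mem_filter, Finset.mem_univ, true_and]
            exact ⟨fun h => ⟨h.le.trans (Finset.mem_Icc.mp hq).2, h⟩, fun h => h.2⟩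
          · intro ψ hψ
            exact Finset.mem_Icc.mpr ⟨orderOf_pos ψ, (Finset.mem_filter.mp hψ).2⟩
      _ ≤ _ := by
          gcongr
          exact sum_normSq_localCoeff_le hW hW0 hKW hA hQ U hQ1 f x
  have h3 : ∀ u, ∑ x ∈ X, W (x - u) ≤ A := by
    intro u
    have hs : Summable fun x : ℤ => W (x - u) := by
      have h := Summable.int_add_right (E := ℝ) hW (-u)
      simpa only [sub_eq_add_neg] using h
    have h := tsum_int_add_right (E := ℝ) W (-u)
    simp only [← sub_eq_add_neg] at h
    exact ((hs.sum_le_tsum X fun _ _ => hW0 _).trans_eq h).trans hA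
  calc _ = ∑ x ∈ X, ∑ g ∈ Finset.Icc 1 Q, ∑ y : ZMod D, localSquare D K U Q f (g, x, y) := by
        rw [Finset.sum_product]
        simp_rw [Finset.sum_product]
        rw [Finset.sum_comm]
    _ ≤ ∑ x ∈ X, T * (D * (2 * A * ∑ u ∈ U, ‖f u‖ ^ 2 * W (x - u))) :=
        Finset.sum_le_sum fun x _ => h2 x
    _ = T * (D * (2 * A * ∑ u ∈ U, ‖f u‖ ^ 2 * ∑ x ∈ X, W (x - u))) := by
        simp_rw [← Finset.mul_sum]
        rw [Finset.sum_comm]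
        simp_rw [Finset.mul_sum]
    _ ≤ T * (D * (2 * A * ∑ u ∈ U, ‖f u‖ ^ 2 * A)) := by
        gcongr with u
        exact h3 u
    _ = _ := by rw [← Finset.sum_mul]; ring

/-- Multi-frequency estimate on the product of the integers and a finite cyclic group. -/
theorem sum_norm_localCoeff_pow_le {m : ℕ} (hm : 1 ≤ m)
    (hW : Summable W) (hW0 : ∀ u, 0 ≤ W u) (hKW : ∀ u, ‖K u‖ ≤ W u) (hA0 : 0 < A)
    (hA : ∑' u, W u ≤ A) (hQ : ((Q : ℝ) ^ 2 + (Q : ℝ) ^ 6) * totalVariation W ≤ A)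
    (hD : ∀ q ∈ Finset.Icc 1 Q, q ∣ D) (hT0 : 0 < T)
    (hT : ∀ k ∈ Finset.Icc 1 (Q ^ m), k.divisors.card ≤ T) (hQ1 : 1 ≤ Q)
    (X U : Finset ℤ) (f : ℤ → ℂ) :
    ∑ x ∈ X, ∑ y : ZMod D, ‖∑ ψ : AddChar (ZMod D) ℂ with orderOf ψ ≤ Q,
        localCoeff K U f x ψ * ψ y‖ ^ (2 * (m + 1))
      ≤ ((T : ℝ) ^ 2 ^ (2 * (m + 1))) ^ (m + 1) * (2 ^ (m + 1) * (T : ℝ) ^ (m + 1) *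
        (16 / 3 * (16 * (4 * A ^ 2 * T ^ 3)) ^ m * (2 * A ^ 2 * T * D)
          * ∑ u ∈ U, ‖f u‖ ^ (2 * (m + 1)))) := by
  classical
  have hT' : ∀ k ∈ Finset.Icc 1 Q, k.divisors.card ≤ T := fun k hk => hT k <| by
    rw [Finset.mem_Icc] at hk ⊢
    exact ⟨hk.1, hk.2.trans (Nat.le_self_pow (by omega) Q)⟩
  have hT0' : (0 : ℝ) < T := by exact_mod_cast hT0
  have hpt : ∀ x, ∑ y : ZMod D, ‖∑ ψ : AddChar (ZMod D) ℂ with orderOf ψ ≤ Q,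
        localCoeff K U f x ψ * ψ y‖ ^ (2 * (m + 1))
      ≤ ((T : ℝ) ^ 2 ^ (2 * (m + 1))) ^ (m + 1) * (2 ^ (m + 1) * (T : ℝ) ^ (m + 1) *
        ∑ g ∈ Finset.Icc 1 Q, ∑ y : ZMod D, localSquare D K U Q f (g, x, y) ^ (m + 1)) := by
    intro x
    have h1 : ∀ y : ZMod D, ∑ ψ : AddChar (ZMod D) ℂ with orderOf ψ ≤ Q,
        localCoeff K U f x ψ * ψ y
        = ∑ q ∈ Finset.Icc 1 Q, orderPart (localCoeff K U f x) q y := by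
      intro y
      rw [← Finset.sum_fiberwise_of_maps_to (t := Finset.Icc 1 Q) (g := orderOf)
            (s := Finset.univ.filter fun ψ : AddChar (ZMod D) ℂ => orderOf ψ ≤ Q)]
      · refine Finset.sum_congr rfl fun q hq => Finset.sum_congr ?_ fun _ _ => rfl
        ext ψ
        simp only [Finset.mem_filter, Finset.mem_univ, true_and]
        exact ⟨fun h => h.2, fun h => ⟨h.le.trans (Finset.mem_Icc.mp hq).2, h⟩⟩
      · intro ψ hψ
        exact Finset.mem_Icc.mpr ⟨orderOf_pos ψ, (Finset.mem_filter.mp hψ).2⟩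
    simp_rw [h1]
    refine (sum_norm_pow_le_sum_square_function _ Q (m + 1) T hT'
      (fun q _ y t => orderPart_invariant _ q y t)
      (fun q _ ℓ h y => sum_orderPart_eq_zero _ q ℓ h y)).trans ?_
    refine mul_le_mul_of_nonneg_left ?_ (by positivity)
    have := sum_pow_le_sum_mulAverage_pow (Y := ZMod D)
      (fun q y => ‖orderPart (localCoeff K U f x) q y‖ ^ 2) Q m T hT
      (fun _ _ => by positivity)
      (fun q _ y t => by have := orderPart_invariant (localCoeff K U f x) q y t; rw [← this])
    unfold localSquare
    convert this
  have hI := sum_pow_le_of_interpolation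
    (Finset.Icc 1 Q ×ˢ X ×ˢ (Finset.univ : Finset (ZMod D))) U (localSquare D K U Q)
    (localSquare_nonneg K U Q) (localSquare_add_le K U Q)
    (B := 4 * A ^ 2 * T ^ 3) (B₂ := 2 * A ^ 2 * T * D) (by positivity) (by positivity)
    (fun f a hf ω hω => localSquare_le_of_bounded hW hW0 hKW hA hQ hD U hT' f hf ω
      (Finset.mem_product.mp hω).1)
    (fun f => sum_localSquare_le hW hW0 hKW hA hQ U hT' hQ1 X f) hm f
  calc _ ≤ ∑ x ∈ X, ((T : ℝ) ^ 2 ^ (2 * (m + 1))) ^ (m + 1) * (2 ^ (m + 1) * (T : ℝ) ^ (m + 1) *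
        ∑ g ∈ Finset.Icc 1 Q, ∑ y : ZMod D, localSquare D K U Q f (g, x, y) ^ (m + 1)) :=
        Finset.sum_le_sum fun x _ => hpt x
    _ = ((T : ℝ) ^ 2 ^ (2 * (m + 1))) ^ (m + 1) * (2 ^ (m + 1) * (T : ℝ) ^ (m + 1) *
        ∑ ω ∈ Finset.Icc 1 Q ×ˢ X ×ˢ (Finset.univ : Finset (ZMod D)),
          localSquare D K U Q f ω ^ (m + 1)) := by
        rw [← Finset.mul_sum, ← Finset.mul_sum]
        congr 2
        rw [Finset.sum_product]
        simp_rw [Finset.sum_product]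
        rw [Finset.sum_comm]
    _ ≤ _ := by gcongr

end DiscreteLargeSieve

section SchurTest

/-- Jensen's inequality for a nonnegative weight. -/
theorem sum_mul_pow_succ_le {ι : Type*} (s : Finset ι) (w z : ι → ℝ) (hw : ∀ i ∈ s, 0 ≤ w i)
    (hz : ∀ i ∈ s, 0 ≤ z i) (n : ℕ) :
    (∑ i ∈ s, w i * z i) ^ (n + 1) ≤ (∑ i ∈ s, w i) ^ n * ∑ i ∈ s, w i * z i ^ (n + 1) := by
  rcases (Finset.sum_nonneg hw).eq_or_lt with h | h
  · have h0 : ∀ i ∈ s, w i = 0 := (Finset.sum_eq_zero_iff_of_nonneg hw).mp h.symm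
    rw [Finset.sum_eq_zero (fun i hi => by rw [h0 i hi, zero_mul]), zero_pow (by omega)]
    exact mul_nonneg (by rw [← h]; positivity)
      (Finset.sum_nonneg fun i hi => by rw [h0 i hi, zero_mul])
  · set M := ∑ i ∈ s, w i
    have h1 := Real.pow_arith_mean_le_arith_mean_pow s (fun i => w i / M) z
      (fun i hi => div_nonneg (hw i hi) h.le) (by rw [← Finset.sum_div, div_self h.ne']) hz (n + 1)
    have h2 : ∀ g : ι → ℝ, ∑ i ∈ s, w i / M * g i = (∑ i ∈ s, w i * g i) / M := by
      intro g
      rw [Finset.sum_div]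
      exact Finset.sum_congr rfl fun i _ => by ring
    rw [h2, h2, div_pow, div_le_div_iff₀ (by positivity) h] at h1
    have h3 : (∑ i ∈ s, w i * z i) ^ (n + 1) * M
        ≤ (M ^ n * ∑ i ∈ s, w i * z i ^ (n + 1)) * M := by
      calc _ ≤ _ := h1
        _ = _ := by ring
    exact le_of_mul_le_mul_right h3 h

/-- Schur's test for integer powers. -/
theorem sum_sum_mul_pow_succ_le {ι κ : Type*} (X : Finset ι) (U : Finset κ) (w : ι → κ → ℝ)
    (hw : ∀ x u, 0 ≤ w x u) {A : ℝ} (hx : ∀ x ∈ X, ∑ u ∈ U, w x u ≤ A)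
    (hu : ∀ u ∈ U, ∑ x ∈ X, w x u ≤ A) (hA : 0 ≤ A) (z : κ → ℝ) (hz : ∀ u, 0 ≤ z u) (n : ℕ) :
    ∑ x ∈ X, (∑ u ∈ U, w x u * z u) ^ (n + 1) ≤ A ^ (n + 1) * ∑ u ∈ U, z u ^ (n + 1) := by
  calc _ ≤ ∑ x ∈ X, A ^ n * ∑ u ∈ U, w x u * z u ^ (n + 1) := by
        refine Finset.sum_le_sum fun x hxX =>
          (sum_mul_pow_succ_le U (w x) z (fun u _ => hw x u) (fun u _ => hz u) n).trans ?_
        refine mul_le_mul_of_nonneg_right (pow_le_pow_left₀ (Finset.sum_nonneg fun u _ => hw x u)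
          (hx x hxX) n) (Finset.sum_nonneg fun u _ => mul_nonneg (hw x u) (pow_nonneg (hz u) _))
    _ = A ^ n * ∑ u ∈ U, (∑ x ∈ X, w x u) * z u ^ (n + 1) := by
        rw [← Finset.mul_sum, Finset.sum_comm]
        simp_rw [Finset.sum_mul]
    _ ≤ A ^ n * ∑ u ∈ U, A * z u ^ (n + 1) := by
        refine mul_le_mul_of_nonneg_left (Finset.sum_le_sum fun u hU => ?_) (pow_nonneg hA n)
        exact mul_le_mul_of_nonneg_right (hu u hU) (pow_nonneg (hz u) _)
    _ = _ := by rw [← Finset.mul_sum]; ring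

end SchurTest

section IntervalAverages

variable {D : ℕ} [NeZero D]

/-- `F` is a combination of characters of order at most `n`, with coefficients of absolute sum at
most `M`. -/
def IsCharacterSum (n : ℕ) (M : ℝ) (F : ZMod D → ℂ) : Prop :=
  ∃ (ι : Type) (s : Finset ι) (a : ι → ℂ) (χ : ι → AddChar (ZMod D) ℂ),
    (∀ y, F y = ∑ i ∈ s, a i * χ i y) ∧ ∑ i ∈ s, ‖a i‖ ≤ M ∧
      ∀ i ∈ s, ∃ k, 0 < k ∧ k ≤ n ∧ χ i ^ k = 1

omit [NeZero D] in
theorem IsCharacterSum.mul {n n' : ℕ} {M M' : ℝ} {F F' : ZMod D → ℂ}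
    (h : IsCharacterSum n M F) (h' : IsCharacterSum n' M' F') :
    IsCharacterSum (n * n') (M * M') (fun y => F y * F' y) := by
  obtain ⟨ι, s, a, χ, h1, h2, h3⟩ := h
  obtain ⟨ι', s', a', χ', h1', h2', h3'⟩ := h'
  refine ⟨ι × ι', s ×ˢ s', fun i => a i.1 * a' i.2, fun i => χ i.1 * χ' i.2, fun y => ?_, ?_, ?_⟩
  · dsimp only
    rw [h1, h1', Finset.sum_mul_sum, Finset.sum_product]
    refine Finset.sum_congr rfl fun i _ => Finset.sum_congr rfl fun j _ => ?_
    rw [AddChar.mul_apply]; ring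
  · rw [Finset.sum_product]
    simp_rw [norm_mul]
    rw [← Finset.sum_mul_sum]
    exact mul_le_mul h2 h2' (by positivity) ((by positivity : (0 : ℝ) ≤ ∑ i ∈ s, ‖a i‖).trans h2)
  · rintro ⟨i, j⟩ hij
    rw [Finset.mem_product] at hij
    obtain ⟨k, hk0, hk, hk1⟩ := h3 i hij.1
    obtain ⟨k', hk0', hk', hk1'⟩ := h3' j hij.2
    refine ⟨k * k', by positivity, Nat.mul_le_mul hk hk', ?_⟩
    dsimp only
    rw [mul_pow, pow_mul, hk1, one_pow, mul_comm k, pow_mul, hk1', one_pow, one_mul]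

theorem IsCharacterSum.star {n : ℕ} {M : ℝ} {F : ZMod D → ℂ} (h : IsCharacterSum n M F) :
    IsCharacterSum n M (fun y => (starRingEnd ℂ) (F y)) := by
  obtain ⟨ι, s, a, χ, h1, h2, h3⟩ := h
  refine ⟨ι, s, fun i => (starRingEnd ℂ) (a i), fun i => (χ i)⁻¹, fun y => ?_, ?_, ?_⟩
  · dsimp only
    rw [h1, map_sum]
    refine Finset.sum_congr rfl fun i _ => ?_
    rw [map_mul, AddChar.inv_apply, AddChar.map_neg_eq_conj]
  · simpa using h2
  · intro i hi
    obtain ⟨k, hk0, hk, hk1⟩ := h3 i hi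
    exact ⟨k, hk0, hk, by rw [inv_pow, hk1, inv_one]⟩

omit [NeZero D] in
theorem IsCharacterSum.pow {n : ℕ} {M : ℝ} {F : ZMod D → ℂ}
    (h : IsCharacterSum n M F) (r : ℕ) :
    IsCharacterSum (n ^ r) (M ^ r) (fun y => F y ^ r) := by
  induction r with
  | zero =>
    exact ⟨Unit, {()}, fun _ => 1, fun _ => 1, fun y => by simp, by simp,
      fun _ _ => ⟨1, one_pos, by simp, by simp⟩⟩
  | succ r ih =>
    simp_rw [pow_succ]
    exact ih.mul h

/-- Averages of a character sum along an interval are close to its mean. -/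
theorem IsCharacterSum.norm_sum_interval_sub_le {n : ℕ} {M : ℝ} {F : ZMod D → ℂ}
    (h : IsCharacterSum n M F) (x : ZMod D) (H : ℕ) :
    ‖∑ j ∈ Finset.range H, F (x + j) - H / D * ∑ y, F y‖ ≤ 2 * n * M := by
  obtain ⟨ι, s, a, χ, h1, h2, h3⟩ := h
  have hD : (D : ℂ) ≠ 0 := NeZero.ne _
  have key : ∀ i ∈ s, ‖∑ j ∈ Finset.range H, χ i (x + j) - H / D * ∑ y, χ i y‖ ≤ 2 * n := by
    intro i hi
    obtain ⟨k, hk0, hk, hk1⟩ := h3 i hi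
    by_cases hχ : χ i = 1
    · rw [hχ]
      simp only [AddChar.one_apply, Finset.sum_const, Finset.card_range, Finset.card_univ,
        ZMod.card, nsmul_eq_mul, mul_one]
      rw [div_mul_cancel₀ _ hD, sub_self, norm_zero]
      positivity
    · rw [AddChar.sum_eq_zero_of_ne_one hχ, mul_zero, sub_zero]
      have hζ1 : χ i 1 ≠ 1 := (AddChar.zmod_char_ne_one_iff D (χ i)).mp hχ
      have hζk : (χ i 1) ^ k = 1 := by
        rw [← AddChar.pow_apply, hk1, AddChar.one_apply]
      have hsep := norm_one_sub_ge_of_pow_eq_one hk0 hζk hζ1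
      have hsum : ∑ j ∈ Finset.range H, χ i (x + j)
          = χ i x * ∑ j ∈ Finset.range H, (χ i 1) ^ j := by
        rw [Finset.mul_sum]
        refine Finset.sum_congr rfl fun j _ => ?_
        rw [AddChar.map_add_eq_mul, ← AddChar.map_nsmul_eq_pow, nsmul_one]
      have hgeom := mul_neg_geom_sum (χ i 1) H
      have hle : ‖1 - χ i 1‖ * ‖∑ j ∈ Finset.range H, (χ i 1) ^ j‖ ≤ 2 := by
        rw [← norm_mul, hgeom]
        refine (norm_sub_le _ _).trans ?_
        rw [norm_one, norm_pow, AddChar.norm_apply, one_pow]; norm_num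
      rw [hsum, norm_mul, AddChar.norm_apply, one_mul]
      have h0 := norm_nonneg (∑ j ∈ Finset.range H, (χ i 1) ^ j)
      have hkn : (k : ℝ) ≤ n := by exact_mod_cast hk
      have hk0' : (0 : ℝ) ≤ k := by positivity
      calc _ = 1 * ‖∑ j ∈ Finset.range H, (χ i 1) ^ j‖ := (one_mul _).symm
        _ ≤ (k * ‖1 - χ i 1‖) * ‖∑ j ∈ Finset.range H, (χ i 1) ^ j‖ :=
            mul_le_mul_of_nonneg_right hsep h0
        _ = k * (‖1 - χ i 1‖ * ‖∑ j ∈ Finset.range H, (χ i 1) ^ j‖) := by ring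
        _ ≤ k * 2 := mul_le_mul_of_nonneg_left hle hk0'
        _ ≤ _ := by linarith
  have heq : ∑ j ∈ Finset.range H, F (x + j) - H / D * ∑ y, F y
      = ∑ i ∈ s, a i * (∑ j ∈ Finset.range H, χ i (x + j) - H / D * ∑ y, χ i y) := by
    simp_rw [h1, mul_sub, Finset.sum_sub_distrib]
    congr 1
    · rw [Finset.sum_comm]
      simp_rw [Finset.mul_sum]
    · rw [Finset.sum_comm, Finset.mul_sum]
      refine Finset.sum_congr rfl fun i _ => ?_
      rw [← Finset.mul_sum]; ring
  rw [heq]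
  refine (norm_sum_le _ _).trans ?_
  calc _ ≤ ∑ i ∈ s, ‖a i‖ * (2 * n) := Finset.sum_le_sum fun i hi => by
        rw [norm_mul]; exact mul_le_mul_of_nonneg_left (key i hi) (norm_nonneg _)
    _ = (∑ i ∈ s, ‖a i‖) * (2 * n) := (Finset.sum_mul _ _ _).symm
    _ ≤ M * (2 * n) := mul_le_mul_of_nonneg_right h2 (by positivity)
    _ = _ := by ring

theorem sum_range_norm_sum_char_pow_le (Q : ℕ) (c : AddChar (ZMod D) ℂ → ℂ) {M : ℝ}
    (hM : ∑ ψ : AddChar (ZMod D) ℂ with orderOf ψ ≤ Q, ‖c ψ‖ ≤ M) (r : ℕ) (x : ZMod D) (H : ℕ) :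
    ∑ j ∈ Finset.range H,
        ‖∑ ψ : AddChar (ZMod D) ℂ with orderOf ψ ≤ Q, c ψ * ψ (x + j)‖ ^ (2 * r)
      ≤ H / D * ∑ y, ‖∑ ψ : AddChar (ZMod D) ℂ with orderOf ψ ≤ Q, c ψ * ψ y‖ ^ (2 * r)
        + 2 * Q ^ (2 * r) * M ^ (2 * r) := by
  have hM0 : 0 ≤ M :=
    (Finset.sum_nonneg fun _ _ => norm_nonneg _).trans hM
  set g : ZMod D → ℂ := fun y => ∑ ψ : AddChar (ZMod D) ℂ with orderOf ψ ≤ Q, c ψ * ψ y with hg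
  have h1 : IsCharacterSum Q M g :=
    ⟨AddChar (ZMod D) ℂ, Finset.univ.filter fun ψ => orderOf ψ ≤ Q, c, id, fun y => rfl, hM,
      fun ψ hψ => ⟨orderOf ψ, orderOf_pos ψ, (Finset.mem_filter.mp hψ).2, pow_orderOf_eq_one ψ⟩⟩
  have h2 := ((h1.pow r).mul
    (h1.star.pow r)).norm_sum_interval_sub_le x H
  have h3 : ∀ y, g y ^ r * (starRingEnd ℂ) (g y) ^ r = ((‖g y‖ ^ (2 * r) : ℝ) : ℂ) := by
    intro y
    rw [← mul_pow, Complex.mul_conj', ← pow_mul]; push_cast; rfl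
  simp_rw [h3] at h2
  have h4 : (∑ j ∈ Finset.range H, ((‖g (x + j)‖ ^ (2 * r) : ℝ) : ℂ)
      - H / D * ∑ y, ((‖g y‖ ^ (2 * r) : ℝ) : ℂ))
      = ((∑ j ∈ Finset.range H, ‖g (x + j)‖ ^ (2 * r) - H / D * ∑ y, ‖g y‖ ^ (2 * r) : ℝ) : ℂ) := by
    push_cast; rfl
  rw [h4, Complex.norm_real, Real.norm_eq_abs] at h2
  have h5 := (le_abs_self _).trans h2
  have h6 : 2 * ((Q ^ r * Q ^ r : ℕ) : ℝ) * (M ^ r * M ^ r) = 2 * Q ^ (2 * r) * M ^ (2 * r) := by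
    push_cast; ring
  rw [h6] at h5
  linarith

end IntervalAverages

section Transfer

variable {K : ℤ → ℂ} {V : ℝ}

theorem sum_norm_shift_sub_le (hK : Summable fun u => ‖K (u + 1) - K u‖)
    (hV : ∑' u, ‖K (u + 1) - K u‖ ≤ V) (j : ℕ) (X : Finset ℤ) :
    ∑ x ∈ X, ‖K (x + j) - K x‖ ≤ j * V := by
  induction j with
  | zero => simp
  | succ j ih =>
    calc _ ≤ ∑ x ∈ X, (‖K (x + j) - K x‖ + ‖K (x + j + 1) - K (x + j)‖) := by
          refine Finset.sum_le_sum fun x _ => ?_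
          have : K (x + (j + 1 : ℕ)) - K x = (K (x + j) - K x) + (K (x + j + 1) - K (x + j)) := by
            push_cast; rw [add_assoc]; ring
          rw [this]
          exact norm_add_le _ _
      _ ≤ j * V + V := by
          rw [Finset.sum_add_distrib]
          refine add_le_add ih ?_
          have h := tsum_int_add_right (E := ℝ) (fun u => ‖K (u + 1) - K u‖) (j : ℤ)
          have hs := Summable.int_add_right (E := ℝ) hK (j : ℤ)
          exact ((hs.sum_le_tsum X fun _ _ => norm_nonneg _).trans_eq h).trans hV
      _ = _ := by push_cast; ring

variable {W : ℤ → ℝ} {A : ℝ}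

theorem sum_weight_le (hW : Summable W) (hW0 : ∀ u, 0 ≤ W u) (hA : ∑' u, W u ≤ A)
    (X : Finset ℤ) : ∑ x ∈ X, W x ≤ A :=
  (hW.sum_le_tsum X fun _ _ => hW0 _).trans hA

theorem sum_sub_right_le_of_forall {w : ℤ → ℝ} (h : ∀ X : Finset ℤ, ∑ x ∈ X, w x ≤ A) (u : ℤ)
    (X : Finset ℤ) : ∑ x ∈ X, w (x - u) ≤ A := by
  classical
  refine le_trans (le_of_eq ?_) (h (X.image fun x => x - u))
  rw [Finset.sum_image fun a _ b _ hab => by simpa using hab]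

theorem sum_sub_left_le_of_forall {w : ℤ → ℝ} (h : ∀ X : Finset ℤ, ∑ x ∈ X, w x ≤ A) (x : ℤ)
    (U : Finset ℤ) : ∑ u ∈ U, w (x - u) ≤ A := by
  classical
  refine le_trans (le_of_eq ?_) (h (U.image fun u => x - u))
  rw [Finset.sum_image fun a _ b _ hab => by simpa using hab]

theorem sum_convolution_pow_le {w : ℤ → ℝ} (hw : ∀ u, 0 ≤ w u)
    (h : ∀ X : Finset ℤ, ∑ x ∈ X, w x ≤ A) (f : ℤ → ℂ) (X U : Finset ℤ) (n : ℕ) :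
    ∑ x ∈ X, (∑ u ∈ U, w (x - u) * ‖f u‖) ^ (n + 1)
      ≤ A ^ (n + 1) * ∑ u ∈ U, ‖f u‖ ^ (n + 1) :=
  sum_sum_mul_pow_succ_le X U (fun x u => w (x - u)) (fun _ _ => hw _)
    (fun x _ => sum_sub_left_le_of_forall h x U) (fun u _ => sum_sub_right_le_of_forall h u X)
    (by simpa using h ∅) _ (fun _ => norm_nonneg _) n

variable {D : ℕ} [NeZero D]

theorem norm_localCoeff_le (hKW : ∀ u, ‖K u‖ ≤ W u) (U : Finset ℤ) (f : ℤ → ℂ) (x : ℤ)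
    (φ : AddChar (ZMod D) ℂ) : ‖localCoeff K U f x φ‖ ≤ ∑ u ∈ U, W (x - u) * ‖f u‖ := by
  refine (norm_sum_le _ _).trans (Finset.sum_le_sum fun u _ => ?_)
  rw [norm_mul, norm_mul, AddChar.norm_apply, mul_one, mul_comm]
  exact mul_le_mul_of_nonneg_right (hKW _) (norm_nonneg _)

theorem norm_localCoeff_shift_sub_le (U : Finset ℤ) (f : ℤ → ℂ) (x : ℤ) (j : ℕ)
    (φ : AddChar (ZMod D) ℂ) : ‖localCoeff K U f (x + j) φ - localCoeff K U f x φ‖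
      ≤ ∑ u ∈ U, ‖K (x - u + j) - K (x - u)‖ * ‖f u‖ := by
  rw [localCoeff, localCoeff, ← Finset.sum_sub_distrib]
  refine (norm_sum_le _ _).trans (Finset.sum_le_sum fun u _ => ?_)
  rw [← sub_mul, ← mul_sub, norm_mul, norm_mul, AddChar.norm_apply, mul_one, mul_comm,
    add_sub_right_comm]

theorem sum_norm_le_of_norm_le (Q : ℕ) (c : AddChar (ZMod D) ℂ → ℂ) {M : ℝ}
    (hc : ∀ ψ, ‖c ψ‖ ≤ M) :
    ∑ ψ : AddChar (ZMod D) ℂ with orderOf ψ ≤ Q, ‖c ψ‖ ≤ Q ^ 2 * M := by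
  have hM : 0 ≤ M := (norm_nonneg _).trans (hc 1)
  refine (Finset.sum_le_sum fun ψ _ => hc ψ).trans ?_
  rw [Finset.sum_const, nsmul_eq_mul]
  refine mul_le_mul_of_nonneg_right ?_ hM
  exact_mod_cast card_addChar_orderOf_le D Q

/-- A bound for the averaged local expansion yields one for the expansion on the integers, as the
coefficients are essentially constant at small scales. -/
theorem sum_norm_localExpansion_pow_le {n : ℕ}
    (hW : Summable W) (hW0 : ∀ u, 0 ≤ W u) (hKW : ∀ u, ‖K u‖ ≤ W u)
    (hA : ∑' u, W u ≤ A) {Q : ℕ} (hQ1 : 1 ≤ Q)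
    (hK : Summable fun u => ‖K (u + 1) - K u‖) (hV : ∑' u, ‖K (u + 1) - K u‖ ≤ V)
    (hQV : (Q : ℝ) ^ (6 * (n + 1) + 2) * V ≤ A) (U : Finset ℤ) (f : ℤ → ℂ) {B : ℝ}
    (hB : ∀ X : Finset ℤ, ∑ x ∈ X, ∑ y : ZMod D, ‖∑ ψ : AddChar (ZMod D) ℂ with orderOf ψ ≤ Q,
        localCoeff K U f x ψ * ψ y‖ ^ (2 * (n + 1)) ≤ D * B) (X : Finset ℤ) :
    ∑ x ∈ X, ‖∑ ψ : AddChar (ZMod D) ℂ with orderOf ψ ≤ Q,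
        localCoeff K U f x ψ * ψ (x : ZMod D)‖ ^ (2 * (n + 1))
      ≤ 2 ^ (2 * (n + 1)) * (B + 3 * A ^ (2 * (n + 1)) * ∑ u ∈ U, ‖f u‖ ^ (2 * (n + 1))) := by
  classical
  have hA0 : 0 ≤ A := (tsum_nonneg hW0).trans hA
  have hV0 : 0 ≤ V := (tsum_nonneg fun _ => norm_nonneg _).trans hV
  have hD : (0 : ℝ) < D := by exact_mod_cast NeZero.pos D
  set H := Q ^ (6 * (n + 1)) with hH
  have hHpos : (0 : ℝ) < H := by
    have : 0 < Q ^ (6 * (n + 1)) := by positivity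
    exact_mod_cast this
  set F := ∑ u ∈ U, ‖f u‖ ^ (2 * (n + 1)) with hF
  have hF0 : 0 ≤ F := Finset.sum_nonneg fun _ _ => by positivity
  set S := Finset.univ.filter fun ψ : AddChar (ZMod D) ℂ => orderOf ψ ≤ Q with hS
  set X' := (Finset.range H).biUnion fun j => X.image fun x => x - (j : ℤ) with hX'
  have h1 : ∀ j ∈ Finset.range H,
      ∑ x ∈ X, ‖∑ ψ ∈ S, localCoeff K U f x ψ * ψ (x : ZMod D)‖ ^ (2 * (n + 1))
      ≤ ∑ x ∈ X', 2 ^ (2 * (n + 1)) *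
        (‖∑ ψ ∈ S, localCoeff K U f x ψ * ψ ((x : ZMod D) + j)‖ ^ (2 * (n + 1))
        + (Q ^ 2 * ∑ u ∈ U, ‖K (x - u + j) - K (x - u)‖ * ‖f u‖) ^ (2 * (n + 1))) := by
    intro j hj
    have hsub : X.image (fun x => x - (j : ℤ)) ⊆ X' :=
      Finset.subset_biUnion_of_mem (fun j : ℕ => X.image fun x => x - (j : ℤ)) hj
    have e1 : ∑ x ∈ X, ‖∑ ψ ∈ S, localCoeff K U f x ψ * ψ (x : ZMod D)‖ ^ (2 * (n + 1))
        = ∑ x ∈ X.image (fun x => x - (j : ℤ)),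
          ‖∑ ψ ∈ S, localCoeff K U f (x + j) ψ * ψ ((x : ZMod D) + j)‖ ^ (2 * (n + 1)) := by
      rw [Finset.sum_image fun a _ b _ hab => by simpa using hab]
      refine Finset.sum_congr rfl fun x _ => ?_
      push_cast
      simp only [sub_add_cancel]
    rw [e1]
    refine (Finset.sum_le_sum_of_subset_of_nonneg hsub fun _ _ _ => by positivity).trans ?_
    refine Finset.sum_le_sum fun x _ => ?_
    have e2 : ‖∑ ψ ∈ S, localCoeff K U f (x + j) ψ * ψ ((x : ZMod D) + j)‖
        ≤ ‖∑ ψ ∈ S, localCoeff K U f x ψ * ψ ((x : ZMod D) + j)‖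
          + Q ^ 2 * ∑ u ∈ U, ‖K (x - u + j) - K (x - u)‖ * ‖f u‖ := by
      have e3 : ∑ ψ ∈ S, localCoeff K U f (x + j) ψ * ψ ((x : ZMod D) + j)
          = ∑ ψ ∈ S, localCoeff K U f x ψ * ψ ((x : ZMod D) + j)
          + ∑ ψ ∈ S, (localCoeff K U f (x + j) ψ - localCoeff K U f x ψ)
            * ψ ((x : ZMod D) + j) := by
        rw [← Finset.sum_add_distrib]
        exact Finset.sum_congr rfl fun ψ _ => by ring
      rw [e3]
      refine (norm_add_le _ _).trans (add_le_add le_rfl ((norm_sum_le _ _).trans ?_))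
      simp_rw [norm_mul, AddChar.norm_apply, mul_one]
      exact sum_norm_le_of_norm_le Q
        (fun ψ => localCoeff K U f (x + j) ψ - localCoeff K U f x ψ)
        fun ψ => norm_localCoeff_shift_sub_le U f x j ψ
    have e4 : 0 ≤ Q ^ 2 * ∑ u ∈ U, ‖K (x - u + j) - K (x - u)‖ * ‖f u‖ :=
      mul_nonneg (by positivity) (Finset.sum_nonneg fun _ _ => by positivity)
    refine (pow_le_pow_left₀ (norm_nonneg _) e2 _).trans
      ((add_pow_le (norm_nonneg _) e4 _).trans ?_)
    refine mul_le_mul_of_nonneg_right (pow_le_pow_right₀ one_le_two (Nat.sub_le _ _))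
      (add_nonneg (by positivity) (by positivity))
  have h2 : ∀ j ∈ Finset.range H, ∑ x ∈ X',
      (Q ^ 2 * ∑ u ∈ U, ‖K (x - u + j) - K (x - u)‖ * ‖f u‖) ^ (2 * (n + 1))
        ≤ A ^ (2 * (n + 1)) * F := by
    intro j hj
    have hjH : (j : ℝ) ≤ H := by exact_mod_cast (Finset.mem_range.mp hj).le
    have e1 : ∀ X : Finset ℤ, ∑ x ∈ X, (Q ^ 2 * ‖K (x + j) - K x‖) ≤ A := by
      intro X
      rw [← Finset.mul_sum]
      have := sum_norm_shift_sub_le hK hV j X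
      calc _ ≤ (Q : ℝ) ^ 2 * (H * V) := by
            refine mul_le_mul_of_nonneg_left (this.trans ?_) (by positivity)
            exact mul_le_mul_of_nonneg_right hjH hV0
        _ = (Q : ℝ) ^ (6 * (n + 1) + 2) * V := by rw [hH]; push_cast; ring
        _ ≤ A := hQV
    have e2 := sum_convolution_pow_le (w := fun v => Q ^ 2 * ‖K (v + j) - K v‖)
      (fun _ => by positivity) e1 f X' U (2 * n + 1)
    simp_rw [Finset.mul_sum, ← mul_assoc]
    exact e2
  have h3 : ∑ x ∈ X', (Q ^ 2 * ∑ u ∈ U, W (x - u) * ‖f u‖) ^ (2 * (n + 1))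
      ≤ Q ^ (4 * (n + 1)) * (A ^ (2 * (n + 1)) * F) := by
    simp_rw [mul_pow]
    rw [← Finset.mul_sum, ← pow_mul, show 2 * (2 * (n + 1)) = 4 * (n + 1) by ring]
    refine mul_le_mul_of_nonneg_left ?_ (by positivity)
    exact sum_convolution_pow_le hW0 (sum_weight_le hW hW0 hA) f X' U (2 * n + 1)
  have h4 : ∑ j ∈ Finset.range H, ∑ x ∈ X',
      ‖∑ ψ ∈ S, localCoeff K U f x ψ * ψ ((x : ZMod D) + j)‖ ^ (2 * (n + 1))
      ≤ H * B + H * (2 * (A ^ (2 * (n + 1)) * F)) := by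
    rw [Finset.sum_comm]
    have e1 : ∀ x ∈ X', ∑ j ∈ Finset.range H,
        ‖∑ ψ ∈ S, localCoeff K U f x ψ * ψ ((x : ZMod D) + j)‖ ^ (2 * (n + 1))
        ≤ H / D * ∑ y : ZMod D, ‖∑ ψ ∈ S, localCoeff K U f x ψ * ψ y‖ ^ (2 * (n + 1))
          + 2 * Q ^ (2 * (n + 1)) * (Q ^ 2 * ∑ u ∈ U, W (x - u) * ‖f u‖) ^ (2 * (n + 1)) := by
      intro x _
      have e2 := sum_norm_le_of_norm_le (D := D) Q (localCoeff K U f x)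
        fun ψ => norm_localCoeff_le hKW U f x ψ
      have e3 := sum_range_norm_sum_char_pow_le (D := D) Q (localCoeff K U f x) e2 (n + 1) x H
      convert e3
    refine (Finset.sum_le_sum e1).trans ?_
    rw [Finset.sum_add_distrib, ← Finset.mul_sum, ← Finset.mul_sum]
    refine add_le_add ?_ ?_
    · calc _ ≤ (H : ℝ) / D * (D * B) := mul_le_mul_of_nonneg_left (hB X') (by positivity)
        _ = _ := by field_simp
    · calc _ ≤ 2 * (Q : ℝ) ^ (2 * (n + 1)) * (Q ^ (4 * (n + 1)) * (A ^ (2 * (n + 1)) * F)) :=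
            mul_le_mul_of_nonneg_left h3 (by positivity)
        _ = _ := by rw [hH]; push_cast; ring
  have h5 := Finset.sum_le_sum h1
  rw [Finset.sum_const, Finset.card_range, nsmul_eq_mul] at h5
  simp_rw [← Finset.mul_sum, Finset.sum_add_distrib] at h5
  have h6 := Finset.sum_le_sum h2
  rw [Finset.sum_const, Finset.card_range, nsmul_eq_mul] at h6
  have h7 := h5.trans (mul_le_mul_of_nonneg_left (add_le_add h4 h6) (by positivity))
  refine le_of_mul_le_mul_left (h7.trans_eq ?_) hHpos
  ring

end Transfer

section CauchyWeight

/-- The weight `δ / (1 + (δ u)²)` on the integers. -/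
noncomputable def cauchyWeight (δ : ℝ) (u : ℤ) : ℝ := δ / (1 + (δ * u) ^ 2)

theorem cauchyWeight_nonneg {δ : ℝ} (hδ : 0 < δ) (u : ℤ) : 0 ≤ cauchyWeight δ u := by
  unfold cauchyWeight; positivity

theorem cauchyWeight_neg (δ : ℝ) (u : ℤ) : cauchyWeight δ (-u) = cauchyWeight δ u := by
  unfold cauchyWeight; push_cast; ring_nf

theorem sum_range_cauchyWeight_le {δ : ℝ} (hδ : 0 < δ) (N : ℕ) :
    ∑ n ∈ Finset.range N, cauchyWeight δ (n + 1 : ℤ) ≤ 2 * (1 - 1 / (1 + δ * N)) := by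
  induction N with
  | zero => simp
  | succ N ih =>
    rw [Finset.sum_range_succ]
    have hx : 0 ≤ δ * (N : ℝ) := by positivity
    have h : cauchyWeight δ (N + 1 : ℤ) ≤ 2 * (1 / (1 + δ * N) - 1 / (1 + δ * (N + 1 : ℕ))) := by
      unfold cauchyWeight
      push_cast
      generalize hs : δ * (N : ℝ) = s at *
      have e : δ * ((N : ℝ) + 1) = s + δ := by rw [← hs]; ring
      rw [e]
      have e2 : 2 * (1 / (1 + s) - 1 / (1 + (s + δ))) = 2 * δ / ((1 + s) * (1 + (s + δ))) := by
        field_simp; ring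
      rw [e2, div_le_div_iff₀ (by positivity) (by positivity)]
      have : (1 + s) * (1 + (s + δ)) ≤ 2 * (1 + (s + δ) ^ 2) := by
        nlinarith [sq_nonneg (s + δ - 1), mul_nonneg hx hδ.le]
      nlinarith
    linarith

theorem summable_cauchyWeight_and_tsum_le {δ : ℝ} (hδ : 0 < δ) (hδ1 : δ ≤ 1) :
    Summable (cauchyWeight δ) ∧ ∑' u, cauchyWeight δ u ≤ 5 := by
  have h2 : ∀ N, ∑ n ∈ Finset.range N, cauchyWeight δ (n + 1 : ℤ) ≤ 2 := fun N =>
    (sum_range_cauchyWeight_le hδ N).trans (by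
      have : 0 ≤ 1 / (1 + δ * N) := by positivity
      linarith)
  have h3 : ∀ N, ∑ n ∈ Finset.range N, cauchyWeight δ (n : ℤ) ≤ 3 := by
    intro N
    rcases N with _ | N
    · simp
    · rw [Finset.sum_range_succ']
      have := h2 N
      have h0 : cauchyWeight δ ((0 : ℕ) : ℤ) ≤ 1 := by simpa [cauchyWeight] using hδ1
      push_cast at *
      linarith
  have h2' : ∀ N, ∑ n ∈ Finset.range N, cauchyWeight δ (-(n + 1 : ℤ)) ≤ 2 := by
    simpa only [cauchyWeight_neg] using h2
  have s3 := summable_of_sum_range_le (fun n => cauchyWeight_nonneg hδ _) h3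
  have s2 := summable_of_sum_range_le (fun n => cauchyWeight_nonneg hδ _) h2'
  refine ⟨Summable.of_nat_of_neg_add_one s3 s2, ?_⟩
  rw [tsum_of_nat_of_neg_add_one s3 s2]
  have t3 := Real.tsum_le_of_sum_range_le (fun n => cauchyWeight_nonneg hδ _) h3
  have t2 := Real.tsum_le_of_sum_range_le (fun n => cauchyWeight_nonneg hδ _) h2'
  linarith

theorem abs_inv_one_add_sq_sub_le (a b : ℝ) :
    |1 / (1 + a ^ 2) - 1 / (1 + b ^ 2)|
      ≤ |a - b| * (1 / (1 + a ^ 2) + 1 / (1 + b ^ 2)) := by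
  have e : 1 / (1 + a ^ 2) - 1 / (1 + b ^ 2)
      = (a - b) * (-(a + b) * (1 / (1 + a ^ 2)) * (1 / (1 + b ^ 2))) := by
    field_simp; ring
  rw [e, abs_mul]
  refine mul_le_mul_of_nonneg_left ?_ (abs_nonneg _)
  have e2 : 1 / (1 + a ^ 2) + 1 / (1 + b ^ 2)
      = (2 + a ^ 2 + b ^ 2) * (1 / (1 + a ^ 2) * (1 / (1 + b ^ 2))) := by
    field_simp; ring
  rw [e2, mul_assoc, abs_mul, abs_of_nonneg (a := 1 / (1 + a ^ 2) * (1 / (1 + b ^ 2)))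
    (by positivity)]
  refine mul_le_mul_of_nonneg_right ?_ (by positivity)
  rw [abs_neg, abs_le]
  constructor <;> nlinarith [sq_nonneg (a + 1), sq_nonneg (b + 1), sq_nonneg (a - 1),
    sq_nonneg (b - 1)]

theorem totalVariation_cauchyWeight_le {δ : ℝ} (hδ : 0 < δ) (hδ1 : δ ≤ 1) :
    totalVariation (cauchyWeight δ) ≤ 10 * δ := by
  obtain ⟨hs, ht⟩ := summable_cauchyWeight_and_tsum_le hδ hδ1
  have h1 : ∀ u, |cauchyWeight δ u - cauchyWeight δ (u - 1)|
      ≤ δ * (cauchyWeight δ u + cauchyWeight δ (u - 1)) := by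
    intro u
    have h := abs_inv_one_add_sq_sub_le (δ * u) (δ * (u - 1 : ℤ))
    have e : δ * (u : ℝ) - δ * (u - 1 : ℤ) = δ := by push_cast; ring
    rw [e, abs_of_pos hδ] at h
    have e1 : ∀ v : ℤ, cauchyWeight δ v = δ * (1 / (1 + (δ * v) ^ 2)) := fun v => by
      rw [cauchyWeight, mul_one_div]
    rw [e1, e1, ← mul_sub, abs_mul, abs_of_pos hδ, ← mul_add]
    exact mul_le_mul_of_nonneg_left h hδ.le
  have hs' : Summable fun u => cauchyWeight δ (u - 1) := by
    simpa only [sub_eq_add_neg] using Summable.int_add_right (E := ℝ) hs (-1)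
  have ht' : ∑' u, cauchyWeight δ (u - 1) = ∑' u, cauchyWeight δ u := by
    simpa only [sub_eq_add_neg] using tsum_int_add_right (E := ℝ) (cauchyWeight δ) (-1)
  calc _ ≤ ∑' u, δ * (cauchyWeight δ u + cauchyWeight δ (u - 1)) :=
        (summable_abs_sub_shift hs 1).tsum_le_tsum h1 ((hs.add hs').mul_left δ)
    _ = δ * (∑' u, cauchyWeight δ u + ∑' u, cauchyWeight δ u) := by
        rw [tsum_mul_left, hs.tsum_add hs', ht']
    _ ≤ _ := by nlinarith

end CauchyWeight

section Kernel

open FourierTransform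

theorem norm_e2pi (x : ℝ) : ‖e2pi x‖ = 1 := by
  rw [e2pi, show (2 * Real.pi * Complex.I * x : ℂ) = ((2 * Real.pi * x : ℝ) : ℂ) * Complex.I by
    push_cast; ring, Complex.norm_exp_ofReal_mul_I]

theorem e2pi_add (x y : ℝ) : e2pi (x + y) = e2pi x * e2pi y := by
  rw [e2pi, e2pi, e2pi, ← Complex.exp_add]; push_cast; ring_nf

theorem e2pi_intCast (n : ℤ) : e2pi n = 1 := by
  rw [e2pi, Complex.exp_eq_one_iff]
  exact ⟨n, by push_cast; ring⟩

theorem continuous_e2pi : Continuous e2pi := by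
  unfold e2pi; fun_prop

/-- Decay of the Fourier transform of a test function and of its derivative. -/
theorem exists_fourier_decay {φ : ℝ → ℂ} (hφ : ContDiff ℝ (⊤ : ℕ∞) φ) (hc : HasCompactSupport φ) :
    ∃ C : ℝ, 0 < C ∧ (∀ s, ‖𝓕 φ s‖ ≤ C / (1 + s ^ 2)) ∧ Differentiable ℝ (𝓕 φ) ∧
      ∀ s, ‖deriv (𝓕 φ) s‖ ≤ C / (1 + s ^ 2) := by
  set Φ : SchwartzMap ℝ ℂ := hc.toSchwartzMap hφ with hΦ
  have hcoe : ((𝓕 Φ : SchwartzMap ℝ ℂ) : ℝ → ℂ) = 𝓕 φ := by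
    rw [SchwartzMap.fourier_coe]; rfl
  have decay : ∀ g : SchwartzMap ℝ ℂ, ∃ C : ℝ, 0 < C ∧ ∀ s, ‖g s‖ ≤ C / (1 + s ^ 2) := by
    intro g
    obtain ⟨C0, hC0, h0⟩ := g.decay 0 0
    obtain ⟨C2, hC2, h2⟩ := g.decay 2 0
    refine ⟨C0 + C2, by positivity, fun s => ?_⟩
    rw [le_div_iff₀ (by positivity)]
    have a := h0 s
    have b := h2 s
    rw [norm_iteratedFDeriv_zero] at a b
    rw [Real.norm_eq_abs, sq_abs] at b
    nlinarith
  obtain ⟨C, hC, h⟩ := decay (𝓕 Φ)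
  obtain ⟨C', hC', h'⟩ := decay (SchwartzMap.derivCLM ℝ ℂ (𝓕 Φ))
  refine ⟨C + C', by positivity, fun s => ?_, ?_, fun s => ?_⟩
  · have := h s
    rw [hcoe] at this
    exact this.trans (by gcongr; linarith)
  · rw [← hcoe]; exact (𝓕 Φ).differentiable
  · have := h' s
    rw [SchwartzMap.derivCLM_apply, hcoe] at this
    exact this.trans (by gcongr; linarith)

/-- The convolution kernel of the Fourier multiplier `η (ξ / δ)`. -/
noncomputable def localKernel (η : ℝ → ℝ) (δ : ℝ) (m : ℤ) : ℂ :=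
  δ * 𝓕 (fun t => (η t : ℂ)) (δ * m)

variable {η : ℝ → ℝ} (hηsmooth : ContDiff ℝ (⊤ : ℕ∞) η)
    (hη0 : ∀ x : ℝ, x ∉ Set.Ioo (-(1 / 2) : ℝ) (1 / 2) → η x = 0)

include hηsmooth hη0 in
theorem exists_localKernel_bounds : ∃ A : ℝ, 0 < A ∧ ∀ δ : ℝ, 0 < δ → δ ≤ 1 →
    ∃ W : ℤ → ℝ, Summable W ∧ (∀ u, 0 ≤ W u) ∧ (∀ u, ‖localKernel η δ u‖ ≤ W u) ∧
      ∑' u, W u ≤ A ∧ totalVariation W ≤ A * δ ∧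
      Summable (fun u => ‖localKernel η δ (u + 1) - localKernel η δ u‖) ∧
      ∑' u, ‖localKernel η δ (u + 1) - localKernel η δ u‖ ≤ A * δ := by
  obtain ⟨C, hC, h1, hd, h2⟩ := exists_fourier_decay (φ := fun t => (η t : ℂ))
    (Complex.ofRealCLM.contDiff.comp hηsmooth)
    (HasCompactSupport.intro (isCompact_Icc (a := -(1 / 2 : ℝ)) (b := 1 / 2)) fun x hx => by
      rw [hη0 x fun h => hx (Set.Ioo_subset_Icc_self h), Complex.ofReal_zero])
  set h := 𝓕 (fun t => (η t : ℂ)) with hh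
  refine ⟨15 * C, by positivity, fun δ hδ hδ1 => ?_⟩
  obtain ⟨hs, ht⟩ := summable_cauchyWeight_and_tsum_le hδ hδ1
  have hK : ∀ u, ‖localKernel η δ (u + 1) - localKernel η δ u‖ ≤ 3 * C * δ * cauchyWeight δ u := by
    intro u
    rw [localKernel, localKernel, ← mul_sub, norm_mul, Complex.norm_real, Real.norm_eq_abs,
      abs_of_pos hδ, ← hh]
    have := Convex.norm_image_sub_le_of_norm_deriv_le (f := h)
      (s := Set.Icc (δ * u) (δ * (u + 1 : ℤ))) (C := 3 * C / (1 + (δ * u) ^ 2))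
      (x := δ * u) (y := δ * (u + 1 : ℤ))
      (fun x _ => hd x) (fun x hx => (h2 x).trans ?_) (convex_Icc _ _)
      ⟨le_rfl, by push_cast; nlinarith⟩ ⟨by push_cast; nlinarith, le_rfl⟩
    · rw [show δ * ((u + 1 : ℤ) : ℝ) - δ * u = δ by push_cast; ring, Real.norm_eq_abs,
        abs_of_pos hδ] at this
      calc _ ≤ δ * (3 * C / (1 + (δ * u) ^ 2) * δ) := mul_le_mul_of_nonneg_left this hδ.le
        _ = _ := by rw [cauchyWeight]; ring
    · have a1 : δ * (u : ℝ) ≤ x := hx.1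
      have a2 : x ≤ δ * u + 1 := by
        have := hx.2
        push_cast at this
        linarith
      rw [div_le_div_iff₀ (by positivity) (by positivity)]
      have : 1 + (δ * (u : ℝ)) ^ 2 ≤ 3 * (1 + x ^ 2) := by
        nlinarith [sq_nonneg (x + (x - δ * u)), sq_nonneg (x - δ * u)]
      nlinarith
  have hsK : Summable fun u => ‖localKernel η δ (u + 1) - localKernel η δ u‖ :=
    Summable.of_nonneg_of_le (fun _ => norm_nonneg _) hK (hs.mul_left _)
  refine ⟨fun u => C * cauchyWeight δ u, hs.mul_left C,
    fun u => mul_nonneg hC.le (cauchyWeight_nonneg hδ u), fun u => ?_, ?_, ?_, hsK, ?_⟩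
  · rw [localKernel, norm_mul, Complex.norm_real, Real.norm_eq_abs, abs_of_pos hδ]
    calc _ ≤ δ * (C / (1 + (δ * u) ^ 2)) := mul_le_mul_of_nonneg_left (h1 _) hδ.le
      _ = C * cauchyWeight δ u := by rw [cauchyWeight]; ring
  · rw [tsum_mul_left]; nlinarith
  · have := totalVariation_cauchyWeight_le hδ hδ1
    unfold totalVariation at *
    simp_rw [← mul_sub, abs_mul, abs_of_pos hC]
    rw [tsum_mul_left]
    nlinarith
  · calc _ ≤ ∑' u, 3 * C * δ * cauchyWeight δ u := hsK.tsum_le_tsum hK (hs.mul_left _)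
      _ = 3 * C * δ * ∑' u, cauchyWeight δ u := tsum_mul_left
      _ ≤ 3 * C * δ * 5 := mul_le_mul_of_nonneg_left ht (by positivity)
      _ = _ := by ring

end Kernel

section IonescuWaingerKernel

open FourierTransform

variable {η : ℝ → ℝ}

theorem measurable_sub_round : Measurable fun t : ℝ => t - round t := by
  have : (fun t : ℝ => t - round t) = fun t => Int.fract (t + 1 / 2) - 1 / 2 := by
    funext t
    rw [round_eq, Int.fract]; ring
  rw [this]
  exact (measurable_fract.comp (measurable_id.add_const _)).sub_const _

theorem measurable_iwSymbol (hη : Continuous η) (N₁ N₂ : ℝ) : Measurable (iwSymbol η N₁ N₂) := by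
  refine Finset.measurable_sum _ fun aq _ => hη.measurable.comp (Measurable.const_mul ?_ _)
  exact measurable_sub_round.comp (measurable_id.sub_const _)

theorem integrable_period_mul_e2pi {g : ℝ → ℂ} (hg : Measurable g) {M : ℝ}
    (hgM : ∀ t, ‖g t‖ ≤ M) (c : ℝ → ℝ) (hc : Continuous c) :
    IntegrableOn (fun ξ => g ξ * e2pi (c ξ)) (Set.Ioc 0 1) := by
  refine Measure.integrableOn_of_bounded (M := M) (by simp)
    (hg.mul (continuous_e2pi.comp hc).measurable).aestronglyMeasurable (ae_of_all _ fun ξ => ?_)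
  rw [norm_mul, norm_e2pi, mul_one]
  exact hgM ξ

variable (hη : Continuous η) (hη01 : ∀ x : ℝ, η x ∈ Set.Icc (0 : ℝ) 1)
    (hη0 : ∀ x : ℝ, x ∉ Set.Ioo (-(1 / 2) : ℝ) (1 / 2) → η x = 0)

include hη0 in
theorem integral_bump_eq {δ : ℝ} (hδ : 0 < δ) (hδ1 : δ ≤ 1) (θ : ℝ) (m : ℤ) :
    ∫ ξ in Set.Ioc (0 : ℝ) 1, (η (δ⁻¹ * ((ξ - θ) - round (ξ - θ))) : ℂ) * e2pi (-(ξ * m))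
      = e2pi (-(θ * m)) * localKernel η δ m := by
  set G : ℝ → ℂ := fun ξ => (η (δ⁻¹ * ((ξ - θ) - round (ξ - θ))) : ℂ) * e2pi (-(ξ * m)) with hG
  have hper : Function.Periodic G 1 := by
    intro ξ
    simp only [hG]
    have e1 : round (ξ + 1 - θ) = round (ξ - θ) + 1 := by
      rw [show ξ + 1 - θ = (ξ - θ) + ((1 : ℤ) : ℝ) by push_cast; ring, round_add_intCast]
    have e2 : ξ + 1 - θ - ((round (ξ - θ) + 1 : ℤ) : ℝ) = ξ - θ - round (ξ - θ) := by
      push_cast; ring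
    have e3 : e2pi (-((ξ + 1) * m)) = e2pi (-(ξ * m)) := by
      rw [show -((ξ + 1) * (m : ℝ)) = -(ξ * m) + ((-m : ℤ) : ℝ) by push_cast; ring, e2pi_add,
        e2pi_intCast, mul_one]
    rw [e1, e2, e3]
  have h1 : ∫ ξ in Set.Ioc (0 : ℝ) 1, G ξ = ∫ t in (-(1 / 2) : ℝ)..(1 / 2), G (t + θ) := by
    rw [intervalIntegral.integral_comp_add_right,
      show (1 / 2 : ℝ) + θ = (-(1 / 2) + θ) + 1 by ring,
      hper.intervalIntegral_add_eq (-(1 / 2) + θ) 0, zero_add,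
      intervalIntegral.integral_of_le zero_le_one]
  have h2 : ∫ t in (-(1 / 2) : ℝ)..(1 / 2), G (t + θ)
      = ∫ t in (-(1 / 2) : ℝ)..(1 / 2), e2pi (-(θ * m)) * ((η (δ⁻¹ * t) : ℂ) * e2pi (-(t * m))) := by
    refine intervalIntegral.integral_congr fun t ht => ?_
    rw [Set.uIcc_of_le (by norm_num)] at ht
    have e0 : G (t + θ) = (η (δ⁻¹ * (t - round t)) : ℂ) * e2pi (-((t + θ) * m)) := by
      simp only [hG, add_sub_cancel_right]
    have e1 : η (δ⁻¹ * (t - round t)) = η (δ⁻¹ * t) := by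
      by_cases h : t = 1 / 2
      · have hr : round t = 1 := by
          rw [h, round_eq]; norm_num
        have hδ' : 1 ≤ δ⁻¹ := (one_le_inv₀ hδ).mpr hδ1
        rw [hr, h, hη0, hη0]
        · intro hx; have := hx.2; nlinarith
        · intro hx; have := hx.1; push_cast at this; nlinarith
      · have hr : round t = 0 := round_eq_zero_iff.mpr ⟨ht.1, lt_of_le_of_ne ht.2 h⟩
        rw [hr]; simp
    simp only [e0, e1]
    rw [show -((t + θ) * (m : ℝ)) = -(θ * m) + -(t * m) by ring, e2pi_add]; ring
  have h3 : ∫ t in (-(1 / 2) : ℝ)..(1 / 2), ((η (δ⁻¹ * t) : ℂ) * e2pi (-(t * m)))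
      = ∫ t, ((η (δ⁻¹ * t) : ℂ) * e2pi (-(t * m))) := by
    rw [intervalIntegral.integral_of_le (by norm_num)]
    refine setIntegral_eq_integral_of_forall_compl_eq_zero fun t ht => ?_
    rw [hη0, Complex.ofReal_zero, zero_mul]
    intro hx
    apply ht
    have hδ' : 1 ≤ δ⁻¹ := (one_le_inv₀ hδ).mpr hδ1
    have h1 := hx.1
    have h2 := hx.2
    constructor
    · by_contra hcon
      push Not at hcon
      nlinarith
    · by_contra hcon
      push Not at hcon
      nlinarith
  have h4 : ∫ t, ((η (δ⁻¹ * t) : ℂ) * e2pi (-(t * m))) = localKernel η δ m := by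
    have := Measure.integral_comp_mul_left (fun s => (η s : ℂ) * e2pi (-(δ * s * m))) δ⁻¹
    rw [inv_inv, abs_of_pos hδ] at this
    have e : ∀ t : ℝ, δ * (δ⁻¹ * t) = t := fun t => by field_simp
    simp_rw [e] at this
    rw [this, localKernel, Complex.real_smul, Real.fourier_real_eq_integral_exp_smul]
    congr 1
    refine integral_congr_ae (ae_of_all _ fun s => ?_)
    simp only [e2pi, smul_eq_mul]
    rw [mul_comm]
    congr 2
    push_cast; ring
  rw [h1, h2, intervalIntegral.integral_const_mul, h3, h4]

include hη hη01 hη0 in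
theorem iwKernel_eq_sum {δ : ℝ} (hδ : 0 < δ) (hδ1 : δ ≤ 1) (N₁ : ℝ) (m : ℤ) :
    iwKernel η N₁ δ m
      = ∑ aq ∈ canonicalFractions N₁, e2pi (-((aq.1 : ℝ) / aq.2 * m)) * localKernel η δ m := by
  unfold iwKernel iwSymbol
  simp_rw [Complex.ofReal_sum, Finset.sum_mul]
  rw [integral_finsetSum]
  · exact Finset.sum_congr rfl fun aq _ => integral_bump_eq hη0 hδ hδ1 _ m
  · intro aq _
    refine integrable_period_mul_e2pi (M := 1) ?_ (fun t => ?_) (fun ξ => -(ξ * m)) (by fun_prop)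
    · exact Complex.measurable_ofReal.comp (hη.measurable.comp (Measurable.const_mul
        (measurable_sub_round.comp (measurable_id.sub_const _)) _))
    · rw [Complex.norm_real, Real.norm_eq_abs, abs_of_nonneg (hη01 _).1]
      exact (hη01 _).2

end IonescuWaingerKernel

section FractionCharacters

variable {D : ℕ} [NeZero D]

omit [NeZero D] in
theorem addChar_zmod_intCast (ψ : AddChar (ZMod D) ℂ) (z : ℤ) : ψ (z : ZMod D) = ψ 1 ^ z := by
  rw [← AddChar.map_zsmul_eq_zpow, zsmul_one]

omit [NeZero D] in
theorem addChar_zmod_ext {ψ φ : AddChar (ZMod D) ℂ} (h : ψ 1 = φ 1) : ψ = φ := by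
  ext y
  obtain ⟨z, rfl⟩ := ZMod.intCast_surjective y
  rw [addChar_zmod_intCast, addChar_zmod_intCast, h]

omit [NeZero D] in
theorem orderOf_addChar_zmod (ψ : AddChar (ZMod D) ℂ) : orderOf ψ = orderOf (ψ 1) := by
  rw [orderOf_eq_orderOf_iff]
  intro n
  rw [← AddChar.pow_apply]
  constructor
  · intro h; rw [h, AddChar.one_apply]
  · intro h; exact addChar_zmod_ext (by rw [h, AddChar.one_apply])

/-- The character `x ↦ e(-ax/q)` for `(a, q)` with `q ∣ D`. -/
noncomputable def fractionChar (D : ℕ) [NeZero D] (aq : ℕ × ℕ) : AddChar (ZMod D) ℂ :=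
  AddChar.mulShift ZMod.stdAddChar (-(aq.1 * (D / aq.2 : ℕ) : ℤ) : ZMod D)

theorem fractionChar_one {aq : ℕ × ℕ} (h0 : 0 < aq.2) (h : aq.2 ∣ D) :
    fractionChar D aq 1 = e2pi (-((aq.1 : ℝ) / aq.2)) := by
  have hD : (D : ℂ) ≠ 0 := NeZero.ne _
  have hq : (aq.2 : ℂ) ≠ 0 := by exact_mod_cast h0.ne'
  obtain ⟨k, hk⟩ := h
  have hk' : D / aq.2 = k := by rw [hk, Nat.mul_div_cancel_left _ h0]
  have hkD : (D : ℂ) = aq.2 * k := by exact_mod_cast hk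
  have hk0 : (k : ℂ) ≠ 0 := by
    intro h; rw [h, mul_zero] at hkD; exact hD hkD
  rw [fractionChar, AddChar.mulShift_apply, mul_one, hk']
  rw [show (-(((aq.1 : ℤ) * (k : ℕ) : ℤ) : ZMod D)) = ((-(aq.1 * k : ℤ) : ℤ) : ZMod D) by push_cast; rfl,
    ZMod.stdAddChar_coe, e2pi]
  congr 1
  push_cast
  rw [hkD]
  field_simp

theorem fractionChar_intCast {aq : ℕ × ℕ} (h0 : 0 < aq.2) (h : aq.2 ∣ D) (z : ℤ) :
    fractionChar D aq (z : ZMod D) = e2pi (-((aq.1 : ℝ) / aq.2 * z)) := by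
  rw [addChar_zmod_intCast, fractionChar_one h0 h, e2pi, e2pi, ← Complex.exp_int_mul]
  congr 1
  push_cast; ring

theorem inv_e2pi (x : ℝ) : (e2pi x)⁻¹ = e2pi (-x) := by
  rw [e2pi, e2pi, ← Complex.exp_neg]; push_cast; ring_nf

theorem isPrimitiveRoot_e2pi_neg {a q : ℕ} (h0 : 0 < q) (h : Nat.gcd a q = 1) :
    IsPrimitiveRoot (e2pi (-((a : ℝ) / q))) q := by
  rw [← inv_e2pi]
  have := Complex.isPrimitiveRoot_exp_of_coprime a q h0.ne' h
  have e : e2pi ((a : ℝ) / q) = Complex.exp (2 * Real.pi * Complex.I * (a / q)) := by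
    rw [e2pi]; push_cast; rfl
  rw [e]
  exact this.inv

theorem mem_canonicalFractions {Q : ℕ} {aq : ℕ × ℕ} :
    aq ∈ canonicalFractions Q ↔ 1 ≤ aq.2 ∧ aq.2 ≤ Q ∧ aq.1 < aq.2 ∧ Nat.gcd aq.1 aq.2 = 1 := by
  simp only [canonicalFractions, Nat.floor_natCast, Finset.mem_filter, Finset.mem_product,
    Finset.mem_range, Finset.mem_Icc]
  constructor
  · rintro ⟨⟨_, h1, h2⟩, h3, h4⟩
    exact ⟨h1, h2, h3, h4⟩
  · rintro ⟨h1, h2, h3, h4⟩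
    exact ⟨⟨by omega, h1, h2⟩, h3, h4⟩

theorem sum_canonicalFractions_eq {Q : ℕ} (hQ : ∀ q ∈ Finset.Icc 1 Q, q ∣ D)
    (F : AddChar (ZMod D) ℂ → ℂ) :
    ∑ aq ∈ canonicalFractions Q, F (fractionChar D aq)
      = ∑ ψ : AddChar (ZMod D) ℂ with orderOf ψ ≤ Q, F ψ := by
  have hdvd : ∀ aq ∈ canonicalFractions Q, aq.2 ∣ D := fun aq h => by
    rw [mem_canonicalFractions] at h
    exact hQ _ (Finset.mem_Icc.mpr ⟨h.1, h.2.1⟩)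
  have hord : ∀ aq ∈ canonicalFractions Q, orderOf (fractionChar D aq) = aq.2 := fun aq h => by
    have hd := hdvd aq h
    rw [mem_canonicalFractions] at h
    rw [orderOf_addChar_zmod, fractionChar_one h.1 hd]
    exact (isPrimitiveRoot_e2pi_neg h.1 h.2.2.2).eq_orderOf.symm
  refine Finset.sum_bij (fun aq _ => fractionChar D aq) (fun aq h => ?_) (fun aq h aq' h' heq => ?_)
    (fun ψ hψ => ?_) (fun _ _ => rfl)
  · rw [Finset.mem_filter, hord aq h]
    rw [mem_canonicalFractions] at h
    exact ⟨Finset.mem_univ _, h.2.1⟩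
  · have h2 : aq.2 = aq'.2 := by rw [← hord aq h, ← hord aq' h', heq]
    have hd := hdvd aq h
    have hd' := hdvd aq' h'
    rw [mem_canonicalFractions] at h h'
    have h1 : e2pi (-((aq.1 : ℝ) / aq.2)) = e2pi (-((aq'.1 : ℝ) / aq'.2)) := by
      rw [← fractionChar_one h.1 hd, ← fractionChar_one h'.1 hd', heq]
    rw [e2pi, e2pi, Complex.exp_eq_exp_iff_exists_int] at h1
    obtain ⟨n, hn⟩ := h1
    have hq : (aq'.2 : ℝ) ≠ 0 := by have := h'.1; positivity
    have hn' : -((aq.1 : ℝ) / aq.2) = -((aq'.1 : ℝ) / aq'.2) + n := by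
      have h2 : (2 * Real.pi * Complex.I) ≠ 0 := Complex.two_pi_I_ne_zero
      have : (2 * Real.pi * Complex.I) * ((-((aq.1 : ℝ) / aq.2) : ℝ) : ℂ)
          = (2 * Real.pi * Complex.I) * ((-((aq'.1 : ℝ) / aq'.2) + n : ℝ) : ℂ) := by
        rw [hn]; push_cast; ring
      exact_mod_cast mul_left_cancel₀ h2 this
    rw [h2] at hn'
    have hz : (aq'.1 : ℤ) - aq.1 = n * aq'.2 := by
      have : (aq'.1 : ℝ) - aq.1 = n * aq'.2 := by field_simp at hn'; linarith
      exact_mod_cast this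
    have hn0 : n = 0 := by
      have hlt1 : (aq.1 : ℤ) < aq'.2 := by have := h.2.2.1; omega
      have hlt2 : (aq'.1 : ℤ) < aq'.2 := by have := h'.2.2.1; omega
      have hp : (0 : ℤ) < aq'.2 := by omega
      have a1 : n * aq'.2 < 1 * aq'.2 := by omega
      have a2 : (-1) * (aq'.2 : ℤ) < n * aq'.2 := by omega
      have b1 := lt_of_mul_lt_mul_right a1 hp.le
      have b2 := lt_of_mul_lt_mul_right a2 hp.le
      omega
    rw [hn0, zero_mul] at hz
    exact Prod.ext (by omega) h2
  · have hq := orderOf_pos ψ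
    have hle := (Finset.mem_filter.mp hψ).2
    have hprim : IsPrimitiveRoot (ψ 1)⁻¹ (orderOf ψ) := by
      rw [orderOf_addChar_zmod]
      exact (IsPrimitiveRoot.orderOf (ψ 1)).inv
    obtain ⟨i, hi, hco, hζ⟩ := (Complex.isPrimitiveRoot_iff _ _ hq.ne').mp hprim
    have hmem : (i, orderOf ψ) ∈ canonicalFractions Q := mem_canonicalFractions.mpr ⟨hq, hle, hi, hco⟩
    refine ⟨(i, orderOf ψ), hmem, addChar_zmod_ext ?_⟩
    rw [fractionChar_one hq (hdvd _ hmem), ← inv_e2pi, ← inv_inv (ψ 1), ← hζ, e2pi]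
    push_cast
    rfl

end FractionCharacters

section Projection

variable {η : ℝ → ℝ}

theorem iwProj_eq_sum (N₁ N₂ : ℝ) {f : ℤ → ℂ} {U : Finset ℤ} (hf : ∀ u ∉ U, f u = 0) (x : ℤ) :
    iwProj η N₁ N₂ f x = ∑ u ∈ U, iwKernel η N₁ N₂ (x - u) * f u := by
  unfold iwProj
  have h := tsum_int_const_sub (E := ℂ) (fun y => iwKernel η N₁ N₂ y * f (x - y)) x
  rw [← h]
  simp only [sub_sub_cancel]
  exact tsum_eq_sum fun u hu => by rw [hf u hu, mul_zero]

variable (hη : Continuous η) (hη01 : ∀ x : ℝ, η x ∈ Set.Icc (0 : ℝ) 1)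
    (hη0 : ∀ x : ℝ, x ∉ Set.Ioo (-(1 / 2) : ℝ) (1 / 2) → η x = 0)

include hη hη01 hη0 in
theorem iwProj_eq_localExpansion {D : ℕ} [NeZero D] {Q : ℕ} (hQ : ∀ q ∈ Finset.Icc 1 Q, q ∣ D)
    {δ : ℝ} (hδ : 0 < δ) (hδ1 : δ ≤ 1)
    {f : ℤ → ℂ} {U : Finset ℤ} (hf : ∀ u ∉ U, f u = 0) (x : ℤ) :
    iwProj η Q δ f x = ∑ ψ : AddChar (ZMod D) ℂ with orderOf ψ ≤ Q,
      localCoeff (localKernel η δ) U f x ψ * ψ (x : ZMod D) := by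
  rw [iwProj_eq_sum _ _ hf, ← sum_canonicalFractions_eq hQ
    (fun ψ => localCoeff (localKernel η δ) U f x ψ * ψ (x : ZMod D))]
  simp_rw [iwKernel_eq_sum hη hη01 hη0 hδ hδ1, localCoeff, Finset.sum_mul]
  rw [Finset.sum_comm]
  refine Finset.sum_congr rfl fun aq haq => Finset.sum_congr rfl fun u _ => ?_
  rw [mem_canonicalFractions] at haq
  have hd := hQ _ (Finset.mem_Icc.mpr ⟨haq.1, haq.2.1⟩)
  have e : e2pi (-((aq.1 : ℝ) / aq.2 * (x - u : ℤ)))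
      = fractionChar D aq (-(u : ZMod D)) * fractionChar D aq (x : ZMod D) := by
    rw [← AddChar.map_add_eq_mul, ← fractionChar_intCast haq.1 hd]
    congr 1
    push_cast; ring
  rw [e]; ring

end Projection

theorem exists_card_divisors_le {ε : ℝ} (hε : 0 < ε) :
    ∃ C : ℝ, 1 ≤ C ∧ ∀ n : ℕ, n ≠ 0 → (n.divisors.card : ℝ) ≤ C * (n : ℝ) ^ ε := by
  set c : ℝ := 1 + (ε * Real.log 2)⁻¹ with hc
  have hl : 0 < Real.log 2 := Real.log_pos (by norm_num)
  have hc1 : 1 ≤ c := by rw [hc]; have : 0 < (ε * Real.log 2)⁻¹ := by positivity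
                         linarith
  set M : ℕ := ⌈(2 : ℝ) ^ ε⁻¹⌉₊ with hM
  have key : ∀ q : ℕ, q.Prime → ∀ e : ℕ,
      ((e + 1 : ℕ) : ℝ) ≤ (if q < M then c else 1) * ((q : ℝ) ^ e) ^ ε := by
    intro q hq e
    have hq2 : (2 : ℝ) ≤ q := by exact_mod_cast hq.two_le
    rw [← Real.rpow_natCast, ← Real.rpow_mul (by linarith), mul_comm (e : ℝ), Real.rpow_mul (by linarith),
      Real.rpow_natCast]
    split_ifs with h
    · have h1 : (2 : ℝ) ^ ε ≤ (q : ℝ) ^ ε := Real.rpow_le_rpow (by norm_num) hq2 hε.le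
      have h2 : 1 + ε * Real.log 2 ≤ (2 : ℝ) ^ ε := by
        rw [Real.rpow_def_of_pos (by norm_num)]
        have := Real.add_one_le_exp (Real.log 2 * ε)
        linarith
      have h3 : 1 + e * (ε * Real.log 2) ≤ (1 + ε * Real.log 2) ^ e :=
        one_add_mul_le_pow (by have : 0 < ε * Real.log 2 := by positivity
                               linarith) e
      have h4 : (1 + ε * Real.log 2) ^ e ≤ ((q : ℝ) ^ ε) ^ e :=
        pow_le_pow_left₀ (by positivity) (h2.trans h1) e
      have h5 : ((e + 1 : ℕ) : ℝ) ≤ c * (1 + e * (ε * Real.log 2)) := by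
        have : 0 < ε * Real.log 2 := by positivity
        push_cast
        rw [hc, add_mul, mul_add (ε * Real.log 2)⁻¹]
        have e1 : (ε * Real.log 2)⁻¹ * (e * (ε * Real.log 2)) = e := by field_simp
        rw [e1]
        have : 0 ≤ (e : ℝ) * (ε * Real.log 2) := by positivity
        have : 0 ≤ (ε * Real.log 2)⁻¹ := by positivity
        linarith
      exact h5.trans (mul_le_mul_of_nonneg_left (h3.trans h4) (by linarith))
    · have h1 : (2 : ℝ) ≤ (q : ℝ) ^ ε := by
        have : (2 : ℝ) ^ ε⁻¹ ≤ q := (Nat.le_ceil _).trans (by exact_mod_cast not_lt.mp h)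
        calc (2 : ℝ) = ((2 : ℝ) ^ ε⁻¹) ^ ε := by
              rw [← Real.rpow_mul (by norm_num), inv_mul_cancel₀ hε.ne', Real.rpow_one]
          _ ≤ _ := Real.rpow_le_rpow (by positivity) this hε.le
      rw [one_mul]
      calc ((e + 1 : ℕ) : ℝ) ≤ (2 : ℝ) ^ e := by exact_mod_cast Nat.lt_two_pow_self
        _ ≤ _ := pow_le_pow_left₀ (by norm_num) h1 e
  refine ⟨c ^ M, one_le_pow₀ hc1, fun n hn => ?_⟩
  rw [Nat.card_divisors hn, Nat.cast_prod]
  calc ∏ q ∈ n.primeFactors, ((n.factorization q + 1 : ℕ) : ℝ)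
      ≤ ∏ q ∈ n.primeFactors, ((if q < M then c else 1) * ((q : ℝ) ^ n.factorization q) ^ ε) :=
        Finset.prod_le_prod (fun _ _ => by positivity)
          fun q hq => key q (Nat.prime_of_mem_primeFactors hq) _
    _ = (∏ q ∈ n.primeFactors, if q < M then c else 1) * (n : ℝ) ^ ε := by
        rw [Finset.prod_mul_distrib, Real.finsetProd_rpow _ _ fun _ _ => by positivity]
        congr 2
        conv_rhs => rw [← Nat.prod_factorization_pow_eq_self hn]
        rw [Finsupp.prod, Nat.support_factorization]
        push_cast
        rfl
    _ ≤ c ^ M * (n : ℝ) ^ ε := by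
        refine mul_le_mul_of_nonneg_right ?_ (by positivity)
        rw [← Finset.prod_filter, Finset.prod_const]
        refine pow_le_pow_right₀ hc1 ?_
        calc _ ≤ (Finset.range M).card := Finset.card_le_card fun q hq => by
              rw [Finset.mem_range]; exact (Finset.mem_filter.mp hq).2
          _ = M := Finset.card_range M

section Projection

variable {η : ℝ → ℝ} (hηsmooth : ContDiff ℝ (⊤ : ℕ∞) η) (hη01 : ∀ x : ℝ, η x ∈ Set.Icc (0 : ℝ) 1)
  (hη0 : ∀ x : ℝ, x ∉ Set.Ioo (-(1 / 2) : ℝ) (1 / 2) → η x = 0)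

include hηsmooth hη01 hη0

theorem exists_sum_norm_iwProj_pow_le {m : ℕ} (hm : 1 ≤ m) {ε : ℝ} (hε : 0 < ε) :
    ∃ C : ℝ, 0 < C ∧ ∀ Q : ℕ, 1 ≤ Q → ∀ δ : ℝ, 0 < δ → 2 * (Q : ℝ) ^ (6 * (m + 1) + 2) * δ ≤ 1 →
      ∀ (U : Finset ℤ) (f : ℤ → ℂ), (∀ u ∉ U, f u = 0) → ∀ X : Finset ℤ,
        ∑ x ∈ X, ‖iwProj η Q δ f x‖ ^ (2 * (m + 1))
          ≤ C * (Q : ℝ) ^ ε * ∑ u ∈ U, ‖f u‖ ^ (2 * (m + 1)) := by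
  obtain ⟨A, hA, hker⟩ := exists_localKernel_bounds hηsmooth hη0
  set E : ℕ := 2 ^ (2 * (m + 1)) * (m + 1) + (m + 1) + 3 * m + 1 with hE
  obtain ⟨C, hC1, hC⟩ := exists_card_divisors_le (ε := ε / (m * E))
    (by rw [hE]; have : (0 : ℝ) < m := by exact_mod_cast hm
        positivity)
  set κ : ℝ := 2 ^ (m + 1) * (16 / 3 * (64 * A ^ 2) ^ m * (2 * A ^ 2)) with hκ
  have hκ0 : 0 < κ := by positivity
  refine ⟨2 ^ (2 * (m + 1)) * (κ * C ^ E + 3 * A ^ (2 * (m + 1))), by positivity,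
    fun Q hQ1 δ hδ hδQ U f hf X => ?_⟩
  have hQR : (1 : ℝ) ≤ Q := by exact_mod_cast hQ1
  have hp1 : (1 : ℝ) ≤ (Q : ℝ) ^ (6 * (m + 1) + 2) := one_le_pow₀ hQR
  have hδ1 : δ ≤ 1 := by nlinarith
  obtain ⟨W, hW, hW0, hKW, hWA, hWV, hKs, hKV⟩ := hker δ hδ hδ1
  set S := ∑ u ∈ U, ‖f u‖ ^ (2 * (m + 1)) with hS
  have hS0 : 0 ≤ S := by positivity
  set T : ℕ := ⌊C * ((Q : ℝ) ^ m) ^ (ε / (m * E))⌋₊ with hT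
  have hx1 : (1 : ℝ) ≤ C * ((Q : ℝ) ^ m) ^ (ε / (m * E)) := by
    have : (1 : ℝ) ≤ ((Q : ℝ) ^ m) ^ (ε / (m * E)) :=
      Real.one_le_rpow (one_le_pow₀ hQR) (by positivity)
    nlinarith
  have hT0 : 0 < T := Nat.floor_pos.mpr hx1
  have hTC : (T : ℝ) ^ E ≤ C ^ E * (Q : ℝ) ^ ε := by
    calc (T : ℝ) ^ E ≤ (C * ((Q : ℝ) ^ m) ^ (ε / (m * E))) ^ E :=
          pow_le_pow_left₀ (by positivity) (Nat.floor_le (by linarith)) E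
      _ = C ^ E * (Q : ℝ) ^ ε := by
          have hm0 : (m : ℝ) ≠ 0 := by exact_mod_cast (by omega : m ≠ 0)
          have hE0 : (E : ℝ) ≠ 0 := by rw [hE]; positivity
          rw [mul_pow, ← Real.rpow_natCast (Q : ℝ) m, ← Real.rpow_mul (by linarith),
            ← Real.rpow_mul_natCast (by linarith)]
          congr 2
          field_simp
  have hTd : ∀ k ∈ Finset.Icc 1 (Q ^ m), k.divisors.card ≤ T := fun k hk => by
    rw [Finset.mem_Icc] at hk
    refine Nat.le_floor ((hC k (by omega)).trans ?_)
    refine mul_le_mul_of_nonneg_left (Real.rpow_le_rpow (by positivity) ?_ (by positivity)) (by linarith)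
    exact_mod_cast hk.2
  have : NeZero Q.factorial := ⟨Q.factorial_ne_zero⟩
  have hD : ∀ q ∈ Finset.Icc 1 Q, q ∣ Q.factorial := fun q hq => by
    rw [Finset.mem_Icc] at hq
    exact Nat.dvd_factorial hq.1 hq.2
  have h26 : (Q : ℝ) ^ 2 + (Q : ℝ) ^ 6 ≤ 2 * (Q : ℝ) ^ (6 * (m + 1) + 2) := by
    have a1 : (Q : ℝ) ^ 2 ≤ (Q : ℝ) ^ (6 * (m + 1) + 2) := pow_le_pow_right₀ hQR (by omega)
    have a2 : (Q : ℝ) ^ 6 ≤ (Q : ℝ) ^ (6 * (m + 1) + 2) := pow_le_pow_right₀ hQR (by omega)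
    linarith
  have hTE : (T : ℝ) ^ E = ((T : ℝ) ^ 2 ^ (2 * (m + 1))) ^ (m + 1) * (T : ℝ) ^ (m + 1)
      * ((T : ℝ) ^ 3) ^ m * T := by
    rw [← pow_mul, ← pow_mul, ← pow_add, ← pow_add, ← pow_succ, hE]
  have h16 : (16 * (4 * A ^ 2 * (T : ℝ) ^ 3)) ^ m = (64 * A ^ 2) ^ m * ((T : ℝ) ^ 3) ^ m := by
    rw [← mul_pow]
    ring
  have hloc := fun Y => sum_norm_localCoeff_pow_le hm hW hW0 hKW hA hWA
    (calc ((Q : ℝ) ^ 2 + (Q : ℝ) ^ 6) * totalVariation W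
          ≤ (2 * (Q : ℝ) ^ (6 * (m + 1) + 2)) * (A * δ) :=
          mul_le_mul h26 hWV (tsum_nonneg fun _ => abs_nonneg _) (by positivity)
      _ = A * (2 * (Q : ℝ) ^ (6 * (m + 1) + 2) * δ) := by ring
      _ ≤ A := mul_le_of_le_one_right hA.le hδQ) hD hT0 hTd hQ1 Y U f
  have hfin := sum_norm_localExpansion_pow_le (D := Q.factorial) hW hW0 hKW hWA hQ1 hKs hKV
    (show (Q : ℝ) ^ (6 * (m + 1) + 2) * (A * δ) ≤ A by
      have h1 : 0 ≤ A * δ * (Q : ℝ) ^ (6 * (m + 1) + 2) := by positivity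
      have h2 := mul_le_of_le_one_right hA.le hδQ
      linarith) U f
    (B := κ * (T : ℝ) ^ E * S) (fun Y => (hloc Y).trans (le_of_eq (by
      rw [hκ, hTE, ← hS, h16]
      ring))) X
  simp_rw [iwProj_eq_localExpansion hηsmooth.continuous hη01 hη0 hD hδ hδ1 hf]
  refine hfin.trans ?_
  rw [mul_assoc (2 ^ (2 * (m + 1)) : ℝ), mul_assoc (2 ^ (2 * (m + 1)) : ℝ)]
  refine mul_le_mul_of_nonneg_left ?_ (by positivity)
  have hQε : (1 : ℝ) ≤ (Q : ℝ) ^ ε := Real.one_le_rpow hQR hε.le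
  rw [add_mul, add_mul]
  refine add_le_add ?_ ?_
  · calc κ * (T : ℝ) ^ E * S ≤ κ * (C ^ E * (Q : ℝ) ^ ε) * S := by gcongr
      _ = _ := by ring
  · rw [mul_assoc (3 * A ^ (2 * (m + 1)))]
    refine mul_le_mul_of_nonneg_left ?_ (by positivity)
    nlinarith

end Projection

/-- `φ` is a polynomial phase of degree at most `k + 1` with leading datum `A`: iterated differences
with steps `h₁, …, hₖ, 1` are constantly `h₁ ⋯ hₖ A`. -/
def IsPolyPhase : ℕ → ℝ → (ℕ → ℝ) → Prop
  | 0, A, φ => ∀ n, φ (n + 1) - φ n = A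
  | k + 1, A, φ => ∀ h : ℕ, IsPolyPhase k (h * A) fun n => φ (n + h) - φ n

namespace IsPolyPhase

theorem add {k : ℕ} : ∀ {A B : ℝ} {φ ψ : ℕ → ℝ}, IsPolyPhase k A φ → IsPolyPhase k B ψ →
    IsPolyPhase k (A + B) fun n => φ n + ψ n := by
  induction k with
  | zero => exact fun {A B φ ψ} h₁ h₂ n => by linarith [h₁ n, h₂ n]
  | succ k ih =>
    exact fun {A B φ ψ} h₁ h₂ h => by
      have := ih (h₁ h) (h₂ h)
      rw [← mul_add] at this
      convert this using 2
      ring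

theorem const_mul {k : ℕ} (c : ℝ) : ∀ {A : ℝ} {φ : ℕ → ℝ}, IsPolyPhase k A φ →
    IsPolyPhase k (c * A) fun n => c * φ n := by
  induction k with
  | zero => exact fun {A φ} h₁ n => by rw [← mul_sub, h₁ n]
  | succ k ih =>
    exact fun {A φ} h₁ h => by
      have := ih (h₁ h)
      rw [mul_left_comm] at this
      convert this using 2
      ring

theorem zero (k : ℕ) : IsPolyPhase k 0 fun _ => 0 := by
  induction k with
  | zero => exact fun n => by simp
  | succ k ih => exact fun h => by simpa using ih

theorem sum {k : ℕ} {ι : Type*} (s : Finset ι) (A : ι → ℝ) (φ : ι → ℕ → ℝ)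
    (h : ∀ i ∈ s, IsPolyPhase k (A i) (φ i)) :
    IsPolyPhase k (∑ i ∈ s, A i) fun n => ∑ i ∈ s, φ i n := by
  classical
  induction s using Finset.induction_on with
  | empty => simpa using zero k
  | insert i s hi ih =>
    simp_rw [Finset.sum_insert hi]
    exact (h i (Finset.mem_insert_self i s)).add
      (ih fun j hj => h j (Finset.mem_insert_of_mem hj))

theorem monomial (k : ℕ) : ∀ j : ℕ, j ≤ k + 1 →
    IsPolyPhase k (if j = k + 1 then ((k + 1).factorial : ℝ) else 0) fun n => ((n : ℝ) + 1) ^ j := by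
  induction k with
  | zero =>
    intro j hj n
    interval_cases j <;> simp
  | succ k ih =>
    intro j hj h
    have key : ∀ n : ℕ, (((n + h : ℕ) : ℝ) + 1) ^ j - ((n : ℝ) + 1) ^ j
        = ∑ i ∈ Finset.range j, ((h : ℝ) ^ (j - i) * j.choose i) * ((n : ℝ) + 1) ^ i := fun n => by
      have : ((n + h : ℕ) : ℝ) + 1 = ((n : ℝ) + 1) + h := by push_cast; ring
      rw [this, add_pow, Finset.sum_range_succ]
      simp only [Nat.sub_self, pow_zero, mul_one, Nat.choose_self, Nat.cast_one, add_sub_cancel_right]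
      exact Finset.sum_congr rfl fun i _ => by ring
    simp_rw [key]
    have hs := sum (Finset.range j) _ _ fun i hi =>
      (ih i (by rw [Finset.mem_range] at hi; omega)).const_mul ((h : ℝ) ^ (j - i) * j.choose i)
    convert hs using 1
    split_ifs with hj'
    · subst hj'
      rw [Finset.sum_range_succ, Finset.sum_eq_zero fun i hi => ?_]
      · simp only [if_true, zero_add, Nat.choose_succ_self_right, Nat.factorial_succ (k + 1)]
        rw [show k + 1 + 1 - (k + 1) = 1 by omega]
        push_cast
        ring
      · rw [Finset.mem_range] at hi
        rw [if_neg (by omega), mul_zero]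
    · rw [mul_zero, Finset.sum_eq_zero fun i hi => ?_]
      rw [Finset.mem_range] at hi
      rw [if_neg (by omega), mul_zero]

theorem polynomial (P : Polynomial ℤ) (k : ℕ) (hP : P.natDegree ≤ k + 1) (ξ : ℝ) :
    IsPolyPhase k (((k + 1).factorial * P.coeff (k + 1) : ℤ) * ξ)
      fun n => ξ * (P.eval ((n : ℤ) + 1) : ℤ) := by
  have hs := (sum (Finset.range (k + 1 + 1)) _ _ fun i hi =>
    (monomial k i (by rw [Finset.mem_range] at hi; omega)).const_mul (P.coeff i : ℝ)).const_mul ξ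
  convert hs using 1
  · rw [Finset.sum_range_succ, Finset.sum_eq_zero fun i hi => ?_]
    · simp only [if_true, zero_add]
      push_cast
      ring
    · rw [Finset.mem_range] at hi
      rw [if_neg (by omega), mul_zero]
  · ext n
    rw [Polynomial.eval_eq_sum_range' (Nat.lt_succ_of_le hP)]
    push_cast
    rfl

end IsPolyPhase

theorem norm_sum_sq_le_vanDerCorput (z : ℕ → ℂ) (L : ℕ) :
    ‖∑ j ∈ Finset.range L, z j‖ ^ 2
      ≤ 2 * ∑ h ∈ Finset.range L, ‖∑ j ∈ Finset.range (L - h), z (h + j) * (starRingEnd ℂ) (z j)‖ := by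
  have h1 : ∀ L : ℕ, ‖∑ j ∈ Finset.range L, z j‖ ^ 2
      ≤ 2 * (∑ m ∈ Finset.range L, ∑ h ∈ Finset.range (m + 1),
        z (h + (m - h)) * (starRingEnd ℂ) (z (m - h))).re := by
    intro L
    induction L with
    | zero => simp
    | succ L ih =>
      rw [Finset.sum_range_succ, Finset.sum_range_succ, Complex.add_re]
      have e : ∑ h ∈ Finset.range (L + 1), z (h + (L - h)) * (starRingEnd ℂ) (z (L - h))
          = z L * (starRingEnd ℂ) (∑ j ∈ Finset.range L, z j) + z L * (starRingEnd ℂ) (z L) := by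
        rw [← Finset.sum_range_reflect, map_sum, Finset.mul_sum, Finset.sum_range_succ]
        congr 1
        · refine Finset.sum_congr rfl fun j hj => ?_
          rw [Finset.mem_range] at hj
          congr 2
          · omega
          · congr 1; omega
        · congr 2
          · omega
          · congr 1; omega
      rw [e, Complex.add_re, Complex.mul_conj, ← Complex.normSq_eq_norm_sq]
      rw [← Complex.normSq_eq_norm_sq] at ih
      rw [Complex.normSq_add, Complex.ofReal_re]
      have : (z L * (starRingEnd ℂ) (∑ j ∈ Finset.range L, z j)).re
          = ((∑ j ∈ Finset.range L, z j) * (starRingEnd ℂ) (z L)).re := by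
        simp only [Complex.mul_re, Complex.conj_re, Complex.conj_im]
        ring
      have := Complex.normSq_nonneg (z L)
      linarith
  refine (h1 L).trans ?_
  rw [Finset.sum_range_diag_flip L fun h j => z (h + j) * (starRingEnd ℂ) (z j)]
  refine mul_le_mul_of_nonneg_left ?_ (by norm_num)
  exact (Complex.re_le_norm _).trans (norm_sum_le _ _)

/-- A majorant for the geometric exponential sum of length `N` and frequency `A`. -/
noncomputable def geomMajorant (N : ℕ) (A : ℝ) : ℝ := 2 * N / (1 + N * |A - round A|)

theorem geomMajorant_nonneg (N : ℕ) (A : ℝ) : 0 ≤ geomMajorant N A := by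
  unfold geomMajorant; positivity

theorem geomMajorant_le (N : ℕ) (A : ℝ) : geomMajorant N A ≤ 2 * N := by
  unfold geomMajorant
  exact div_le_self (by positivity) (by have : 0 ≤ N * |A - round A| := by positivity
                                        linarith)

/-- The iterated sum of geometric majorants produced by Weyl differencing. -/
noncomputable def weylMajorant (N : ℕ) : ℕ → ℝ → ℝ
  | 0, A => geomMajorant N A
  | k + 1, A => 2 * ∑ h ∈ Finset.range N, weylMajorant N k (h * A)

theorem e2pi_sub_round (A : ℝ) : e2pi (A - round A) = e2pi A := by
  rw [sub_eq_add_neg, e2pi_add, ← Int.cast_neg, e2pi_intCast, mul_one]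

theorem four_mul_abs_le_norm_e2pi_sub_one (A : ℝ) : 4 * |A - round A| ≤ ‖e2pi A - 1‖ := by
  set y := A - round A with hy
  have hy2 : |y| ≤ 1 / 2 := abs_sub_round A
  rw [← e2pi_sub_round, ← hy]
  have h1 : ‖e2pi y - 1‖ = 2 * |Real.sin (π * y)| := by
    have : e2pi y = Complex.exp (Complex.I * ((2 * π * y : ℝ) : ℂ)) := by
      unfold e2pi; congr 1; push_cast; ring
    rw [this, Complex.norm_exp_I_mul_ofReal_sub_one, norm_mul, Real.norm_eq_abs, Real.norm_eq_abs, abs_two]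
    congr 3
    ring
  rw [h1]
  have h2 := Real.mul_abs_le_abs_sin (x := π * y) (by
    rw [abs_mul, abs_of_pos Real.pi_pos]; nlinarith [Real.pi_pos])
  rw [abs_mul, abs_of_pos Real.pi_pos] at h2
  have : 2 / π * (π * |y|) = 2 * |y| := by field_simp
  linarith

theorem norm_sum_e2pi_le_geomMajorant {A : ℝ} {φ : ℕ → ℝ} (h : ∀ n, φ (n + 1) - φ n = A)
    {L N : ℕ} (hL : L ≤ N) : ‖∑ j ∈ Finset.range L, e2pi (φ j)‖ ≤ geomMajorant N A := by
  set y := |A - round A| with hy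
  have hy0 : 0 ≤ y := abs_nonneg _
  have hN : ‖∑ j ∈ Finset.range L, e2pi (φ j)‖ ≤ N := by
    refine (norm_sum_le _ _).trans ?_
    simp_rw [norm_e2pi]
    rw [Finset.sum_const, Finset.card_range, nsmul_eq_mul, mul_one]
    exact_mod_cast hL
  have hφ : ∀ j, e2pi (φ (j + 1)) = e2pi A * e2pi (φ j) := fun j => by
    rw [← e2pi_add, ← h j]; congr 1; ring
  have htel : (e2pi A - 1) * ∑ j ∈ Finset.range L, e2pi (φ j) = e2pi (φ L) - e2pi (φ 0) := by
    rw [← Finset.sum_range_sub (fun j => e2pi (φ j)), Finset.mul_sum]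
    refine Finset.sum_congr rfl fun j _ => ?_
    rw [hφ]; ring
  have h2 : ‖e2pi A - 1‖ * ‖∑ j ∈ Finset.range L, e2pi (φ j)‖ ≤ 2 := by
    rw [← norm_mul, htel]
    refine (norm_sub_le _ _).trans ?_
    rw [norm_e2pi, norm_e2pi]; norm_num
  have h3 := mul_le_mul_of_nonneg_right (four_mul_abs_le_norm_e2pi_sub_one A)
    (norm_nonneg (∑ j ∈ Finset.range L, e2pi (φ j)))
  rw [← hy] at h3
  unfold geomMajorant
  rw [← hy, le_div_iff₀ (by positivity)]
  rcases Nat.eq_zero_or_pos N with rfl | hN0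
  · simp at hN ⊢; simp [hN]
  have hN1 : (1 : ℝ) ≤ N := by exact_mod_cast hN0
  nlinarith

theorem norm_sum_e2pi_pow_le_weylMajorant {N : ℕ} (k : ℕ) : ∀ {A : ℝ} {φ : ℕ → ℝ}, IsPolyPhase k A φ →
    ∀ L ≤ N, ‖∑ j ∈ Finset.range L, e2pi (φ j)‖ ^ 2 ^ k * (2 * N) ^ (k + 1)
      ≤ (2 * N : ℝ) ^ 2 ^ k * weylMajorant N k A := by
  induction k with
  | zero =>
    intro A φ h L hL
    simp only [pow_zero, pow_one, zero_add, weylMajorant]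
    rw [mul_comm]
    exact mul_le_mul_of_nonneg_left (norm_sum_e2pi_le_geomMajorant h hL) (by positivity)
  | succ k ih =>
    intro A φ h L hL
    rcases Nat.eq_zero_or_pos N with rfl | hN0
    · simp
    have hN : (0 : ℝ) < 2 * N := by positivity
    set S : ℕ → ℂ := fun h => ∑ j ∈ Finset.range (L - h), e2pi (φ (j + h) - φ j) with hS
    have h1 : ‖∑ j ∈ Finset.range L, e2pi (φ j)‖ ^ 2 ≤ 2 * ∑ h ∈ Finset.range N, ‖S h‖ := by
      refine (norm_sum_sq_le_vanDerCorput _ L).trans ?_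
      refine mul_le_mul_of_nonneg_left ?_ (by norm_num)
      refine (Finset.sum_le_sum fun h _ => le_of_eq ?_).trans
        (Finset.sum_le_sum_of_subset_of_nonneg (Finset.range_mono hL) fun _ _ _ => norm_nonneg _)
      rw [hS]
      dsimp only
      congr 1
      refine Finset.sum_congr rfl fun j _ => ?_
      rw [sub_eq_add_neg, e2pi_add, ← inv_e2pi, add_comm h j,
        Complex.inv_eq_conj (norm_e2pi _)]
    obtain ⟨t, ht⟩ : ∃ t, 2 ^ k = t + 1 := ⟨2 ^ k - 1, by have := Nat.one_le_two_pow (n := k); omega⟩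
    have h2 : (2 * ∑ h ∈ Finset.range N, ‖S h‖) ^ 2 ^ k * (2 * N) ≤ 
        (2 * N) ^ 2 ^ k * (2 * ∑ h ∈ Finset.range N, ‖S h‖ ^ 2 ^ k) := by
      have hJ := sum_mul_pow_succ_le (Finset.range N) (fun _ => 2) (fun h => ‖S h‖)
        (fun _ _ => by norm_num) (fun _ _ => norm_nonneg _) t
      rw [← ht, Finset.sum_const, Finset.card_range, nsmul_eq_mul, ← Finset.mul_sum, ← Finset.mul_sum,
        mul_comm (N : ℝ)] at hJ
      calc _ ≤ (2 * N : ℝ) ^ t * (2 * ∑ h ∈ Finset.range N, ‖S h‖ ^ 2 ^ k) * (2 * N) :=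
            mul_le_mul_of_nonneg_right hJ hN.le
        _ = _ := by rw [ht]; ring
    have h3 : ∀ h : ℕ, ‖S h‖ ^ 2 ^ k * (2 * N) ^ (k + 1)
        ≤ (2 * N : ℝ) ^ 2 ^ k * weylMajorant N k (h * A) := fun m =>
      ih (h m) (L - m) ((Nat.sub_le _ _).trans hL)
    have h4 : (‖∑ j ∈ Finset.range L, e2pi (φ j)‖ ^ 2) ^ 2 ^ k
        ≤ (2 * ∑ h ∈ Finset.range N, ‖S h‖) ^ 2 ^ k := pow_le_pow_left₀ (by positivity) h1 _
    rw [weylMajorant]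
    calc ‖∑ j ∈ Finset.range L, e2pi (φ j)‖ ^ 2 ^ (k + 1) * (2 * N : ℝ) ^ (k + 1 + 1)
        = (‖∑ j ∈ Finset.range L, e2pi (φ j)‖ ^ 2) ^ 2 ^ k * (2 * N) * (2 * N) ^ (k + 1) := by
          rw [← pow_mul, ← pow_succ']
          ring
      _ ≤ (2 * ∑ h ∈ Finset.range N, ‖S h‖) ^ 2 ^ k * (2 * N) * (2 * N) ^ (k + 1) := by gcongr
      _ ≤ (2 * N) ^ 2 ^ k * (2 * ∑ h ∈ Finset.range N, ‖S h‖ ^ 2 ^ k) * (2 * N) ^ (k + 1) := by gcongr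
      _ = (2 * N) ^ 2 ^ k * 2 * ∑ h ∈ Finset.range N, ‖S h‖ ^ 2 ^ k * (2 * N) ^ (k + 1) := by
          rw [← Finset.sum_mul]; ring
      _ ≤ (2 * N) ^ 2 ^ k * 2 * ∑ h ∈ Finset.range N, (2 * N) ^ 2 ^ k * weylMajorant N k (h * A) :=
          mul_le_mul_of_nonneg_left (Finset.sum_le_sum fun h _ => h3 h) (by positivity)
      _ = _ := by
          rw [← Finset.mul_sum, pow_succ (2 : ℕ) k, pow_mul]
          ring

theorem sum_Ico_mul_le_sum_divisors {M N T : ℕ} {g : ℕ → ℝ} (hg : ∀ m, 0 ≤ g m)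
    (hT : ∀ m ∈ Finset.Icc 1 (M * N), m.divisors.card ≤ T) :
    ∑ h ∈ Finset.Ico 1 N, ∑ m ∈ Finset.Icc 1 M, g (m * h)
      ≤ T * ∑ m ∈ Finset.Icc 1 (M * N), g m := by
  rw [← Finset.sum_product', Finset.mul_sum]
  rw [← Finset.sum_fiberwise_of_maps_to (t := Finset.Icc 1 (M * N)) (g := fun x : ℕ × ℕ => x.2 * x.1)]
  · refine Finset.sum_le_sum fun n hn => ?_
    rw [Finset.sum_congr rfl (g := fun _ => g n) fun x hx => by rw [(Finset.mem_filter.mp hx).2]]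
    rw [Finset.sum_const, nsmul_eq_mul]
    refine mul_le_mul_of_nonneg_right ?_ (hg n)
    have : _ ≤ n.divisors.card := Finset.card_le_card_of_injOn (fun x : ℕ × ℕ => x.1)
      (s := (Finset.Ico 1 N ×ˢ Finset.Icc 1 M).filter fun x => x.2 * x.1 = n) (fun x hx => by
        rw [Finset.mem_coe, Finset.mem_filter] at hx
        rw [Finset.mem_coe, Nat.mem_divisors]
        rw [Finset.mem_Icc] at hn
        exact ⟨⟨x.2, by rw [← hx.2, mul_comm]⟩, by omega⟩) (by
      rintro ⟨a, b⟩ hx ⟨a', b'⟩ hy (rfl : a = a')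
      rw [Finset.mem_coe, Finset.mem_filter, Finset.mem_product, Finset.mem_Ico] at hx hy
      have h1 : b * a = b' * a := hx.2.trans hy.2.symm
      rw [Nat.eq_of_mul_eq_mul_right hx.1.1.1 h1])
    exact_mod_cast this.trans (hT n hn)
  · rintro ⟨h, m⟩ hx
    rw [Finset.mem_product, Finset.mem_Ico, Finset.mem_Icc] at hx
    rw [Finset.mem_Icc]
    exact ⟨Nat.mul_pos hx.2.1 hx.1.1, Nat.mul_le_mul hx.2.2 hx.1.2.le⟩

theorem weylMajorant_le_trivial (N k : ℕ) (A : ℝ) : weylMajorant N k A ≤ (2 * N) ^ (k + 1) := by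
  induction k generalizing A with
  | zero => simpa using! geomMajorant_le N A
  | succ k ih =>
    rw [weylMajorant]
    calc 2 * ∑ h ∈ Finset.range N, weylMajorant N k (h * A)
        ≤ 2 * ∑ h ∈ Finset.range N, (2 * N : ℝ) ^ (k + 1) := by gcongr; exact ih _
      _ = _ := by rw [Finset.sum_const, Finset.card_range, nsmul_eq_mul]; ring

theorem weylMajorant_le_sum_geomMajorant {N T : ℕ} (hN : 1 ≤ N) {K : ℕ}
    (hT : ∀ m ∈ Finset.Icc 1 (N ^ K), m.divisors.card ≤ T) (k : ℕ) (hk : k ≤ K) (A : ℝ) :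
    weylMajorant N k A ≤ k * 2 ^ (k + 1) * N ^ k
      + (2 * T) ^ k * ∑ m ∈ Finset.Icc 1 (N ^ k), geomMajorant N (m * A) := by
  induction k generalizing A with
  | zero => simp [weylMajorant]
  | succ k ih =>
    rw [weylMajorant, ← Finset.sum_range_add_sum_Ico _ hN]
    simp only [Finset.range_one, Finset.sum_singleton, Nat.cast_zero, zero_mul]
    have h0 := weylMajorant_le_trivial N k 0
    have h1 : ∑ h ∈ Finset.Ico 1 N, weylMajorant N k (h * A)
        ≤ N * (k * 2 ^ (k + 1) * N ^ k) + (2 * T) ^ k *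
          (T * ∑ m ∈ Finset.Icc 1 (N ^ (k + 1)), geomMajorant N (m * A)) := by
      calc ∑ h ∈ Finset.Ico 1 N, weylMajorant N k (h * A)
          ≤ ∑ h ∈ Finset.Ico 1 N, (k * 2 ^ (k + 1) * (N : ℝ) ^ k
            + (2 * T) ^ k * ∑ m ∈ Finset.Icc 1 (N ^ k), geomMajorant N (m * (h * A))) :=
            Finset.sum_le_sum fun h _ => ih (by omega) _
        _ ≤ _ := by
            rw [Finset.sum_add_distrib, Finset.sum_const, Nat.card_Ico, nsmul_eq_mul, ← Finset.mul_sum]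
            refine add_le_add ?_ (mul_le_mul_of_nonneg_left ?_ (by positivity))
            · refine mul_le_mul_of_nonneg_right ?_ (by positivity)
              exact_mod_cast Nat.sub_le _ _
            · have := sum_Ico_mul_le_sum_divisors (M := N ^ k) (N := N) (T := T)
                (g := fun m => geomMajorant N (m * A)) (fun m => geomMajorant_nonneg N _)
                (fun m hm => hT m (by
                  rw [Finset.mem_Icc] at hm ⊢
                  refine ⟨hm.1, hm.2.trans ?_⟩
                  rw [← pow_succ]
                  exact Nat.pow_le_pow_right hN hk))
              rw [← pow_succ] at this
              refine le_trans (le_of_eq ?_) this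
              refine Finset.sum_congr rfl fun h _ => Finset.sum_congr rfl fun m _ => ?_
              push_cast
              rw [mul_assoc]
    calc 2 * (weylMajorant N k 0 + ∑ h ∈ Finset.Ico 1 N, weylMajorant N k (h * A))
        ≤ 2 * ((2 * N) ^ (k + 1) + (N * (k * 2 ^ (k + 1) * N ^ k) + (2 * T) ^ k *
          (T * ∑ m ∈ Finset.Icc 1 (N ^ (k + 1)), geomMajorant N (m * A)))) := by gcongr
      _ = _ := by
          push_cast
          ring

theorem sum_Icc_inv_le_one_add_log (q : ℕ) : ∑ i ∈ Finset.Icc 1 q, ((i : ℝ))⁻¹ ≤ 1 + Real.log q := by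
  have := harmonic_le_one_add_log q
  rw [harmonic_eq_sum_Icc] at this
  push_cast at this
  exact this

/-- Points `x j` separated by `1 / (2q)` modulo one. -/
theorem sum_geomMajorant_le_of_separated (N : ℕ) {q : ℕ} (hq : 1 ≤ q) (s : Finset ℕ) (x : ℕ → ℝ)
    (hx : ∀ i ∈ s, ∀ j ∈ s, i ≠ j → ∀ n : ℤ, 1 / (2 * q) ≤ |x i - x j - n|) :
    ∑ j ∈ s, geomMajorant N (x j) ≤ 8 * N + 8 * q * (1 + Real.log q) := by
  have hq0 : (0 : ℝ) < q := by exact_mod_cast hq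
  set b : ℕ → ℤ := fun j => ⌊2 * q * (x j - round (x j))⌋ with hb
  have hinj : Set.InjOn b s := fun i hi j hj hij => by
    by_contra hne
    have h1 := hx i hi j hj hne (round (x i) - round (x j))
    have h2 := Int.abs_sub_lt_one_of_floor_eq_floor hij
    rw [← mul_sub, abs_mul, abs_of_pos (by positivity)] at h2
    rw [div_le_iff₀ (by positivity)] at h1
    rw [show x i - x j - ((round (x i) - round (x j) : ℤ) : ℝ) =
      x i - round (x i) - (x j - round (x j)) by push_cast; ring] at h1
    linarith
  have hbound : ∀ j, ∀ k : ℕ, 1 ≤ k → (k : ℝ) ≤ 2 * q * |x j - round (x j)| →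
      geomMajorant N (x j) ≤ 4 * q * (k : ℝ)⁻¹ := fun j k hk h => by
    have hk0 : (0 : ℝ) < k := by exact_mod_cast hk
    unfold geomMajorant
    rw [← div_eq_mul_inv, div_le_div_iff₀ (by positivity) hk0]
    have := mul_le_mul_of_nonneg_left h (show (0 : ℝ) ≤ 2 * N by positivity)
    nlinarith
  have hy : ∀ j, |2 * q * (x j - round (x j))| ≤ q := fun j => by
    rw [abs_mul, abs_of_pos (by positivity : (0 : ℝ) < 2 * q)]
    nlinarith [abs_sub_round (x j)]
  have hside : ∀ (r : Finset ℕ) (κ : ℕ → ℕ), Set.InjOn κ r →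
      (∀ j ∈ r, κ j ∈ Finset.Icc 1 q ∧ (κ j : ℝ) ≤ 2 * q * |x j - round (x j)|) →
      ∑ j ∈ r, geomMajorant N (x j) ≤ 4 * q * (1 + Real.log q) := fun r κ hκ h => by
    calc ∑ j ∈ r, geomMajorant N (x j) ≤ ∑ j ∈ r, 4 * q * ((κ j : ℕ) : ℝ)⁻¹ :=
          Finset.sum_le_sum fun j hj =>
            hbound j _ (Finset.mem_Icc.mp (h j hj).1).1 (h j hj).2
      _ = ∑ k ∈ r.image κ, 4 * q * (k : ℝ)⁻¹ := (Finset.sum_image (f := fun k : ℕ => 4 * q * (k : ℝ)⁻¹) hκ).symm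
      _ ≤ ∑ k ∈ Finset.Icc 1 q, 4 * q * (k : ℝ)⁻¹ :=
          Finset.sum_le_sum_of_subset_of_nonneg (Finset.image_subset_iff.mpr fun j hj => (h j hj).1)
            fun _ _ _ => by positivity
      _ ≤ _ := by
          rw [← Finset.mul_sum]
          exact mul_le_mul_of_nonneg_left (sum_Icc_inv_le_one_add_log q) (by positivity)
  rw [← Finset.sum_filter_add_sum_filter_not s (fun j => 1 ≤ b j),
    ← Finset.sum_filter_add_sum_filter_not (s.filter fun j => ¬ 1 ≤ b j) (fun j => b j ≤ -2)]
  have hpos := hside (s.filter fun j => 1 ≤ b j) (fun j => (b j).toNat)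
    (fun i hi j hj hij => by
      rw [Finset.mem_coe, Finset.mem_filter] at hi hj
      refine hinj hi.1 hj.1 ?_
      have : (b i).toNat = (b j).toNat := hij
      omega)
    (fun j hj => by
      rw [Finset.mem_filter] at hj
      have h1 : (b j : ℝ) ≤ 2 * q * (x j - round (x j)) := Int.floor_le _
      have h2 : (((b j).toNat : ℤ) : ℝ) = (b j : ℝ) := by rw [Int.toNat_of_nonneg (by omega)]
      rw [Int.cast_natCast] at h2
      have h3 : (b j : ℝ) ≤ q := h1.trans ((le_abs_self _).trans (hy j))
      have h4 : b j ≤ q := by exact_mod_cast h3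
      refine ⟨Finset.mem_Icc.mpr ⟨by omega, by omega⟩, ?_⟩
      rw [h2]
      exact h1.trans (mul_le_mul_of_nonneg_left (le_abs_self _) (by positivity)))
  have hneg := hside ((s.filter fun j => ¬ 1 ≤ b j).filter fun j => b j ≤ -2) (fun j => (-b j - 1).toNat)
    (fun i hi j hj hij => by
      rw [Finset.mem_coe, Finset.mem_filter, Finset.mem_filter] at hi hj
      refine hinj hi.1.1 hj.1.1 ?_
      have : (-b i - 1).toNat = (-b j - 1).toNat := hij
      omega)
    (fun j hj => by
      rw [Finset.mem_filter] at hj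
      have h1 : 2 * q * (x j - round (x j)) < b j + 1 := Int.lt_floor_add_one _
      have h0 : (b j : ℝ) ≤ 2 * q * (x j - round (x j)) := Int.floor_le _
      have h2 : (((-b j - 1).toNat : ℤ) : ℝ) = -b j - 1 := by
        rw [Int.toNat_of_nonneg (by omega)]; push_cast; ring
      rw [Int.cast_natCast] at h2
      have h3 : -(q : ℝ) < b j + 1 := by
        have := (abs_le.mp (hy j)).1
        linarith
      have h4 : -(q : ℤ) < b j + 1 := by exact_mod_cast h3
      refine ⟨Finset.mem_Icc.mpr ⟨by omega, by omega⟩, ?_⟩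
      rw [h2]
      have := mul_le_mul_of_nonneg_left (neg_le_abs (x j - round (x j))) (by positivity : (0 : ℝ) ≤ 2 * q)
      linarith)
  have hmid : ∑ j ∈ (s.filter fun j => ¬ 1 ≤ b j).filter (fun j => ¬ b j ≤ -2), geomMajorant N (x j)
      ≤ 4 * N := by
    set r := (s.filter fun j => ¬ 1 ≤ b j).filter (fun j => ¬ b j ≤ -2) with hr
    have hcard : r.card ≤ 2 := by
      refine (Finset.card_le_card_of_injOn b (t := {-1, 0}) (fun j hj => ?_) fun i hi j hj => ?_).trans
        Finset.card_le_two
      · rw [Finset.mem_coe, hr, Finset.mem_filter, Finset.mem_filter] at hj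
        simp only [Finset.coe_insert, Finset.coe_singleton, Set.mem_insert_iff, Set.mem_singleton_iff]
        omega
      · rw [Finset.mem_coe, hr, Finset.mem_filter, Finset.mem_filter] at hi hj
        exact hinj hi.1.1 hj.1.1
    calc ∑ j ∈ r, geomMajorant N (x j) ≤ ∑ j ∈ r, (2 * N : ℝ) :=
          Finset.sum_le_sum fun j _ => geomMajorant_le N _
      _ = r.card * (2 * N) := by rw [Finset.sum_const, nsmul_eq_mul]
      _ ≤ 2 * (2 * N) := by
          refine mul_le_mul_of_nonneg_right ?_ (by positivity)
          exact_mod_cast hcard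
      _ = 4 * N := by ring
  have : (0 : ℝ) ≤ N := by positivity
  linarith

theorem one_div_le_abs_of_coprime_approx {ξ : ℝ} {a : ℤ} {q : ℕ} (hq : 1 ≤ q) (ha : IsCoprime a (q : ℤ))
    (hξ : |ξ - a / q| ≤ 1 / (q : ℝ) ^ 2) {l : ℤ} (hl : l ≠ 0) (hlq : 2 * |l| ≤ (q : ℤ))
    (hl1 : |l| < (q : ℤ)) (n : ℤ) :
    1 / (2 * q : ℝ) ≤ |(l : ℝ) * ξ - n| := by
  have hq0 : (0 : ℝ) < q := by exact_mod_cast hq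
  have h1 : (1 : ℝ) / q ≤ |(l : ℝ) * (a / q) - n| := by
    have hne : l * a - n * q ≠ 0 := fun h => by
      have : (q : ℤ) ∣ l * a := ⟨n, by linarith⟩
      have := ha.symm.dvd_of_dvd_mul_right this
      have := Int.le_of_dvd (abs_pos.mpr hl) ((dvd_abs _ _).mpr this)
      omega
    have h2 : (1 : ℝ) ≤ |(l * a - n * q : ℤ)| := by exact_mod_cast Int.one_le_abs hne
    have e : (l : ℝ) * (a / q) - n = ((l * a - n * q : ℤ) : ℝ) / q := by push_cast; field_simp
    rw [e, abs_div, abs_of_pos hq0]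
    refine (div_le_div_iff_of_pos_right hq0).mpr ?_
    exact_mod_cast h2
  have h3 : |(l : ℝ) * (ξ - a / q)| ≤ 1 / (2 * q) := by
    rw [abs_mul]
    have h4 : |(l : ℝ)| ≤ q / 2 := by
      have : ((2 * |l| : ℤ) : ℝ) ≤ (q : ℤ) := by exact_mod_cast hlq
      push_cast at this
      linarith
    calc |(l : ℝ)| * |ξ - a / q| ≤ q / 2 * (1 / (q : ℝ) ^ 2) :=
          mul_le_mul h4 hξ (abs_nonneg _) (by positivity)
      _ = _ := by field_simp
  have h5 : |(l : ℝ) * (a / q) - n| ≤ |l * ξ - n| + |(l : ℝ) * (ξ - a / q)| := by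
    have := abs_sub (l * ξ - n) (l * (ξ - a / q))
    rw [show (l : ℝ) * (a / q) - n = (l * ξ - n) - l * (ξ - a / q) by ring]
    exact this
  have h6 : (1 : ℝ) / q = 1 / (2 * q) + 1 / (2 * q) := by field_simp; norm_num
  linarith

theorem sum_geomMajorant_Icc_le {ξ : ℝ} {a : ℤ} {q : ℕ} (hq : 1 ≤ q) (ha : IsCoprime a (q : ℤ))
    (hξ : |ξ - a / q| ≤ 1 / (q : ℝ) ^ 2) (N M : ℕ) :
    ∑ m ∈ Finset.Icc 1 M, geomMajorant N (m * ξ)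
      ≤ (4 * M / q + 1) * (8 * N + 8 * q * (1 + Real.log q)) := by
  have hq0 : (0 : ℝ) < q := by exact_mod_cast hq
  set H := (q + 1) / 2 with hH
  have hH1 : 1 ≤ H := by omega
  have hK : 0 ≤ 8 * N + 8 * q * (1 + Real.log q) := by
    have := Real.log_natCast_nonneg q
    positivity
  have hmaps : ∀ m ∈ Finset.Icc 1 M, m / H ∈ Finset.range (M / H + 1) := fun m hm => by
    rw [Finset.mem_Icc] at hm
    rw [Finset.mem_range]
    have := Nat.div_le_div_right (c := H) hm.2
    omega
  rw [← Finset.sum_fiberwise_of_maps_to hmaps]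
  calc ∑ j ∈ Finset.range (M / H + 1), ∑ m ∈ Finset.Icc 1 M with m / H = j, geomMajorant N (m * ξ)
      ≤ ∑ j ∈ Finset.range (M / H + 1), (8 * N + 8 * q * (1 + Real.log q)) := by
        refine Finset.sum_le_sum fun j _ => ?_
        refine sum_geomMajorant_le_of_separated N hq _ (fun m => m * ξ) fun m hm m' hm' hne n => ?_
        rw [Finset.mem_filter] at hm hm'
        have h1 := Nat.div_add_mod m H
        have h2 := Nat.div_add_mod m' H
        have h3 := Nat.mod_lt m hH1
        have h4 := Nat.mod_lt m' hH1
        rw [hm.2] at h1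
        rw [hm'.2] at h2
        have hl : |(m : ℤ) - m'| < H := by rw [abs_lt]; omega
        have := one_div_le_abs_of_coprime_approx hq ha hξ (l := (m : ℤ) - m')
          (by omega) (by omega) (by omega) n
        push_cast at this
        rwa [sub_mul] at this
    _ = ((M / H : ℕ) + 1 : ℝ) * (8 * N + 8 * q * (1 + Real.log q)) := by
        rw [Finset.sum_const, Finset.card_range, nsmul_eq_mul]; push_cast; ring
    _ ≤ _ := by
        refine mul_le_mul_of_nonneg_right (add_le_add_left ?_ _) hK
        refine Nat.cast_div_le.trans ?_
        rw [div_le_div_iff₀ (by exact_mod_cast hH1) hq0]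
        have : (q : ℝ) ≤ 2 * H := by exact_mod_cast (by omega : q ≤ 2 * H)
        nlinarith [(Nat.cast_nonneg M : (0 : ℝ) ≤ M)]

theorem geomMajorant_neg (N : ℕ) (A : ℝ) : geomMajorant N (-A) = geomMajorant N A := by
  have : |-A - round (-A)| = |A - round A| := by
    rw [← UnitAddCircle.norm_eq, ← UnitAddCircle.norm_eq, AddCircle.coe_neg, norm_neg]
  unfold geomMajorant
  rw [this]

theorem sum_geomMajorant_mul_le (N M : ℕ) {L : ℤ} (hL : L ≠ 0) (ξ : ℝ) :
    ∑ m ∈ Finset.Icc 1 M, geomMajorant N (m * (L * ξ))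
      ≤ ∑ m ∈ Finset.Icc 1 (L.natAbs * M), geomMajorant N (m * ξ) := by
  have hL0 : 0 < L.natAbs := Int.natAbs_pos.mpr hL
  have h : ∀ m : ℕ, geomMajorant N (m * (L * ξ)) = geomMajorant N ((L.natAbs * m : ℕ) * ξ) := fun m => by
    rcases Int.natAbs_eq L with e | e
    · have : (L : ℝ) = ((L.natAbs : ℤ) : ℝ) := congrArg _ e
      rw [this, Nat.cast_mul, Int.cast_natCast]
      congr 1; ring
    · have : (L : ℝ) = ((-(L.natAbs : ℤ) : ℤ) : ℝ) := congrArg _ e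
      rw [this, Nat.cast_mul, ← geomMajorant_neg, Int.cast_neg, Int.cast_natCast]
      congr 1; ring
  simp_rw [h]
  rw [← Finset.sum_image (s := Finset.Icc 1 M) (g := fun m => L.natAbs * m)
    (f := fun n : ℕ => geomMajorant N (n * ξ)) fun a _ b _ hab => Nat.eq_of_mul_eq_mul_left hL0 hab]
  refine Finset.sum_le_sum_of_subset_of_nonneg (fun n hn => ?_) fun _ _ _ => geomMajorant_nonneg _ _
  obtain ⟨m, hm, rfl⟩ := Finset.mem_image.mp hn
  rw [Finset.mem_Icc] at hm ⊢
  exact ⟨Nat.mul_pos hL0 hm.1, Nat.mul_le_mul_left _ hm.2⟩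

/-- Off the major arcs, the sum of geometric majorants saves a power of `N`. -/
theorem sum_geomMajorant_Icc_le_rpow {κ : ℝ} (hκ : 0 < κ) (hκ1 : κ ≤ 1) {k : ℕ} (hk : 1 ≤ k) (L : ℕ) :
    ∃ C : ℝ, 0 < C ∧ ∀ N : ℕ, 1 ≤ N → ∀ (ξ : ℝ) (a : ℤ) (q : ℕ), 1 ≤ q → IsCoprime a (q : ℤ) →
      |ξ - a / q| ≤ 1 / (q : ℝ) ^ 2 → (N : ℝ) ^ κ ≤ q → (q : ℝ) ≤ (N : ℝ) ^ ((k : ℝ) + 1 - κ) →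
      ∑ m ∈ Finset.Icc 1 (L * N ^ k), geomMajorant N (m * ξ) ≤ C * (N : ℝ) ^ ((k : ℝ) + 1 - κ + κ / 4) := by
  set C₁ : ℝ := 1 + (k + 1) / (κ / 4) with hC₁
  have hC₁0 : 1 ≤ C₁ := by rw [hC₁]; have : 0 ≤ (k + 1) / (κ / 4) := by positivity
                           linarith
  refine ⟨32 * L + 32 * L * C₁ + 8 + 8 * C₁, by positivity, fun N hN ξ a q hq ha hξ hq1 hq2 => ?_⟩
  have hN1 : (1 : ℝ) ≤ N := by exact_mod_cast hN
  have hN0 : (0 : ℝ) < N := by linarith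
  have hq0 : (0 : ℝ) < q := by exact_mod_cast hq
  have hkR : (1 : ℝ) ≤ k := by exact_mod_cast hk
  set Y : ℝ := (N : ℝ) ^ ((k : ℝ) + 1 - κ + κ / 4) with hY
  have hle : ∀ s : ℝ, s ≤ (k : ℝ) + 1 - κ + κ / 4 → (N : ℝ) ^ s ≤ Y := fun s hs =>
    Real.rpow_le_rpow_of_exponent_le hN1 hs
  have hNε : (1 : ℝ) ≤ (N : ℝ) ^ (κ / 4) := Real.one_le_rpow hN1 (by positivity)
  have hlog : 1 + Real.log q ≤ C₁ * (N : ℝ) ^ (κ / 4) := by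
    have h1 : Real.log q ≤ (k + 1) * Real.log N := by
      calc Real.log q ≤ Real.log ((N : ℝ) ^ ((k : ℝ) + 1 - κ)) := Real.log_le_log hq0 hq2
        _ = ((k : ℝ) + 1 - κ) * Real.log N := Real.log_rpow hN0 _
        _ ≤ _ := mul_le_mul_of_nonneg_right (by linarith) (Real.log_nonneg hN1)
    have h2 : Real.log N ≤ (N : ℝ) ^ (κ / 4) / (κ / 4) := Real.log_le_rpow_div hN0.le (by positivity)
    have h3 : ((k : ℝ) + 1) * Real.log N ≤ (k + 1) * ((N : ℝ) ^ (κ / 4) / (κ / 4)) :=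
      mul_le_mul_of_nonneg_left h2 (by positivity)
    calc 1 + Real.log q ≤ (N : ℝ) ^ (κ / 4) + (k + 1) * ((N : ℝ) ^ (κ / 4) / (κ / 4)) := by linarith
      _ = _ := by rw [hC₁]; ring
  refine (sum_geomMajorant_Icc_le hq ha hξ N _).trans ?_
  push_cast
  have hinv : (q : ℝ)⁻¹ ≤ (N : ℝ) ^ (-κ) := by
    rw [Real.rpow_neg hN0.le]
    exact inv_anti₀ (by positivity) hq1
  have hNk : (N : ℝ) ^ k = (N : ℝ) ^ (k : ℝ) := (Real.rpow_natCast _ _).symm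
  have t1 : (N : ℝ) ^ k * (q : ℝ)⁻¹ * N ≤ Y := by
    calc (N : ℝ) ^ k * (q : ℝ)⁻¹ * N ≤ (N : ℝ) ^ (k : ℝ) * (N : ℝ) ^ (-κ) * N := by
          rw [hNk]; gcongr
      _ = (N : ℝ) ^ ((k : ℝ) + -κ + 1) := by rw [Real.rpow_add_one hN0.ne', Real.rpow_add hN0]
      _ ≤ Y := hle _ (by linarith)
  have t2 : (N : ℝ) ^ k * (N : ℝ) ^ (κ / 4) ≤ Y := by
    rw [hNk, ← Real.rpow_add hN0]
    exact hle _ (by linarith)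
  have t3 : (N : ℝ) ≤ Y := by
    calc (N : ℝ) = (N : ℝ) ^ (1 : ℝ) := (Real.rpow_one _).symm
      _ ≤ Y := hle _ (by linarith)
  have t4 : (q : ℝ) * (N : ℝ) ^ (κ / 4) ≤ Y := by
    calc (q : ℝ) * (N : ℝ) ^ (κ / 4) ≤ (N : ℝ) ^ ((k : ℝ) + 1 - κ) * (N : ℝ) ^ (κ / 4) := by gcongr
      _ = Y := by rw [hY, Real.rpow_add hN0 ((k : ℝ) + 1 - κ)]
  calc (4 * (L * (N : ℝ) ^ k) / q + 1) * (8 * N + 8 * q * (1 + Real.log q))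
      ≤ (4 * (L * (N : ℝ) ^ k) / q + 1) * (8 * N + 8 * q * (C₁ * (N : ℝ) ^ (κ / 4))) := by gcongr
    _ = 32 * L * ((N : ℝ) ^ k * (q : ℝ)⁻¹ * N) + 32 * L * C₁ * ((N : ℝ) ^ k * (N : ℝ) ^ (κ / 4))
        + 8 * N + 8 * C₁ * (q * (N : ℝ) ^ (κ / 4)) := by field_simp; ring
    _ ≤ 32 * L * Y + 32 * L * C₁ * Y + 8 * Y + 8 * C₁ * Y := by gcongr
    _ = _ := by ring

theorem exists_weyl_bound (P : Polynomial ℤ) {d : ℕ} (hPd : P.natDegree = d) (hd : 2 ≤ d)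
    {κ : ℝ} (hκ : 0 < κ) (hκ1 : κ ≤ 1) :
    ∃ c : ℝ, 0 < c ∧ ∃ C : ℝ, 0 < C ∧ ∀ N : ℕ, 1 ≤ N → ∀ ξ : ℝ,
      (∃ (a : ℤ) (q : ℕ), 1 ≤ q ∧ IsCoprime a (q : ℤ) ∧ (q : ℝ) ≤ (N : ℝ) ^ κ ∧
        |ξ - a / q| ≤ (N : ℝ) ^ (κ - d)) ∨
      ‖∑ n ∈ Finset.Icc 1 N, e2pi (ξ * (P.eval (n : ℤ) : ℤ))‖ ≤ C * (N : ℝ) ^ (1 - c) := by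
  obtain ⟨k, rfl⟩ : ∃ k, d = k + 1 := ⟨d - 1, by omega⟩
  have hk : 1 ≤ k := by omega
  have hk0 : (k : ℝ) ≠ 0 := by exact_mod_cast (by omega : k ≠ 0)
  set L : ℤ := ((k + 1).factorial : ℤ) * P.coeff (k + 1) with hL
  have hL0 : L ≠ 0 := by
    refine mul_ne_zero (by exact_mod_cast (k + 1).factorial_ne_zero) ?_
    rw [← hPd, Polynomial.coeff_natDegree, Polynomial.leadingCoeff_ne_zero]
    rintro rfl
    simp at hPd
  obtain ⟨C₂, hC₂, hgeom⟩ := sum_geomMajorant_Icc_le_rpow hκ hκ1 hk L.natAbs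
  obtain ⟨C₁, hC₁, hdiv⟩ := exists_card_divisors_le (ε := κ / 4 / (k * k)) (by positivity)
  set C₃ : ℝ := k * 2 ^ (k + 1) + (2 * C₁) ^ k * C₂ with hC₃
  have hC₃0 : 0 < C₃ := by positivity
  refine ⟨κ / 2 / 2 ^ k, by positivity, 2 * (C₃ + 1), by positivity, fun N hN ξ => ?_⟩
  have hN1 : (1 : ℝ) ≤ N := by exact_mod_cast hN
  have hN0 : (0 : ℝ) < N := by linarith
  set X : ℕ := ⌊(N : ℝ) ^ ((k : ℝ) + 1 - κ)⌋₊ with hX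
  have hkR : (1 : ℝ) ≤ k := by exact_mod_cast hk
  have hX1 : 0 < X := Nat.floor_pos.mpr (Real.one_le_rpow hN1 (by linarith))
  obtain ⟨r, hr, hrX⟩ := Real.exists_rat_abs_sub_le_and_den_le ξ hX1
  have hq : 1 ≤ r.den := r.pos
  have hq0 : (0 : ℝ) < r.den := by exact_mod_cast hq
  have hcop : IsCoprime r.num (r.den : ℤ) := by
    rw [Int.isCoprime_iff_nat_coprime]
    exact r.reduced
  rw [Rat.cast_def] at hr
  have hX2 : (N : ℝ) ^ ((k : ℝ) + 1 - κ) ≤ X + 1 := (Nat.lt_floor_add_one _).le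
  by_cases hmaj : (r.den : ℝ) ≤ (N : ℝ) ^ κ
  · left
    refine ⟨r.num, r.den, hq, hcop, hmaj, hr.trans ?_⟩
    rw [show κ - ((k + 1 : ℕ) : ℝ) = -((k : ℝ) + 1 - κ) by push_cast; ring, Real.rpow_neg hN0.le, ← one_div]
    refine one_div_le_one_div_of_le (by positivity) (hX2.trans ?_)
    exact le_mul_of_one_le_right (by positivity) (by exact_mod_cast hq)
  right
  have hξ : |ξ - r.num / r.den| ≤ 1 / (r.den : ℝ) ^ 2 := hr.trans <| by
    refine one_div_le_one_div_of_le (by positivity) ?_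
    rw [sq]
    refine mul_le_mul_of_nonneg_right ?_ hq0.le
    have : (r.den : ℝ) ≤ X := by exact_mod_cast hrX
    linarith
  have hqX : (r.den : ℝ) ≤ (N : ℝ) ^ ((k : ℝ) + 1 - κ) :=
    (by exact_mod_cast hrX : (r.den : ℝ) ≤ X).trans (Nat.floor_le (by positivity))
  have hG := hgeom N hN ξ r.num r.den hq hcop hξ (not_le.mp hmaj).le hqX
  set T : ℕ := ⌊C₁ * ((N : ℝ) ^ k) ^ (κ / 4 / (k * k))⌋₊ with hT
  have hTk : (T : ℝ) ^ k ≤ C₁ ^ k * (N : ℝ) ^ (κ / 4) := by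
    calc (T : ℝ) ^ k ≤ (C₁ * ((N : ℝ) ^ k) ^ (κ / 4 / (k * k))) ^ k :=
          pow_le_pow_left₀ (by positivity) (Nat.floor_le (by positivity)) k
      _ = _ := by
          rw [mul_pow, ← Real.rpow_natCast (N : ℝ) k, ← Real.rpow_mul hN0.le, ← Real.rpow_mul_natCast hN0.le]
          congr 2
          field_simp
  have hW := weylMajorant_le_sum_geomMajorant (T := T) hN (K := k) (fun m hm => by
    rw [Finset.mem_Icc] at hm
    refine Nat.le_floor ((hdiv m (by omega)).trans ?_)
    refine mul_le_mul_of_nonneg_left (Real.rpow_le_rpow (by positivity) ?_ (by positivity)) (by linarith)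
    exact_mod_cast hm.2) k le_rfl (L * ξ)
  have hWle : weylMajorant N k (L * ξ) ≤ C₃ * (N : ℝ) ^ ((k : ℝ) + 1 - κ / 2) := by
    calc weylMajorant N k (L * ξ)
        ≤ k * 2 ^ (k + 1) * N ^ k
          + (2 * T) ^ k * (C₂ * (N : ℝ) ^ ((k : ℝ) + 1 - κ + κ / 4)) :=
          hW.trans (by gcongr; exact (sum_geomMajorant_mul_le N _ hL0 ξ).trans hG)
      _ = k * 2 ^ (k + 1) * (N : ℝ) ^ (k : ℝ)
          + 2 ^ k * T ^ k * (C₂ * (N : ℝ) ^ ((k : ℝ) + 1 - κ + κ / 4)) := by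
          rw [Real.rpow_natCast, mul_pow]
      _ ≤ k * 2 ^ (k + 1) * (N : ℝ) ^ ((k : ℝ) + 1 - κ / 2)
          + 2 ^ k * (C₁ ^ k * (N : ℝ) ^ (κ / 4)) * (C₂ * (N : ℝ) ^ ((k : ℝ) + 1 - κ + κ / 4)) := by
          gcongr
          · linarith
      _ = k * 2 ^ (k + 1) * (N : ℝ) ^ ((k : ℝ) + 1 - κ / 2)
          + 2 ^ k * C₁ ^ k * C₂ * ((N : ℝ) ^ (κ / 4) * (N : ℝ) ^ ((k : ℝ) + 1 - κ + κ / 4)) := by ring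
      _ = _ := by
          rw [← Real.rpow_add hN0, hC₃, mul_pow]
          rw [show κ / 4 + ((k : ℝ) + 1 - κ + κ / 4) = (k : ℝ) + 1 - κ / 2 by ring]
          ring
  have hS := norm_sum_e2pi_pow_le_weylMajorant k (IsPolyPhase.polynomial P k hPd.le ξ) N le_rfl
  rw [← hL] at hS
  have hsum : ∑ n ∈ Finset.Icc 1 N, e2pi (ξ * (P.eval (n : ℤ) : ℤ))
      = ∑ j ∈ Finset.range N, e2pi (ξ * (P.eval ((j : ℤ) + 1) : ℤ)) := by
    have := Finset.sum_Ico_add' (fun n : ℕ => e2pi (ξ * (P.eval (n : ℤ) : ℤ))) 0 N 1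
    push_cast at this
    rw [Finset.range_eq_Ico, this, Finset.Ico_add_one_right_eq_Icc]
  rw [hsum]
  set S := ‖∑ j ∈ Finset.range N, e2pi (ξ * (P.eval ((j : ℤ) + 1) : ℤ))‖ with hSdef
  have hpow : S ^ 2 ^ k ≤ (2 * (C₃ + 1) * (N : ℝ) ^ (1 - κ / 2 / 2 ^ k)) ^ 2 ^ k := by
    set n : ℕ := 2 ^ k with hn
    have hnR : (2 : ℝ) ^ k = n := by rw [hn]; push_cast; rfl
    have hn0 : (n : ℝ) ≠ 0 := by rw [← hnR]; positivity
    have hn1 : n ≠ 0 := by rw [hn]; positivity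
    have h1 : S ^ n * (N : ℝ) ^ (k + 1) ≤ 2 ^ n * C₃ * (N : ℝ) ^ ((n : ℝ) - κ / 2) * (N : ℝ) ^ (k + 1) := by
      calc S ^ n * (N : ℝ) ^ (k + 1) ≤ S ^ n * (2 * N : ℝ) ^ (k + 1) := by gcongr; linarith
        _ ≤ (2 * N : ℝ) ^ n * (C₃ * (N : ℝ) ^ ((k : ℝ) + 1 - κ / 2)) := hS.trans (by gcongr)
        _ = 2 ^ n * C₃ * ((N : ℝ) ^ (n : ℝ) * (N : ℝ) ^ ((k : ℝ) + 1 - κ / 2)) := by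
            rw [mul_pow, Real.rpow_natCast]; ring
        _ = 2 ^ n * C₃ * ((N : ℝ) ^ ((n : ℝ) - κ / 2) * (N : ℝ) ^ ((k + 1 : ℕ) : ℝ)) := by
            rw [← Real.rpow_add hN0, ← Real.rpow_add hN0]
            congr 2
            push_cast
            ring
        _ = _ := by rw [Real.rpow_natCast]; ring
    have h2 := le_of_mul_le_mul_right h1 (by positivity)
    have h3 : C₃ ≤ (C₃ + 1) ^ n := (by linarith : C₃ ≤ C₃ + 1).trans (le_self_pow₀ (by linarith) hn1)
    calc S ^ n ≤ 2 ^ n * C₃ * (N : ℝ) ^ ((n : ℝ) - κ / 2) := h2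
      _ ≤ 2 ^ n * (C₃ + 1) ^ n * (N : ℝ) ^ ((n : ℝ) - κ / 2) := by gcongr
      _ = _ := by
          rw [mul_pow, mul_pow, ← Real.rpow_mul_natCast hN0.le, hnR]
          congr 2
          field_simp
  exact le_of_pow_le_pow_left₀ (by positivity) (by positivity) hpow

section Symbol

variable {η : ℝ → ℝ} (hη01 : ∀ x : ℝ, η x ∈ Set.Icc (0 : ℝ) 1)
  (hη0 : ∀ x : ℝ, x ∉ Set.Ioo (-(1 / 2) : ℝ) (1 / 2) → η x = 0)

include hη0 in
theorem canonicalFractions_eq_of_bump_ne_zero {Q : ℕ} {δ : ℝ} (hδ : 0 < δ) (hQδ : (Q : ℝ) ^ 2 * δ ≤ 1)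
    {θ θ' : ℕ × ℕ} (hθ : θ ∈ canonicalFractions Q) (hθ' : θ' ∈ canonicalFractions Q) {ξ : ℝ}
    (h : η (δ⁻¹ * ((ξ - (θ.1 : ℝ) / θ.2) - round (ξ - (θ.1 : ℝ) / θ.2))) ≠ 0)
    (h' : η (δ⁻¹ * ((ξ - (θ'.1 : ℝ) / θ'.2) - round (ξ - (θ'.1 : ℝ) / θ'.2))) ≠ 0) : θ = θ' := by
  obtain ⟨a, q⟩ := θ
  obtain ⟨b, r⟩ := θ'
  rw [mem_canonicalFractions] at hθ hθ'
  obtain ⟨hq1, hqQ, haq, hcop⟩ := hθ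
  obtain ⟨hr1, hrQ, hbr, hcop'⟩ := hθ'
  dsimp only at *
  have hq0 : (0 : ℝ) < q := by exact_mod_cast hq1
  have hr0 : (0 : ℝ) < r := by exact_mod_cast hr1
  have key : ∀ t : ℝ, η (δ⁻¹ * t) ≠ 0 → |t| < δ / 2 := fun t ht => by
    have h1 : δ⁻¹ * t ∈ Set.Ioo (-(1 / 2) : ℝ) (1 / 2) := by
      by_contra hc
      exact ht (hη0 _ hc)
    rw [Set.mem_Ioo, inv_mul_eq_div, lt_div_iff₀ hδ, div_lt_iff₀ hδ] at h1
    rw [abs_lt]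
    constructor <;> linarith [h1.1, h1.2]
  have h1 := key _ h
  have h2 := key _ h'
  set k : ℤ := round (ξ - (b : ℝ) / r) - round (ξ - (a : ℝ) / q) with hk
  have h3 : |(b : ℝ) / r - a / q + k| < δ := by
    have e : (b : ℝ) / r - a / q + k = (ξ - (a : ℝ) / q - round (ξ - (a : ℝ) / q))
        - (ξ - (b : ℝ) / r - round (ξ - (b : ℝ) / r)) := by rw [hk]; push_cast; ring
    rw [e]
    refine (abs_sub _ _).trans_lt ?_
    linarith
  have e : (b : ℝ) / r - a / q + k = ((b * q - a * r + k * (q * r) : ℤ) : ℝ) / (q * r) := by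
    push_cast
    field_simp
  have h4 : (b * q - a * r + k * (q * r) : ℤ) = 0 := by
    by_contra hne
    have h5 : (1 : ℝ) ≤ |((b * q - a * r + k * (q * r) : ℤ) : ℝ)| := by exact_mod_cast Int.one_le_abs hne
    rw [e, abs_div, abs_of_pos (by positivity : (0 : ℝ) < q * r), div_lt_iff₀ (by positivity)] at h3
    have h6 : (q : ℝ) * r ≤ (Q : ℝ) ^ 2 := by
      rw [sq]
      exact mul_le_mul (by exact_mod_cast hqQ) (by exact_mod_cast hrQ) hr0.le (by positivity)
    nlinarith
  have hk0 : k = 0 := by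
    have h5 : (b : ℝ) / r - a / q + k = 0 := by rw [e, h4]; simp
    have h6 : (b : ℝ) / r < 1 := (div_lt_one hr0).mpr (by exact_mod_cast hbr)
    have h7 : (a : ℝ) / q < 1 := (div_lt_one hq0).mpr (by exact_mod_cast haq)
    have h8 : 0 ≤ (b : ℝ) / r := by positivity
    have h9 : 0 ≤ (a : ℝ) / q := by positivity
    have h10 : (k : ℝ) < 1 := by linarith
    have h11 : (-1 : ℝ) < k := by linarith
    have h12 : k < 1 := by exact_mod_cast h10
    have h13 : -1 < k := by exact_mod_cast h11
    omega
  rw [hk0] at h4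
  have h5 : b * q = a * r := by
    have : (b * q : ℤ) = a * r := by linarith
    exact_mod_cast this
  have hqr : q = r := by
    refine Nat.dvd_antisymm ?_ ?_
    · exact (Nat.Coprime.symm hcop).dvd_of_dvd_mul_left (Dvd.intro_left b h5)
    · exact (Nat.Coprime.symm hcop').dvd_of_dvd_mul_left (Dvd.intro_left a h5.symm)
  subst hqr
  rw [Nat.eq_of_mul_eq_mul_right hq1 h5]

include hη01 in
theorem iwSymbol_nonneg (N₁ N₂ ξ : ℝ) : 0 ≤ iwSymbol η N₁ N₂ ξ :=
  Finset.sum_nonneg fun _ _ => (hη01 _).1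

include hη01 hη0

theorem iwSymbol_le_one {Q : ℕ} {δ : ℝ} (hδ : 0 < δ) (hQδ : (Q : ℝ) ^ 2 * δ ≤ 1) (ξ : ℝ) :
    iwSymbol η Q δ ξ ≤ 1 := by
  unfold iwSymbol
  by_cases h : ∃ θ ∈ canonicalFractions Q,
      η (δ⁻¹ * ((ξ - (θ.1 : ℝ) / θ.2) - round (ξ - (θ.1 : ℝ) / θ.2))) ≠ 0
  · obtain ⟨θ, hθ, hne⟩ := h
    rw [Finset.sum_eq_single_of_mem θ hθ fun θ' hθ' hne' => ?_]
    · exact (hη01 _).2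
    · by_contra hc
      exact hne' (canonicalFractions_eq_of_bump_ne_zero hη0 hδ hQδ hθ' hθ hc hne)
  · push Not at h
    rw [Finset.sum_eq_zero h]
    exact zero_le_one

theorem iwSymbol_eq_one (hη1 : ∀ x ∈ Set.Icc (-(1 / 4) : ℝ) (1 / 4), η x = 1)
    {Q : ℕ} {δ : ℝ} (hδ : 0 < δ) (hδ1 : δ ≤ 1) (hQδ : (Q : ℝ) ^ 2 * δ ≤ 1)
    {ξ : ℝ} {a : ℤ} {q : ℕ} (hq : 1 ≤ q) (hqQ : q ≤ Q) (ha : IsCoprime a (q : ℤ))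
    (hξ : |ξ - a / q| ≤ δ / 4) : iwSymbol η Q δ ξ = 1 := by
  have hq0 : (0 : ℝ) < q := by exact_mod_cast hq
  refine le_antisymm (iwSymbol_le_one hη01 hη0 hδ hQδ ξ) ?_
  obtain ⟨b, k, hbq, rfl⟩ : ∃ (b : ℕ) (k : ℤ), b < q ∧ a = b + q * k := by
    refine ⟨(a % q).toNat, a / q, ?_, ?_⟩
    · have := Int.emod_lt_of_pos a (by omega : (0 : ℤ) < q)
      omega
    · rw [Int.toNat_of_nonneg (Int.emod_nonneg _ (by omega))]
      exact (Int.emod_add_mul_ediv a q).symm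
  have hmem : (b, q) ∈ canonicalFractions Q := by
    rw [mem_canonicalFractions]
    refine ⟨hq, hqQ, hbq, ?_⟩
    exact Nat.isCoprime_iff_coprime.mp (IsCoprime.of_add_mul_left_left ha)
  have hterm : η (δ⁻¹ * ((ξ - (b : ℝ) / q) - round (ξ - (b : ℝ) / q))) = 1 := by
    have e : ξ - (b : ℝ) / q = (ξ - ((b + q * k : ℤ) : ℝ) / q) + (k : ℤ) := by
      push_cast
      field_simp
      ring
    have hr : round (ξ - ((b + q * k : ℤ) : ℝ) / q) = 0 := by
      rw [round_eq_zero_iff, Set.mem_Ico]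
      have := abs_le.mp hξ
      constructor <;> linarith [this.1, this.2]
    rw [e, round_add_intCast, hr]
    apply hη1
    rw [abs_le] at hξ
    rw [Set.mem_Icc, inv_mul_eq_div, le_div_iff₀ hδ, div_le_iff₀ hδ, zero_add, add_sub_cancel_right]
    constructor <;> linarith [hξ.1, hξ.2]
  have := Finset.single_le_sum (f := fun θ : ℕ × ℕ =>
    η (δ⁻¹ * ((ξ - (θ.1 : ℝ) / θ.2) - round (ξ - (θ.1 : ℝ) / θ.2)))) (fun _ _ => (hη01 _).1) hmem
  dsimp only at this
  rw [hterm] at this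
  exact this

end Symbol

theorem integral_e2pi_int (n : ℤ) : ∫ ξ in Set.Ioc (0 : ℝ) 1, e2pi (ξ * n) = if n = 0 then 1 else 0 := by
  rw [← intervalIntegral.integral_of_le zero_le_one]
  split_ifs with h
  · simp [h, e2pi]
  · have hc : (2 * π * Complex.I * n : ℂ) ≠ 0 := by
      have : (n : ℂ) ≠ 0 := by exact_mod_cast h
      have : (π : ℂ) ≠ 0 := by exact_mod_cast Real.pi_ne_zero
      simp [*]
    have := integral_exp_mul_complex (a := 0) (b := 1) hc
    have e : ∀ ξ : ℝ, e2pi (ξ * n) = Complex.exp (2 * π * Complex.I * n * ξ) := fun ξ => by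
      unfold e2pi; congr 1; push_cast; ring
    simp_rw [e]
    rw [this]
    have h1 : Complex.exp (2 * π * Complex.I * n * ((1 : ℝ) : ℂ)) = 1 := by
      rw [← e 1, one_mul, e2pi_intCast]
    rw [h1]
    simp

theorem hasSum_sq_integral_mul_e2pi {g : ℝ → ℂ} (hg : Measurable g) {M : ℝ} (hgM : ∀ ξ, ‖g ξ‖ ≤ M) :
    HasSum (fun x : ℤ => ‖∫ ξ in Set.Ioc (0 : ℝ) 1, g ξ * e2pi (-(ξ * x))‖ ^ 2)
      (∫ ξ in Set.Ioc (0 : ℝ) 1, ‖g ξ‖ ^ 2) := by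
  have hL2 : MemLp g 2 (volume.restrict (Set.Ioc (0 : ℝ) 1)) :=
    MemLp.of_bound hg.aestronglyMeasurable M (Eventually.of_forall hgM)
  have := hasSum_sq_fourierCoeffOn (zero_lt_one : (0 : ℝ) < 1) hL2
  rw [sub_zero, inv_one, one_smul, intervalIntegral.integral_of_le zero_le_one] at this
  have h : ∀ x : ℤ, ∫ ξ in Set.Ioc (0 : ℝ) 1, g ξ * e2pi (-(ξ * x))
      = fourierCoeffOn (zero_lt_one : (0 : ℝ) < 1) g x := fun x => by
    rw [fourierCoeffOn_eq_integral, intervalIntegral.integral_of_le zero_le_one]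
    simp only [sub_zero, div_one, one_smul]
    refine setIntegral_congr_fun measurableSet_Ioc fun ξ _ => ?_
    rw [fourier_coe_apply, smul_eq_mul, mul_comm]
    congr 1
    unfold e2pi
    congr 1
    push_cast
    simp
    ring
  simp_rw [h]
  exact this

section Parseval

theorem measurable_trigSum (f : ℤ → ℂ) (U : Finset ℤ) :
    Measurable fun ξ : ℝ => ∑ u ∈ U, f u * e2pi (ξ * u) :=
  Finset.measurable_sum _ fun _ _ =>
    ((continuous_e2pi.comp (continuous_id.mul continuous_const)).measurable).const_mul _

theorem norm_trigSum_le (f : ℤ → ℂ) (U : Finset ℤ) (ξ : ℝ) :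
    ‖∑ u ∈ U, f u * e2pi (ξ * u)‖ ≤ ∑ u ∈ U, ‖f u‖ :=
  (norm_sum_le _ _).trans (Finset.sum_le_sum fun u _ => by rw [norm_mul, norm_e2pi, mul_one])

theorem sum_integral_mul_eq {Φ : ℝ → ℂ} (hΦ : Measurable Φ) {M : ℝ} (hM : ∀ ξ, ‖Φ ξ‖ ≤ M)
    (f : ℤ → ℂ) (U : Finset ℤ) (x : ℤ) :
    ∑ u ∈ U, (∫ ξ in Set.Ioc (0 : ℝ) 1, Φ ξ * e2pi (-(ξ * ((x - u : ℤ) : ℝ)))) * f u =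
      ∫ ξ in Set.Ioc (0 : ℝ) 1, (Φ ξ * ∑ u ∈ U, f u * e2pi (ξ * u)) * e2pi (-(ξ * x)) := by
  have h : ∀ ξ : ℝ, (Φ ξ * ∑ u ∈ U, f u * e2pi (ξ * u)) * e2pi (-(ξ * x)) =
      ∑ u ∈ U, Φ ξ * e2pi (-(ξ * ((x - u : ℤ) : ℝ))) * f u := fun ξ => by
    rw [Finset.mul_sum, Finset.sum_mul]
    refine Finset.sum_congr rfl fun u _ => ?_
    rw [show -(ξ * ((x - u : ℤ) : ℝ)) = ξ * u + -(ξ * x) by push_cast; ring, e2pi_add]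
    ring
  simp_rw [h]
  rw [integral_finsetSum]
  · exact Finset.sum_congr rfl fun u _ => (integral_mul_const _ _).symm
  · intro u _
    exact (integrable_period_mul_e2pi hΦ hM _ (by fun_prop)).mul_const _

theorem integral_trigSum_mul_e2pi {f : ℤ → ℂ} {U : Finset ℤ} (hf : ∀ u ∉ U, f u = 0) (x : ℤ) :
    ∫ ξ in Set.Ioc (0 : ℝ) 1, (∑ u ∈ U, f u * e2pi (ξ * u)) * e2pi (-(ξ * x)) = f x := by
  have h := sum_integral_mul_eq (Φ := fun _ => 1) measurable_const (M := 1) (by simp) f U x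
  simp only [one_mul] at h
  rw [← h]
  have h2 : ∀ u : ℤ, ∫ ξ in Set.Ioc (0 : ℝ) 1, e2pi (-(ξ * ((x - u : ℤ) : ℝ))) =
      if x = u then 1 else 0 := fun u => by
    have := integral_e2pi_int (-(x - u))
    simp only [neg_eq_zero, sub_eq_zero] at this
    rw [← this]
    refine setIntegral_congr_fun measurableSet_Ioc fun ξ _ => ?_
    push_cast
    ring_nf
  simp_rw [h2, ite_mul, one_mul, zero_mul]
  rw [Finset.sum_ite_eq]
  split_ifs with hx
  · rfl
  · exact (hf x hx).symm

theorem sum_sq_convolution_le_of_multiplier {Φ : ℝ → ℂ} (hΦ : Measurable Φ) {M : ℝ}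
    (hM : ∀ ξ, ‖Φ ξ‖ ≤ M) {f : ℤ → ℂ} {U : Finset ℤ} (hf : ∀ u ∉ U, f u = 0) (X : Finset ℤ) :
    ∑ x ∈ X, ‖∑ u ∈ U, (∫ ξ in Set.Ioc (0 : ℝ) 1, Φ ξ * e2pi (-(ξ * ((x - u : ℤ) : ℝ)))) * f u‖ ^ 2
      ≤ M ^ 2 * ∑ u ∈ U, ‖f u‖ ^ 2 := by
  set g : ℝ → ℂ := fun ξ => ∑ u ∈ U, f u * e2pi (ξ * u) with hg
  have hgm : Measurable g := measurable_trigSum f U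
  have hM0 : 0 ≤ M := (norm_nonneg _).trans (hM 0)
  have hgb : ∀ ξ, ‖g ξ‖ ≤ ∑ u ∈ U, ‖f u‖ := norm_trigSum_le f U
  have hΦg : ∀ ξ, ‖Φ ξ * g ξ‖ ≤ M * ∑ u ∈ U, ‖f u‖ := fun ξ => by
    rw [norm_mul]
    exact mul_le_mul (hM ξ) (hgb ξ) (norm_nonneg _) hM0
  have hint : ∀ (k : ℝ → ℂ) (A : ℝ), Measurable k → (∀ ξ, ‖k ξ‖ ≤ A) →
      IntegrableOn (fun ξ => ‖k ξ‖ ^ 2) (Set.Ioc (0 : ℝ) 1) := fun k A hk hA => by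
    refine Measure.integrableOn_of_bounded (M := A ^ 2) (by simp)
      (hk.norm.pow_const 2).aestronglyMeasurable (ae_of_all _ fun ξ => ?_)
    rw [norm_pow, norm_norm]
    exact pow_le_pow_left₀ (norm_nonneg _) (hA ξ) 2
  have h1 := hasSum_sq_integral_mul_e2pi (hΦ.mul hgm) hΦg
  have h2 := hasSum_sq_integral_mul_e2pi hgm hgb
  simp only [hg, integral_trigSum_mul_e2pi hf] at h2
  have h3 : ∫ ξ in Set.Ioc (0 : ℝ) 1, ‖g ξ‖ ^ 2 = ∑ u ∈ U, ‖f u‖ ^ 2 := by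
    refine h2.unique ?_
    refine hasSum_sum_of_ne_finset_zero fun u hu => ?_
    rw [hf u hu, norm_zero]
    norm_num
  calc _ = ∑ x ∈ X, ‖∫ ξ in Set.Ioc (0 : ℝ) 1, (Φ ξ * g ξ) * e2pi (-(ξ * x))‖ ^ 2 := by
        refine Finset.sum_congr rfl fun x _ => ?_
        rw [sum_integral_mul_eq hΦ hM f U x]
    _ ≤ ∫ ξ in Set.Ioc (0 : ℝ) 1, ‖Φ ξ * g ξ‖ ^ 2 :=
        sum_le_hasSum X (fun _ _ => by positivity) h1
    _ ≤ ∫ ξ in Set.Ioc (0 : ℝ) 1, M ^ 2 * ‖g ξ‖ ^ 2 := by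
        refine setIntegral_mono_on (hint _ _ (hΦ.mul hgm) hΦg) ((hint _ _ hgm hgb).const_mul _)
          measurableSet_Ioc fun ξ _ => ?_
        rw [norm_mul, mul_pow]
        gcongr
        exact hM ξ
    _ = _ := by rw [integral_const_mul, h3]

end Parseval

/-- The convolution kernel of `f ↦ A_N^P (f - Π[≤N₁, ≤N₂] f)`. -/
noncomputable def minorKernel (η : ℝ → ℝ) (P : Polynomial ℤ) (N : ℕ) (N₁ N₂ : ℝ) (k : ℤ) : ℂ :=
  (N : ℂ)⁻¹ * ∑ n ∈ Finset.Icc 1 N,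
    ((if k - P.eval (n : ℤ) = 0 then 1 else 0) - iwKernel η N₁ N₂ (k - P.eval (n : ℤ)))

theorem discPolyAvg_sub_iwProj_eq_sum (η : ℝ → ℝ) (P : Polynomial ℤ) (N : ℕ) (N₁ N₂ : ℝ)
    {f : ℤ → ℂ} {U : Finset ℤ} (hf : ∀ u ∉ U, f u = 0) (x : ℤ) :
    discPolyAvg P N (fun y => f y - iwProj η N₁ N₂ f y) x =
      ∑ u ∈ U, minorKernel η P N N₁ N₂ (x - u) * f u := by
  unfold discPolyAvg minorKernel
  simp_rw [mul_assoc]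
  rw [← Finset.mul_sum]
  congr 1
  simp_rw [Finset.sum_mul]
  rw [Finset.sum_comm]
  refine Finset.sum_congr rfl fun n _ => ?_
  rw [iwProj_eq_sum N₁ N₂ hf]
  simp_rw [sub_mul]
  rw [Finset.sum_sub_distrib]
  congr 1
  · simp_rw [ite_mul, one_mul, zero_mul]
    have : ∀ u : ℤ, (x - u - P.eval (n : ℤ) = 0) ↔ x - P.eval (n : ℤ) = u := fun u => by
      constructor <;> intro h <;> linarith
    simp_rw [this]
    rw [Finset.sum_ite_eq]
    split_ifs with hx
    · rfl
    · exact hf _ hx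
  · refine Finset.sum_congr rfl fun u _ => ?_
    rw [sub_right_comm]

/-- The multiplier of `f ↦ A_N^P (f - Π[≤N₁, ≤N₂] f)`. -/
noncomputable def minorSymbol (η : ℝ → ℝ) (P : Polynomial ℤ) (N : ℕ) (N₁ N₂ : ℝ) (ξ : ℝ) : ℂ :=
  ((N : ℂ)⁻¹ * ∑ n ∈ Finset.Icc 1 N, e2pi (ξ * (P.eval (n : ℤ) : ℤ))) *
    (1 - (iwSymbol η N₁ N₂ ξ : ℂ))

theorem measurable_minorSymbol {η : ℝ → ℝ} (hη : Continuous η) (P : Polynomial ℤ) (N : ℕ)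
    (N₁ N₂ : ℝ) : Measurable (minorSymbol η P N N₁ N₂) := by
  refine Measurable.mul (Measurable.const_mul ?_ _)
    ((Complex.measurable_ofReal.comp (measurable_iwSymbol hη N₁ N₂)).const_sub 1)
  exact Finset.measurable_sum _ fun n _ =>
    (continuous_e2pi.comp (continuous_id.mul continuous_const)).measurable

theorem minorKernel_eq_integral {η : ℝ → ℝ} (hη : Continuous η) (P : Polynomial ℤ) (N : ℕ)
    {N₁ N₂ : ℝ} (h0 : ∀ ξ, 0 ≤ iwSymbol η N₁ N₂ ξ) (h1 : ∀ ξ, iwSymbol η N₁ N₂ ξ ≤ 1) (k : ℤ) :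
    minorKernel η P N N₁ N₂ k =
      ∫ ξ in Set.Ioc (0 : ℝ) 1, minorSymbol η P N N₁ N₂ ξ * e2pi (-(ξ * k)) := by
  set σ : ℝ → ℂ := fun ξ => (iwSymbol η N₁ N₂ ξ : ℂ) with hσ
  have hσm : Measurable σ := Complex.measurable_ofReal.comp (measurable_iwSymbol hη N₁ N₂)
  have hσ1 : ∀ ξ, ‖σ ξ‖ ≤ 1 := fun ξ => by
    rw [hσ, Complex.norm_real, Real.norm_of_nonneg (h0 ξ)]
    exact h1 ξ
  have hi1 : ∀ c : ℝ → ℝ, Continuous c → IntegrableOn (fun ξ => e2pi (c ξ)) (Set.Ioc 0 1) :=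
    fun c hc => by
      have := integrable_period_mul_e2pi (g := fun _ => 1) measurable_const (M := 1) (by simp) c hc
      simpa only [one_mul] using this
  have hi2 := fun c hc => integrable_period_mul_e2pi hσm hσ1 c hc
  have h : ∀ ξ : ℝ, minorSymbol η P N N₁ N₂ ξ * e2pi (-(ξ * k)) = (N : ℂ)⁻¹ *
      ∑ n ∈ Finset.Icc 1 N, (e2pi (ξ * ((-(k - P.eval (n : ℤ)) : ℤ) : ℝ))
        - σ ξ * e2pi (-(ξ * ((k - P.eval (n : ℤ) : ℤ) : ℝ)))) := fun ξ => by
    unfold minorSymbol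
    rw [mul_assoc, mul_assoc, Finset.sum_mul]
    congr 1
    refine Finset.sum_congr rfl fun n _ => ?_
    rw [show ξ * ((-(k - P.eval (n : ℤ)) : ℤ) : ℝ) = ξ * (P.eval (n : ℤ) : ℤ) + -(ξ * k) by
        push_cast; ring,
      show -(ξ * ((k - P.eval (n : ℤ) : ℤ) : ℝ)) = ξ * (P.eval (n : ℤ) : ℤ) + -(ξ * k) by
        push_cast; ring, e2pi_add]
    ring
  simp_rw [h]
  rw [integral_const_mul, integral_finsetSum]
  · unfold minorKernel
    congr 1
    refine Finset.sum_congr rfl fun n _ => ?_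
    rw [integral_sub (hi1 _ (by fun_prop)) (hi2 _ (by fun_prop)), integral_e2pi_int]
    simp only [neg_eq_zero]
    rfl
  · intro n _
    exact (hi1 _ (by fun_prop)).sub (hi2 _ (by fun_prop))

theorem sum_sq_minorKernel_le {η : ℝ → ℝ} (hη : Continuous η) (P : Polynomial ℤ) (N : ℕ)
    {N₁ N₂ : ℝ} (h0 : ∀ ξ, 0 ≤ iwSymbol η N₁ N₂ ξ) (h1 : ∀ ξ, iwSymbol η N₁ N₂ ξ ≤ 1) {M : ℝ}
    (hM : ∀ ξ, ‖minorSymbol η P N N₁ N₂ ξ‖ ≤ M) {f : ℤ → ℂ} {U : Finset ℤ}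
    (hf : ∀ u ∉ U, f u = 0) (X : Finset ℤ) :
    ∑ x ∈ X, ‖∑ u ∈ U, minorKernel η P N N₁ N₂ (x - u) * f u‖ ^ 2 ≤ M ^ 2 * ∑ u ∈ U, ‖f u‖ ^ 2 := by
  have := sum_sq_convolution_le_of_multiplier (measurable_minorSymbol hη P N N₁ N₂) hM hf X
  simp_rw [minorKernel_eq_integral hη P N h0 h1]
  exact this

theorem two_pow_floor_logb_le {t : ℝ} (ht : 0 ≤ t) : (2 : ℝ) ^ ⌊t⌋₊ ≤ 2 ^ t := by
  rw [← Real.rpow_natCast]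
  exact Real.rpow_le_rpow_of_exponent_le one_le_two (Nat.floor_le ht)

theorem lt_two_mul_two_pow_floor (t : ℝ) : (2 : ℝ) ^ t < 2 * 2 ^ ⌊t⌋₊ := by
  rw [← pow_succ', ← Real.rpow_natCast]
  refine Real.rpow_lt_rpow_of_exponent_lt one_lt_two ?_
  push_cast
  exact Nat.lt_floor_add_one t

theorem exists_scale_bounds {d p₀ : ℕ} (hd : 2 ≤ d) (hp₀ : 0 < p₀) {α : ℝ} (hα : 0 < α)
    (hα' : α < ((10 ^ 6 * d * p₀ : ℕ) : ℝ)⁻¹) :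
    ∃ N₀ : ℕ, 1 ≤ N₀ ∧ ∀ N : ℕ, N₀ ≤ N → ∀ Q δ : ℝ, Q = 2 ^ ⌊α * Real.logb 2 N⌋₊ →
      δ = (2 : ℝ) ^ (-(d : ℤ) * ((⌊Real.logb 2 N⌋₊ : ℤ) - (⌊α * Real.logb 2 N⌋₊ : ℤ))) →
      1 ≤ Q ∧ Q ≤ N ∧ (N : ℝ) ^ (α / 2) ≤ Q ∧ 0 < δ ∧ 2 * Q ^ (3 * p₀ + 2) * δ ≤ 1 ∧
        (N : ℝ) ^ (α / 2 - d) ≤ δ / 4 := by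
  have h1 : ∀ᶠ x : ℝ in atTop, 8 ≤ x ^ (α / 2) :=
    (tendsto_rpow_atTop (half_pos hα)).eventually_ge_atTop 8
  have h2 : ∀ᶠ N : ℕ in atTop, 8 ≤ (N : ℝ) ^ (α / 2) := tendsto_natCast_atTop_atTop.eventually h1
  obtain ⟨N₁, hN₁⟩ := eventually_atTop.mp h2
  refine ⟨max N₁ (2 ^ (d + 1)), le_max_of_le_right Nat.one_le_two_pow, fun N hN Q δ hQ hδ => ?_⟩
  have h8 := hN₁ N (le_of_max_le_left hN)
  have hN2 : (2 : ℝ) ^ (d + 1) ≤ N := by exact_mod_cast le_of_max_le_right hN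
  have hN1 : (1 : ℝ) ≤ N := (one_le_pow₀ one_le_two).trans hN2
  have hN0 : (0 : ℝ) < N := by linarith
  have hdp : (1 : ℝ) ≤ d * p₀ := by exact_mod_cast Nat.mul_pos (by omega : 0 < d) hp₀
  have hαs : α * (10 ^ 6 * (d * p₀)) < 1 := by
    push_cast at hα'
    rw [mul_assoc, lt_inv_comm₀ hα (by positivity), lt_inv_comm₀ (by positivity) hα,
      ← one_div, lt_div_iff₀ (by positivity)] at hα'
    exact lt_of_eq_of_lt (by norm_num) hα'
  have hlog : 0 ≤ Real.logb 2 N := Real.logb_nonneg one_lt_two hN1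
  have e1 : (2 : ℝ) ^ Real.logb 2 N = N := Real.rpow_logb two_pos (by norm_num) hN0
  have e2 : (2 : ℝ) ^ (α * Real.logb 2 N) = (N : ℝ) ^ α := by
    rw [mul_comm, Real.rpow_mul two_pos.le, e1]
  have hQ1 : 1 ≤ Q := hQ ▸ one_le_pow₀ one_le_two
  have hQ0 : 0 < Q := by linarith
  have hQα : Q ≤ (N : ℝ) ^ α := by
    rw [hQ, ← e2]
    exact two_pow_floor_logb_le (by positivity)
  have hαQ : (N : ℝ) ^ α < 2 * Q := by
    rw [hQ, ← e2]
    exact lt_two_mul_two_pow_floor _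
  have hα1 : α ≤ 1 := by nlinarith
  set L : ℝ := 2 ^ ⌊Real.logb 2 N⌋₊ with hL
  have hL0 : 0 < L := by positivity
  have hLN : L ≤ N := by
    rw [hL]
    conv_rhs => rw [← e1]
    exact two_pow_floor_logb_le hlog
  have hNL : N ≤ 2 * L := by
    rw [hL]
    conv_lhs => rw [← e1]
    exact (lt_two_mul_two_pow_floor _).le
  have hδe : δ = (Q / L) ^ d := by
    rw [hδ, hQ, hL, mul_comm, neg_eq_neg_one_mul, ← mul_assoc, zpow_mul, zpow_natCast]
    congr 1
    rw [mul_neg_one, neg_sub, zpow_sub₀ two_ne_zero, zpow_natCast, zpow_natCast]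
  have hαα : (N : ℝ) ^ α = (N : ℝ) ^ (α / 2) * (N : ℝ) ^ (α / 2) := by
    rw [← Real.rpow_add hN0, add_halves]
  have hQ4 : 4 * (N : ℝ) ^ (α / 2) ≤ Q := by nlinarith
  refine ⟨hQ1, ?_, by linarith, by rw [hδe]; positivity, ?_, ?_⟩
  · refine hQα.trans ?_
    conv_rhs => rw [← Real.rpow_one (N : ℝ)]
    exact Real.rpow_le_rpow_of_exponent_le hN1 hα1
  · have hδle : δ ≤ (2 * Q / N) ^ d := by
      rw [hδe]
      refine pow_le_pow_left₀ (by positivity) ?_ d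
      rw [div_le_div_iff₀ hL0 hN0]
      nlinarith
    have h3 : 2 * Q ^ (3 * p₀ + 2) * δ ≤ 2 ^ (d + 1) * (Q ^ (3 * p₀ + 2 + d) / (N : ℝ) ^ d) := by
      calc _ ≤ 2 * Q ^ (3 * p₀ + 2) * (2 * Q / N) ^ d := by gcongr
        _ = _ := by rw [div_pow, mul_pow, pow_succ, pow_add Q (3 * p₀ + 2) d]; ring
    have h4 : Q ^ (3 * p₀ + 2 + d) ≤ (N : ℝ) := by
      calc _ ≤ ((N : ℝ) ^ α) ^ (3 * p₀ + 2 + d) := pow_le_pow_left₀ hQ0.le hQα _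
        _ = (N : ℝ) ^ (α * ((3 * p₀ + 2 + d : ℕ) : ℝ)) := by rw [Real.rpow_mul_natCast hN0.le]
        _ ≤ (N : ℝ) ^ (1 : ℝ) := by
            refine Real.rpow_le_rpow_of_exponent_le hN1 ?_
            have hd1 : (1 : ℝ) ≤ d := by exact_mod_cast (by omega : 1 ≤ d)
            have hp1 : (1 : ℝ) ≤ p₀ := by exact_mod_cast hp₀
            push_cast
            nlinarith [mul_nonneg (sub_nonneg.mpr hd1) (sub_nonneg.mpr hp1)]
        _ = N := Real.rpow_one _
    refine h3.trans ?_
    rw [← mul_div_assoc, div_le_one (by positivity)]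
    calc _ ≤ (N : ℝ) * N := by gcongr
      _ = (N : ℝ) ^ 2 := (sq _).symm
      _ ≤ _ := pow_le_pow_right₀ hN1 hd
  · have h3 : Q / (N : ℝ) ^ d ≤ δ := by
      rw [hδe, div_pow]
      exact div_le_div₀ (by positivity) (le_self_pow₀ hQ1 (by omega)) (by positivity)
        (pow_le_pow_left₀ hL0.le hLN d)
    rw [Real.rpow_sub hN0, Real.rpow_natCast]
    calc _ ≤ Q / 4 / (N : ℝ) ^ d := by gcongr; linarith
      _ = Q / (N : ℝ) ^ d / 4 := by ring
      _ ≤ δ / 4 := by gcongr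

theorem norm_minorSymbol_le {η : ℝ → ℝ} (hη01 : ∀ x : ℝ, η x ∈ Set.Icc (0 : ℝ) 1)
    (hη1 : ∀ x ∈ Set.Icc (-(1 / 4) : ℝ) (1 / 4), η x = 1)
    (hη0 : ∀ x : ℝ, x ∉ Set.Ioo (-(1 / 2) : ℝ) (1 / 2) → η x = 0)
    {P : Polynomial ℤ} {d : ℕ} {N : ℕ} {κ B : ℝ} (hN : 1 ≤ N) (hB : 0 ≤ B)
    (hW : ∀ ξ : ℝ, (∃ (a : ℤ) (q : ℕ), 1 ≤ q ∧ IsCoprime a (q : ℤ) ∧ (q : ℝ) ≤ (N : ℝ) ^ κ ∧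
      |ξ - a / q| ≤ (N : ℝ) ^ (κ - d)) ∨
      ‖∑ n ∈ Finset.Icc 1 N, e2pi (ξ * (P.eval (n : ℤ) : ℤ))‖ ≤ B)
    {Q : ℕ} {δ : ℝ} (hδ : 0 < δ) (hδ1 : δ ≤ 1) (hQδ : (Q : ℝ) ^ 2 * δ ≤ 1)
    (hκQ : (N : ℝ) ^ κ ≤ Q) (hκδ : (N : ℝ) ^ (κ - d) ≤ δ / 4) (ξ : ℝ) :
    ‖minorSymbol η P N Q δ ξ‖ ≤ (N : ℝ)⁻¹ * B := by
  rcases hW ξ with ⟨a, q, hq, ha, hqN, hξ⟩ | h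
  · have : iwSymbol η Q δ ξ = 1 := iwSymbol_eq_one hη01 hη0 hη1 hδ hδ1 hQδ hq
      (by exact_mod_cast hqN.trans hκQ) ha (hξ.trans hκδ)
    rw [minorSymbol, this]
    simp only [Complex.ofReal_one, sub_self, mul_zero, norm_zero]
    positivity
  · rw [minorSymbol, norm_mul, norm_mul, norm_inv, Complex.norm_natCast]
    have h1 : ‖(1 : ℂ) - (iwSymbol η Q δ ξ : ℂ)‖ ≤ 1 := by
      rw [← Complex.ofReal_one, ← Complex.ofReal_sub, Complex.norm_real, Real.norm_eq_abs, abs_le]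
      have h0 := iwSymbol_nonneg hη01 Q δ ξ
      have h1 := iwSymbol_le_one hη01 hη0 hδ hQδ ξ
      constructor <;> linarith
    calc _ ≤ (N : ℝ)⁻¹ * B * 1 := by gcongr
      _ = _ := mul_one _

theorem sum_norm_discPolyAvg_pow_le (P : Polynomial ℤ) {N : ℕ} (hN : 1 ≤ N) (g : ℤ → ℂ) (k : ℕ)
    {A : ℝ} (hA : ∀ X : Finset ℤ, ∑ x ∈ X, ‖g x‖ ^ (k + 1) ≤ A) (X : Finset ℤ) :
    ∑ x ∈ X, ‖discPolyAvg P N g x‖ ^ (k + 1) ≤ A := by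
  have hN0 : (0 : ℝ) < N := by exact_mod_cast hN
  have h1 : ∀ x, ‖discPolyAvg P N g x‖ ^ (k + 1) ≤
      ∑ n ∈ Finset.Icc 1 N, (N : ℝ)⁻¹ * ‖g (x - P.eval (n : ℤ))‖ ^ (k + 1) := fun x => by
    have h2 := sum_mul_pow_succ_le (Finset.Icc 1 N) (fun _ => (N : ℝ)⁻¹)
      (fun n => ‖g (x - P.eval (n : ℤ))‖) (fun _ _ => by positivity) (fun _ _ => norm_nonneg _) k
    have h3 : ∑ n ∈ Finset.Icc 1 N, (N : ℝ)⁻¹ = 1 := by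
      rw [Finset.sum_const, Nat.card_Icc, nsmul_eq_mul, Nat.add_sub_cancel, mul_inv_cancel₀ hN0.ne']
    rw [h3, one_pow, one_mul] at h2
    refine le_trans (pow_le_pow_left₀ (norm_nonneg _) ?_ _) h2
    rw [discPolyAvg, norm_mul, norm_inv, Complex.norm_natCast, ← Finset.mul_sum]
    gcongr
    exact norm_sum_le _ _
  refine (Finset.sum_le_sum fun x _ => h1 x).trans ?_
  rw [Finset.sum_comm]
  have h4 : ∀ n ∈ Finset.Icc 1 N,
      ∑ x ∈ X, (N : ℝ)⁻¹ * ‖g (x - P.eval (n : ℤ))‖ ^ (k + 1) ≤ (N : ℝ)⁻¹ * A := fun n _ => by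
    rw [← Finset.mul_sum]
    gcongr
    have := hA (X.map (Equiv.subRight (P.eval (n : ℤ))).toEmbedding)
    rw [Finset.sum_map] at this
    exact this
  refine (Finset.sum_le_sum h4).trans (le_of_eq ?_)
  rw [Finset.sum_const, Nat.card_Icc, nsmul_eq_mul, Nat.add_sub_cancel, mul_inv_cancel_left₀ hN0.ne']

theorem exists_minorKernel_bounds
    {P : Polynomial ℤ} {d : ℕ} (hPd : P.natDegree = d) (hd : 2 ≤ d)
    {m : ℕ} (hm : 1 ≤ m) {α : ℝ} (hα : 0 < α)
    (hα' : α < ((10 ^ 6 * d * (2 * (m + 1)) : ℕ) : ℝ)⁻¹)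
    {η : ℝ → ℝ} (hηsmooth : ContDiff ℝ (⊤ : ℕ∞) η)
    (hη01 : ∀ x : ℝ, η x ∈ Set.Icc (0 : ℝ) 1)
    (hη1 : ∀ x ∈ Set.Icc (-(1 / 4) : ℝ) (1 / 4), η x = 1)
    (hη0 : ∀ x : ℝ, x ∉ Set.Ioo (-(1 / 2) : ℝ) (1 / 2) → η x = 0) :
    ∃ N₀ : ℕ, 1 ≤ N₀ ∧ ∃ c > (0 : ℝ), ∃ C₁ > (0 : ℝ), ∀ ε > (0 : ℝ), ∃ C₂ > (0 : ℝ),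
      ∀ N : ℕ, N₀ ≤ N → ∀ Q δ : ℝ, Q = 2 ^ ⌊α * Real.logb 2 N⌋₊ →
      δ = (2 : ℝ) ^ (-(d : ℤ) * ((⌊Real.logb 2 N⌋₊ : ℤ) - (⌊α * Real.logb 2 N⌋₊ : ℤ))) →
      ∀ (f : ℤ → ℂ) (U X : Finset ℤ),
        ∑ x ∈ X, ‖∑ u ∈ U, minorKernel η P N Q δ (x - u) * f u‖ ^ 2 ≤
          (C₁ * (N : ℝ) ^ (-c)) ^ 2 * ∑ u ∈ U, ‖f u‖ ^ 2 ∧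
        ∑ x ∈ X, ‖∑ u ∈ U, minorKernel η P N Q δ (x - u) * f u‖ ^ (2 * (m + 1)) ≤
          C₂ * (N : ℝ) ^ ε * ∑ u ∈ U, ‖f u‖ ^ (2 * (m + 1)) := by
  obtain ⟨N₀, hN₀, hscale⟩ := exists_scale_bounds hd (by omega : 0 < 2 * (m + 1)) hα hα'
  have hα1 : α ≤ 1 := by
    refine hα'.le.trans (inv_le_one_of_one_le₀ ?_)
    exact_mod_cast Nat.one_le_iff_ne_zero.mpr (by positivity)
  obtain ⟨c, hc, C₁, hC₁, hW⟩ := exists_weyl_bound P hPd hd (half_pos hα) (by linarith : α / 2 ≤ 1)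
  refine ⟨N₀, hN₀, c, hc, C₁, hC₁, fun ε hε => ?_⟩
  obtain ⟨C, hC, hIW⟩ := exists_sum_norm_iwProj_pow_le hηsmooth hη01 hη0 hm hε
  refine ⟨2 ^ (2 * m + 1) * (1 + C), by positivity, fun N hN Q δ hQ hδ f U X => ?_⟩
  obtain ⟨hQ1, hQN, hκQ, hδ0, hQδ, hκδ⟩ := hscale N hN Q δ hQ hδ
  have hN1 : 1 ≤ N := hN₀.trans hN
  have hNR : (1 : ℝ) ≤ N := by exact_mod_cast hN1
  have hN0 : (0 : ℝ) < N := by linarith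
  obtain ⟨R, rfl⟩ : ∃ R : ℕ, Q = R := ⟨2 ^ ⌊α * Real.logb 2 N⌋₊, by rw [hQ]; push_cast; rfl⟩
  have hR1 : 1 ≤ R := by exact_mod_cast hQ1
  have hδ1 : δ ≤ 1 := by
    have : (1 : ℝ) ≤ (R : ℝ) ^ (3 * (2 * (m + 1)) + 2) := one_le_pow₀ hQ1
    nlinarith
  have hR2δ : (R : ℝ) ^ 2 * δ ≤ 1 := by
    have : (R : ℝ) ^ 2 ≤ (R : ℝ) ^ (3 * (2 * (m + 1)) + 2) := pow_le_pow_right₀ hQ1 (by omega)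
    nlinarith [pow_pos (by linarith : (0 : ℝ) < R) 2]
  set f' : ℤ → ℂ := fun u => if u ∈ U then f u else 0 with hf'
  have hf'0 : ∀ u ∉ U, f' u = 0 := fun u hu => if_neg hu
  have hf'U : ∀ u ∈ U, f' u = f u := fun u hu => if_pos hu
  have hT : ∀ x, ∑ u ∈ U, minorKernel η P N R δ (x - u) * f u =
      ∑ u ∈ U, minorKernel η P N R δ (x - u) * f' u := fun x =>
    Finset.sum_congr rfl fun u hu => by rw [hf'U u hu]
  have hF : ∀ k : ℕ, ∑ u ∈ U, ‖f u‖ ^ k = ∑ u ∈ U, ‖f' u‖ ^ k := fun k =>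
    Finset.sum_congr rfl fun u hu => by rw [hf'U u hu]
  simp_rw [hT, hF]
  constructor
  · refine sum_sq_minorKernel_le hηsmooth.continuous P N (iwSymbol_nonneg hη01 _ _)
      (iwSymbol_le_one hη01 hη0 hδ0 hR2δ) (fun ξ => ?_) hf'0 X
    refine (norm_minorSymbol_le hη01 hη1 hη0 hN1 (by positivity) (hW N hN1) hδ0 hδ1 hR2δ hκQ
      hκδ ξ).trans (le_of_eq ?_)
    rw [sub_eq_add_neg, Real.rpow_add hN0, Real.rpow_one]
    field_simp
  · simp_rw [← discPolyAvg_sub_iwProj_eq_sum η P N R δ hf'0]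
    have e : 2 * (m + 1) = 2 * m + 1 + 1 := by ring
    rw [e]
    refine sum_norm_discPolyAvg_pow_le P hN1 _ (2 * m + 1) (fun Y => ?_) X
    rw [← e]
    have h1 : ∑ x ∈ Y, ‖f' x‖ ^ (2 * (m + 1)) ≤ ∑ u ∈ U, ‖f' u‖ ^ (2 * (m + 1)) := by
      calc _ ≤ ∑ x ∈ Y ∪ U, ‖f' x‖ ^ (2 * (m + 1)) :=
            Finset.sum_le_sum_of_subset_of_nonneg Finset.subset_union_left
              fun _ _ _ => by positivity
        _ = _ := by
            refine (Finset.sum_subset Finset.subset_union_right fun u _ hu => ?_).symm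
            rw [hf'0 u hu, norm_zero, zero_pow (by omega)]
    have h2 := hIW R hR1 δ hδ0 (by
      rw [show 6 * (m + 1) + 2 = 3 * (2 * (m + 1)) + 2 by ring]; exact hQδ) U f' hf'0 Y
    have h3 : (R : ℝ) ^ ε ≤ (N : ℝ) ^ ε := Real.rpow_le_rpow (by positivity) hQN hε.le
    have h4 : 1 ≤ (N : ℝ) ^ ε := Real.one_le_rpow hNR hε.le
    set S := ∑ u ∈ U, ‖f' u‖ ^ (2 * (m + 1)) with hS
    have hS0 : 0 ≤ S := Finset.sum_nonneg fun _ _ => by positivity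
    calc ∑ x ∈ Y, ‖f' x - iwProj η R δ f' x‖ ^ (2 * (m + 1))
        ≤ ∑ x ∈ Y, 2 ^ (2 * m + 1) *
          (‖f' x‖ ^ (2 * (m + 1)) + ‖iwProj η R δ f' x‖ ^ (2 * (m + 1))) := by
          refine Finset.sum_le_sum fun x _ => ?_
          refine (pow_le_pow_left₀ (norm_nonneg _) (norm_sub_le _ _) _).trans ?_
          have := add_pow_le (norm_nonneg (f' x)) (norm_nonneg (iwProj η R δ f' x)) (2 * (m + 1))
          rwa [show 2 * (m + 1) - 1 = 2 * m + 1 by omega] at this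
      _ ≤ 2 ^ (2 * m + 1) * (S + C * (R : ℝ) ^ ε * S) := by
          rw [← Finset.mul_sum, Finset.sum_add_distrib]
          gcongr
      _ ≤ 2 ^ (2 * m + 1) * ((N : ℝ) ^ ε * S + C * (N : ℝ) ^ ε * S) := by
          gcongr
          nlinarith
      _ = _ := by ring

theorem norm_sum_sum_le_interp {ι : Type*} {U X : Finset ι} (K : ι → ι → ℂ) {r t : ι → ℝ}
    (hr : ∀ u ∈ U, 0 < r u) (ht : ∀ x ∈ X, 0 < t x) {a₀ a₁ b₀ b₁ A B : ℝ}
    (hA : ∀ F G : ι → ℂ, (∀ u ∈ U, ‖F u‖ = r u ^ a₀) → (∀ x ∈ X, ‖G x‖ = t x ^ b₀) →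
      ‖∑ x ∈ X, ∑ u ∈ U, K x u * F u * G x‖ ≤ A)
    (hB : ∀ F G : ι → ℂ, (∀ u ∈ U, ‖F u‖ = r u ^ a₁) → (∀ x ∈ X, ‖G x‖ = t x ^ b₁) →
      ‖∑ x ∈ X, ∑ u ∈ U, K x u * F u * G x‖ ≤ B)
    {θ : ℝ} (hθ : θ ∈ Set.Icc (0 : ℝ) 1) {F G : ι → ℂ}
    (hF : ∀ u ∈ U, ‖F u‖ = r u ^ (a₀ + θ * (a₁ - a₀)))
    (hG : ∀ x ∈ X, ‖G x‖ = t x ^ (b₀ + θ * (b₁ - b₀))) :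
    ‖∑ x ∈ X, ∑ u ∈ U, K x u * F u * G x‖ ≤ A ^ (1 - θ) * B ^ θ := by
  set Fz : ℂ → ι → ℂ := fun z u => F u * Complex.exp ((z - θ) * ((a₁ - a₀) * Real.log (r u) : ℝ))
    with hFz
  set Gz : ℂ → ι → ℂ := fun z x => G x * Complex.exp ((z - θ) * ((b₁ - b₀) * Real.log (t x) : ℝ))
    with hGz
  have key : ∀ (ρ c e : ℝ) (w z : ℂ), 0 < ρ → ‖w‖ = ρ ^ (c + θ * e) →
      ‖w * Complex.exp ((z - θ) * (e * Real.log ρ : ℝ))‖ = ρ ^ (c + z.re * e) :=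
    fun ρ c e w z hρ hw => by
      rw [norm_mul, Complex.norm_exp, hw, Complex.re_mul_ofReal, Complex.sub_re, Complex.ofReal_re,
        Real.rpow_def_of_pos hρ, Real.rpow_def_of_pos hρ, ← Real.exp_add]
      congr 1
      ring
  have hFn : ∀ z, ∀ u ∈ U, ‖Fz z u‖ = r u ^ (a₀ + z.re * (a₁ - a₀)) := fun z u hu =>
    key _ _ _ _ _ (hr u hu) (hF u hu)
  have hGn : ∀ z, ∀ x ∈ X, ‖Gz z x‖ = t x ^ (b₀ + z.re * (b₁ - b₀)) := fun z x hx =>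
    key _ _ _ _ _ (ht x hx) (hG x hx)
  set H : ℂ → ℂ := fun z => ∑ x ∈ X, ∑ u ∈ U, K x u * Fz z u * Gz z x with hH
  have hd : Differentiable ℂ H := by
    simp only [hH, hFz, hGz]
    fun_prop
  have hbdd : BddAbove ((norm ∘ H) '' Complex.HadamardThreeLines.verticalClosedStrip 0 1) := by
    set φ : ℝ → ℝ := fun y => ∑ x ∈ X, ∑ u ∈ U,
      ‖K x u‖ * r u ^ (a₀ + y * (a₁ - a₀)) * t x ^ (b₀ + y * (b₁ - b₀)) with hφ
    have hc : ContinuousOn φ (Set.Icc 0 1) := by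
      refine continuousOn_finsetSum _ fun x hx => continuousOn_finsetSum _ fun u hu => ?_
      refine ContinuousOn.mul (ContinuousOn.mul continuousOn_const ?_) ?_
      · exact ContinuousOn.rpow continuousOn_const (by fun_prop) fun _ _ => Or.inl (hr u hu).ne'
      · exact ContinuousOn.rpow continuousOn_const (by fun_prop) fun _ _ => Or.inl (ht x hx).ne'
    obtain ⟨M, hM⟩ := isCompact_Icc.bddAbove_image hc
    refine ⟨M, ?_⟩
    rintro _ ⟨z, hz, rfl⟩
    refine le_trans ?_ (hM ⟨z.re, hz, rfl⟩)
    refine (norm_sum_le _ _).trans (Finset.sum_le_sum fun x hx => ?_)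
    refine (norm_sum_le _ _).trans (Finset.sum_le_sum fun u hu => ?_)
    rw [norm_mul, norm_mul, hFn z u hu, hGn z x hx]
  have hz : (θ : ℂ) ∈ Complex.HadamardThreeLines.verticalClosedStrip 0 1 := hθ
  have := Complex.HadamardThreeLines.norm_le_interp_of_mem_verticalClosedStrip' (f := H)
    zero_lt_one hz hd.diffContOnCl hbdd (a := A) (b := B) (fun z hz => ?_) (fun z hz => ?_)
  · rw [Complex.ofReal_re, sub_zero, sub_zero, div_one] at this
    refine le_of_eq_of_le ?_ this
    simp only [hH, hFz, hGz, sub_self, zero_mul, Complex.exp_zero, mul_one]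
  · have hz' : z.re = 0 := hz
    refine hA _ _ (fun u hu => ?_) (fun x hx => ?_)
    · rw [hFn z u hu, hz', zero_mul, add_zero]
    · rw [hGn z x hx, hz', zero_mul, add_zero]
  · have hz' : z.re = 1 := hz
    refine hB _ _ (fun u hu => ?_) (fun x hx => ?_)
    · rw [hFn z u hu, hz', one_mul, add_sub_cancel]
    · rw [hGn z x hx, hz', one_mul, add_sub_cancel]

/-- Boundedness of the bilinear form `∑_{x,u} b (x - u) f(u) g(x)` on `ℓ^p × ℓ^{p'}`, tested on
finitely supported sequences. -/
def BilinBound (b : ℤ → ℂ) (p p' D : ℝ) : Prop :=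
  ∀ (U X : Finset ℤ) (f g : ℤ → ℂ), ‖∑ x ∈ X, ∑ u ∈ U, b (x - u) * f u * g x‖ ≤
    D * (∑ u ∈ U, ‖f u‖ ^ p) ^ (1 / p) * (∑ x ∈ X, ‖g x‖ ^ p') ^ (1 / p')

theorem BilinBound.swap {b : ℤ → ℂ} {p p' D : ℝ} (h : BilinBound b p p' D) :
    BilinBound b p' p D := by
  intro U X f g
  have := h (X.map (Equiv.neg ℤ).toEmbedding) (U.map (Equiv.neg ℤ).toEmbedding)
    (fun u => g (-u)) (fun x => f (-x))
  simp only [Finset.sum_map, Equiv.coe_toEmbedding, Equiv.neg_apply, neg_neg] at this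
  rw [Finset.sum_comm] at this
  calc _ = ‖∑ x ∈ X, ∑ u ∈ U, b (-u - -x) * g x * f u‖ := by
        congr 1
        refine Finset.sum_congr rfl fun x _ => Finset.sum_congr rfl fun u _ => ?_
        rw [show -u - -x = x - u by ring]
        ring
    _ ≤ _ := this
    _ = _ := by ring

theorem BilinBound.of_sum_le {b : ℤ → ℂ} {p p' D : ℝ} (hp : p.HolderConjugate p') (hD : 0 ≤ D)
    (h : ∀ (U X : Finset ℤ) (f : ℤ → ℂ),
      ∑ x ∈ X, ‖∑ u ∈ U, b (x - u) * f u‖ ^ p ≤ D ^ p * ∑ u ∈ U, ‖f u‖ ^ p) :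
    BilinBound b p p' D := by
  intro U X f g
  have hp0 := hp.pos
  have hS : 0 ≤ ∑ u ∈ U, ‖f u‖ ^ p := Finset.sum_nonneg fun _ _ => by positivity
  calc ‖∑ x ∈ X, ∑ u ∈ U, b (x - u) * f u * g x‖
      ≤ ∑ x ∈ X, ‖∑ u ∈ U, b (x - u) * f u‖ * ‖g x‖ := by
        refine (norm_sum_le _ _).trans (Finset.sum_le_sum fun x _ => ?_)
        rw [← Finset.sum_mul, norm_mul]
    _ ≤ (∑ x ∈ X, ‖∑ u ∈ U, b (x - u) * f u‖ ^ p) ^ (1 / p) *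
        (∑ x ∈ X, ‖g x‖ ^ p') ^ (1 / p') := by
        have := Real.inner_le_Lp_mul_Lq X (fun x => ‖∑ u ∈ U, b (x - u) * f u‖)
          (fun x => ‖g x‖) hp
        simpa only [abs_norm] using this
    _ ≤ (D ^ p * ∑ u ∈ U, ‖f u‖ ^ p) ^ (1 / p) * (∑ x ∈ X, ‖g x‖ ^ p') ^ (1 / p') := by
        gcongr
        exact h U X f
    _ = _ := by
        rw [Real.mul_rpow (by positivity) hS, ← Real.rpow_mul hD, mul_one_div_cancel hp0.ne',
          Real.rpow_one]

theorem BilinBound.sum_le {b : ℤ → ℂ} {p p' D : ℝ} (hp : p.HolderConjugate p') (hD : 0 ≤ D)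
    (h : BilinBound b p p' D) (U X : Finset ℤ) (f : ℤ → ℂ) :
    ∑ x ∈ X, ‖∑ u ∈ U, b (x - u) * f u‖ ^ p ≤ D ^ p * ∑ u ∈ U, ‖f u‖ ^ p := by
  set T : ℤ → ℂ := fun x => ∑ u ∈ U, b (x - u) * f u with hT
  set g : ℤ → ℂ := fun x => (starRingEnd ℂ) (T x) * ((‖T x‖ ^ (p - 2) : ℝ) : ℂ) with hg
  have hp0 := hp.pos
  have hTg : ∀ x, T x * g x = ((‖T x‖ ^ p : ℝ) : ℂ) := fun x => by
    rw [hg]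
    dsimp only
    rw [← mul_assoc, Complex.mul_conj, ← Complex.ofReal_mul, Complex.normSq_eq_norm_sq]
    congr 1
    rcases eq_or_ne ‖T x‖ 0 with h0 | h0
    · rw [h0, Real.zero_rpow hp0.ne']
      simp
    · rw [← Real.rpow_natCast, ← Real.rpow_add (lt_of_le_of_ne (norm_nonneg _) h0.symm)]
      congr 1
      push_cast
      ring
  have hgn : ∀ x, ‖g x‖ ^ p' = ‖T x‖ ^ p := fun x => by
    rcases eq_or_ne ‖T x‖ 0 with h0 | h0
    · have : g x = 0 := by rw [hg]; dsimp only; rw [norm_eq_zero.mp h0]; simp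
      rw [this, h0, norm_zero, Real.zero_rpow hp0.ne', Real.zero_rpow hp.symm.pos.ne']
    · have hpos : 0 < ‖T x‖ := lt_of_le_of_ne (norm_nonneg _) h0.symm
      have h1 : ‖g x‖ = ‖T x‖ ^ (p - 1) := by
        rw [hg]
        dsimp only
        rw [norm_mul, RCLike.norm_conj, Complex.norm_real, Real.norm_of_nonneg (by positivity)]
        calc ‖T x‖ * ‖T x‖ ^ (p - 2) = ‖T x‖ ^ (1 : ℝ) * ‖T x‖ ^ (p - 2) := by rw [Real.rpow_one]
          _ = ‖T x‖ ^ (p - 1) := by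
            rw [← Real.rpow_add hpos]
            congr 1
            ring
      rw [h1, ← Real.rpow_mul hpos.le, hp.sub_one_mul_conj]
  set S := ∑ x ∈ X, ‖T x‖ ^ p with hS
  have hS0 : 0 ≤ S := Finset.sum_nonneg fun _ _ => by positivity
  have hF0 : 0 ≤ ∑ u ∈ U, ‖f u‖ ^ p := Finset.sum_nonneg fun _ _ => by positivity
  have h1 := h U X f g
  simp_rw [← Finset.sum_mul, hgn] at h1
  have h2 : ∑ x ∈ X, T x * g x = ((S : ℝ) : ℂ) := by
    rw [hS, Complex.ofReal_sum]
    exact Finset.sum_congr rfl fun x _ => hTg x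
  rw [show (∑ x ∈ X, (∑ u ∈ U, b (x - u) * f u) * g x) = ((S : ℝ) : ℂ) from h2, Complex.norm_real,
    Real.norm_of_nonneg hS0] at h1
  rcases hS0.eq_or_lt with h0 | hpos
  · rw [← h0]
    positivity
  have h3 : S ^ (1 / p) ≤ D * (∑ u ∈ U, ‖f u‖ ^ p) ^ (1 / p) := by
    refine le_of_mul_le_mul_right (le_of_eq_of_le ?_ h1) (Real.rpow_pos_of_pos hpos (1 / p'))
    rw [← Real.rpow_add hpos, one_div, one_div, hp.inv_add_inv_eq_one, Real.rpow_one]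
  have h4 := Real.rpow_le_rpow (by positivity) h3 hp0.le
  rwa [Real.mul_rpow hD (by positivity), ← Real.rpow_mul hS0, ← Real.rpow_mul hF0,
    one_div_mul_cancel hp0.ne', Real.rpow_one, Real.rpow_one] at h4

theorem sum_filter_norm_rpow (U : Finset ℤ) (f : ℤ → ℂ) {p : ℝ} (hp : 0 < p) :
    ∑ u ∈ U with f u ≠ 0, ‖f u‖ ^ p = ∑ u ∈ U, ‖f u‖ ^ p := by
  refine Finset.sum_subset (Finset.filter_subset _ _) fun u hu hu' => ?_
  have : f u = 0 := by
    by_contra hc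
    exact hu' (Finset.mem_filter.mpr ⟨hu, hc⟩)
  rw [this, norm_zero, Real.zero_rpow hp.ne']

theorem BilinBound.interp {b : ℤ → ℂ} {p₀ p₀' p₁ p₁' p p' A B θ : ℝ}
    (h₀ : p₀.HolderConjugate p₀') (h₁ : p₁.HolderConjugate p₁') (h : p.HolderConjugate p')
    (hA : 0 ≤ A) (hB : 0 ≤ B) (hθ : θ ∈ Set.Icc (0 : ℝ) 1)
    (hpθ : p⁻¹ = (1 - θ) * p₀⁻¹ + θ * p₁⁻¹)
    (hbA : BilinBound b p₀ p₀' A) (hbB : BilinBound b p₁ p₁' B) :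
    BilinBound b p p' (A ^ (1 - θ) * B ^ θ) := by
  intro U X f g
  have hpθ' : p'⁻¹ = (1 - θ) * p₀'⁻¹ + θ * p₁'⁻¹ := by
    have e0 := h₀.inv_add_inv_eq_one
    have e1 := h₁.inv_add_inv_eq_one
    have e := h.inv_add_inv_eq_one
    linear_combination e - hpθ - (1 - θ) * e0 - θ * e1
  set U' := U.filter fun u => f u ≠ 0 with hU'
  set X' := X.filter fun x => g x ≠ 0 with hX'
  set S := ∑ u ∈ U, ‖f u‖ ^ p with hS
  set T := ∑ x ∈ X, ‖g x‖ ^ p' with hT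
  have hS0 : 0 ≤ S := Finset.sum_nonneg fun _ _ => by positivity
  have hT0 : 0 ≤ T := Finset.sum_nonneg fun _ _ => by positivity
  have hSU : ∑ u ∈ U', ‖f u‖ ^ p = S := sum_filter_norm_rpow U f h.pos
  have hTX : ∑ x ∈ X', ‖g x‖ ^ p' = T := sum_filter_norm_rpow X g h.symm.pos
  have hLHS : ∑ x ∈ X, ∑ u ∈ U, b (x - u) * f u * g x =
      ∑ x ∈ X', ∑ u ∈ U', b (x - u) * f u * g x := by
    rw [hX', Finset.sum_filter]
    refine Finset.sum_congr rfl fun x _ => ?_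
    split_ifs with hx
    · rw [hU', Finset.sum_filter]
      refine Finset.sum_congr rfl fun u _ => ?_
      split_ifs with hu
      · rfl
      · rw [not_not.mp hu, mul_zero, zero_mul]
    · rw [not_not.mp hx]
      simp
  have hr : ∀ u ∈ U', 0 < ‖f u‖ := fun u hu => norm_pos_iff.mpr (Finset.mem_filter.mp hu).2
  have ht : ∀ x ∈ X', 0 < ‖g x‖ := fun x hx => norm_pos_iff.mpr (Finset.mem_filter.mp hx).2
  have hpow : ∀ (V : Finset ℤ) (k F : ℤ → ℂ) (e s : ℝ), s ≠ 0 →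
      (∀ v ∈ V, ‖F v‖ = ‖k v‖ ^ (e / s)) → ∑ v ∈ V, ‖F v‖ ^ s = ∑ v ∈ V, ‖k v‖ ^ e :=
    fun V k F e s hs hF => Finset.sum_congr rfl fun v hv => by
      rw [hF v hv, ← Real.rpow_mul (norm_nonneg _), div_mul_cancel₀ _ hs]
  have key := norm_sum_sum_le_interp (U := U') (X := X') (fun x u => b (x - u)) hr ht
    (a₀ := p / p₀) (a₁ := p / p₁) (b₀ := p' / p₀') (b₁ := p' / p₁')
    (A := A * S ^ (1 / p₀) * T ^ (1 / p₀')) (B := B * S ^ (1 / p₁) * T ^ (1 / p₁'))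
    (fun F G hF hG => by
      have := hbA U' X' F G
      rwa [hpow U' f F p p₀ h₀.pos.ne' hF, hpow X' g G p' p₀' h₀.symm.pos.ne' hG, hSU, hTX] at this)
    (fun F G hF hG => by
      have := hbB U' X' F G
      rwa [hpow U' f F p p₁ h₁.pos.ne' hF, hpow X' g G p' p₁' h₁.symm.pos.ne' hG, hSU, hTX] at this)
    hθ (F := f) (G := g)
    (fun u hu => by
      have : p / p₀ + θ * (p / p₁ - p / p₀) = 1 := by
        have := mul_inv_cancel₀ h.pos.ne'
        rw [hpθ] at this
        rw [div_eq_mul_inv, div_eq_mul_inv]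
        linear_combination this
      rw [this, Real.rpow_one])
    (fun x hx => by
      have : p' / p₀' + θ * (p' / p₁' - p' / p₀') = 1 := by
        have := mul_inv_cancel₀ h.symm.pos.ne'
        rw [hpθ'] at this
        rw [div_eq_mul_inv, div_eq_mul_inv]
        linear_combination this
      rw [this, Real.rpow_one])
  have hcomb : ∀ {Y : ℝ} (s s₀ s₁ : ℝ), 0 ≤ Y → s⁻¹ = (1 - θ) * s₀⁻¹ + θ * s₁⁻¹ → s⁻¹ ≠ 0 →
      (Y ^ (1 / s₀)) ^ (1 - θ) * (Y ^ (1 / s₁)) ^ θ = Y ^ (1 / s) := fun {Y} s s₀ s₁ hY hs hs0 => by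
    rw [← Real.rpow_mul hY, ← Real.rpow_mul hY, one_div, one_div, one_div, mul_comm s₀⁻¹,
      mul_comm s₁⁻¹, ← Real.rpow_add' hY (by rwa [← hs]), ← hs]
  rw [hLHS]
  refine key.trans (le_of_eq ?_)
  rw [Real.mul_rpow (by positivity) (by positivity), Real.mul_rpow hA (by positivity),
    Real.mul_rpow (by positivity) (by positivity), Real.mul_rpow hB (by positivity),
    ← hcomb p p₀ p₁ hS0 hpθ (inv_ne_zero h.pos.ne'),
    ← hcomb p' p₀' p₁' hT0 hpθ' (inv_ne_zero h.symm.pos.ne')]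
  ring

section LpBound

variable {P : Polynomial ℤ} {d : ℕ} (hPd : P.natDegree = d) (hd : 2 ≤ d)
    {m : ℕ} (hm : 1 ≤ m) {α : ℝ} (hα : 0 < α)
    (hα' : α < ((10 ^ 6 * d * (2 * (m + 1)) : ℕ) : ℝ)⁻¹)
    {η : ℝ → ℝ} (hηsmooth : ContDiff ℝ (⊤ : ℕ∞) η)
    (hη01 : ∀ x : ℝ, η x ∈ Set.Icc (0 : ℝ) 1)
    (hη1 : ∀ x ∈ Set.Icc (-(1 / 4) : ℝ) (1 / 4), η x = 1)
    (hη0 : ∀ x : ℝ, x ∉ Set.Ioo (-(1 / 2) : ℝ) (1 / 2) → η x = 0)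

include hPd hd hm hα hα' hηsmooth hη01 hη1 hη0

theorem exists_bilinBound_minorKernel_of_two_le {r r' : ℝ} (hr : r.HolderConjugate r') (hr2 : 2 ≤ r)
    (hrm : r < 2 * (m + 1)) :
    ∃ N₀ : ℕ, 1 ≤ N₀ ∧ ∃ c ∈ Set.Ioo (0 : ℝ) 1, ∃ C > (0 : ℝ),
      ∀ N : ℕ, N₀ ≤ N → ∀ Q δ : ℝ, Q = 2 ^ ⌊α * Real.logb 2 N⌋₊ →
      δ = (2 : ℝ) ^ (-(d : ℤ) * ((⌊Real.logb 2 N⌋₊ : ℤ) - (⌊α * Real.logb 2 N⌋₊ : ℤ))) →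
      BilinBound (minorKernel η P N Q δ) r r' (C * (N : ℝ) ^ (-c)) := by
  obtain ⟨N₀, hN₀, c, hc, C₁, hC₁, hmain⟩ :=
    exists_minorKernel_bounds hPd hd hm hα hα' hηsmooth hη01 hη1 hη0
  set s : ℝ := 2 * (m + 1) with hs
  have hm1 : (1 : ℝ) ≤ m := by exact_mod_cast hm
  have hs2 : 2 < s := by linarith
  have hs0 : 0 < s := by linarith
  have hr0 : 0 < r := by linarith
  have hsr : s⁻¹ < r⁻¹ := (inv_lt_inv₀ hs0 hr0).mpr hrm
  have hr2' : r⁻¹ ≤ 2⁻¹ := inv_anti₀ two_pos hr2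
  have hden : 0 < 2⁻¹ - s⁻¹ := by linarith
  set θ : ℝ := (2⁻¹ - r⁻¹) / (2⁻¹ - s⁻¹) with hθ
  have hθ0 : 0 ≤ θ := div_nonneg (by linarith) hden.le
  have hθ1 : θ < 1 := (div_lt_one hden).mpr (by linarith)
  have hθe : θ * (2⁻¹ - s⁻¹) = 2⁻¹ - r⁻¹ := div_mul_cancel₀ _ hden.ne'
  set ε : ℝ := s * ((1 - θ) * c / 2) with hε
  have hcθ : 0 < (1 - θ) * c / 2 := by
    have : 0 < 1 - θ := by linarith
    positivity
  obtain ⟨C₂, hC₂, hbd⟩ := hmain ε (by positivity)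
  refine ⟨N₀, hN₀, min ((1 - θ) * c / 2) (1 / 2),
    ⟨lt_min hcθ (by norm_num), (min_le_right _ _).trans_lt (by norm_num)⟩,
    C₁ ^ (1 - θ) * (C₂ ^ s⁻¹) ^ θ, by positivity, fun N hN Q δ hQ hδ => ?_⟩
  have hN1 : (1 : ℝ) ≤ N := by exact_mod_cast hN₀.trans hN
  have hN0 : (0 : ℝ) < N := by linarith
  have hsc : s = ((2 * (m + 1) : ℕ) : ℝ) := by rw [hs]; push_cast; ring
  have h2 : BilinBound (minorKernel η P N Q δ) 2 2 (C₁ * (N : ℝ) ^ (-c)) := by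
    refine BilinBound.of_sum_le Real.HolderConjugate.two_two (by positivity) fun U X f => ?_
    have := (hbd N hN Q δ hQ hδ f U X).1
    simp only [← Real.rpow_natCast] at this
    exact_mod_cast this
  have hss := Real.HolderConjugate.conjExponent (by linarith : 1 < s)
  have hB0 : 0 ≤ C₂ ^ s⁻¹ * (N : ℝ) ^ ((1 - θ) * c / 2) := by positivity
  have h3 : BilinBound (minorKernel η P N Q δ) s s.conjExponent
      (C₂ ^ s⁻¹ * (N : ℝ) ^ ((1 - θ) * c / 2)) := by
    refine BilinBound.of_sum_le hss hB0 fun U X f => ?_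
    have := (hbd N hN Q δ hQ hδ f U X).2
    rw [Real.mul_rpow (by positivity) (by positivity), ← Real.rpow_mul hC₂.le,
      ← Real.rpow_mul hN0.le, inv_mul_cancel₀ hs0.ne', Real.rpow_one, mul_comm _ s, ← hε, hsc]
    simpa only [Real.rpow_natCast] using this
  have h4 := BilinBound.interp Real.HolderConjugate.two_two hss hr (by positivity) hB0
    ⟨hθ0, hθ1.le⟩ (by linear_combination hθe) h2 h3
  have hle : (C₁ * (N : ℝ) ^ (-c)) ^ (1 - θ) * (C₂ ^ s⁻¹ * (N : ℝ) ^ ((1 - θ) * c / 2)) ^ θ ≤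
      C₁ ^ (1 - θ) * (C₂ ^ s⁻¹) ^ θ * (N : ℝ) ^ (-min ((1 - θ) * c / 2) (1 / 2)) := by
    rw [Real.mul_rpow hC₁.le (by positivity), Real.mul_rpow (by positivity) (by positivity),
      ← Real.rpow_mul hN0.le, ← Real.rpow_mul hN0.le]
    calc _ = C₁ ^ (1 - θ) * (C₂ ^ s⁻¹) ^ θ *
          ((N : ℝ) ^ (-c * (1 - θ)) * (N : ℝ) ^ ((1 - θ) * c / 2 * θ)) := by ring
      _ ≤ _ := by
        rw [← Real.rpow_add hN0]
        gcongr
        have := min_le_left ((1 - θ) * c / 2) (1 / 2 : ℝ)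
        nlinarith
  intro U X f g
  refine (h4 U X f g).trans ?_
  gcongr

theorem exists_sum_minorKernel_rpow_le {p : ℝ} (hp1 : 1 < p)
    (hp' : (2 * (m + 1) : ℝ) / (2 * (m + 1) - 1) < p) (hpm : p < 2 * (m + 1)) :
    ∃ N₀ : ℕ, 1 ≤ N₀ ∧ ∃ c ∈ Set.Ioo (0 : ℝ) 1, ∃ C > (0 : ℝ),
      ∀ N : ℕ, N₀ ≤ N → ∀ Q δ : ℝ, Q = 2 ^ ⌊α * Real.logb 2 N⌋₊ →
      δ = (2 : ℝ) ^ (-(d : ℤ) * ((⌊Real.logb 2 N⌋₊ : ℤ) - (⌊α * Real.logb 2 N⌋₊ : ℤ))) →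
      ∀ (U X : Finset ℤ) (f : ℤ → ℂ),
        ∑ x ∈ X, ‖∑ u ∈ U, minorKernel η P N Q δ (x - u) * f u‖ ^ p ≤
          (C * (N : ℝ) ^ (-c)) ^ p * ∑ u ∈ U, ‖f u‖ ^ p := by
  have hp := Real.HolderConjugate.conjExponent hp1
  rcases le_or_gt 2 p with h2 | h2
  · obtain ⟨N₀, hN₀, c, hc, C, hC, h⟩ := exists_bilinBound_minorKernel_of_two_le hPd hd hm hα hα'
      hηsmooth hη01 hη1 hη0 hp h2 hpm
    exact ⟨N₀, hN₀, c, hc, C, hC, fun N hN Q δ hQ hδ U X f =>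
      (h N hN Q δ hQ hδ).sum_le hp (by positivity) U X f⟩
  · have hm1 : (1 : ℝ) ≤ m := by exact_mod_cast hm
    have hq2 : 2 ≤ p.conjExponent := by
      rw [Real.conjExponent, le_div_iff₀ (by linarith)]
      linarith
    have hqm : p.conjExponent < 2 * (m + 1) := by
      rw [div_lt_iff₀ (by linarith)] at hp'
      rw [Real.conjExponent, div_lt_iff₀ (by linarith)]
      linarith
    obtain ⟨N₀, hN₀, c, hc, C, hC, h⟩ := exists_bilinBound_minorKernel_of_two_le hPd hd hm hα hα'
      hηsmooth hη01 hη1 hη0 hp.symm hq2 hqm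
    exact ⟨N₀, hN₀, c, hc, C, hC, fun N hN Q δ hQ hδ U X f =>
      (h N hN Q δ hQ hδ).swap.sum_le hp (by positivity) U X f⟩

end LpBound

section Truncation

variable {η : ℝ → ℝ} (hη : Continuous η) {N₁ N₂ : ℝ} (h0 : ∀ ξ, 0 ≤ iwSymbol η N₁ N₂ ξ)
  (h1 : ∀ ξ, iwSymbol η N₁ N₂ ξ ≤ 1)

include hη h0 h1

theorem summable_norm_iwKernel_sq : Summable fun x : ℤ => ‖iwKernel η N₁ N₂ x‖ ^ 2 :=
  (hasSum_sq_integral_mul_e2pi (g := fun ξ => (iwSymbol η N₁ N₂ ξ : ℂ))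
    (Complex.measurable_ofReal.comp (measurable_iwSymbol hη N₁ N₂)) (M := 1) fun ξ => by
      rw [Complex.norm_real, Real.norm_of_nonneg (h0 ξ)]
      exact h1 ξ).summable

theorem hasSum_iwProj {f : ℤ → ℂ} (hf : Summable fun x : ℤ => ‖f x‖ ^ 2) (x : ℤ) :
    HasSum (fun u => iwKernel η N₁ N₂ (x - u) * f u) (iwProj η N₁ N₂ f x) := by
  have hs : Summable fun y => iwKernel η N₁ N₂ y * f (x - y) := by
    refine Summable.of_norm_bounded (g := fun y => ‖iwKernel η N₁ N₂ y‖ ^ 2 + ‖f (x - y)‖ ^ 2)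
      ((summable_norm_iwKernel_sq hη h0 h1).add (hf.int_const_sub (E := ℝ) x)) fun y => ?_
    rw [norm_mul]
    nlinarith [sq_nonneg (‖iwKernel η N₁ N₂ y‖ - ‖f (x - y)‖), sq_nonneg ‖iwKernel η N₁ N₂ y‖,
      sq_nonneg ‖f (x - y)‖]
  have := (Equiv.hasSum_iff (Equiv.subLeft x)).mpr hs.hasSum
  unfold iwProj
  simpa only [Function.comp_def, Equiv.subLeft_apply, sub_sub_cancel] using this

theorem hasSum_minorKernel (P : Polynomial ℤ) (N : ℕ) {f : ℤ → ℂ}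
    (hf : Summable fun x : ℤ => ‖f x‖ ^ 2) (x : ℤ) :
    HasSum (fun u => minorKernel η P N N₁ N₂ (x - u) * f u)
      (discPolyAvg P N (fun y => f y - iwProj η N₁ N₂ f y) x) := by
  have h : ∀ n ∈ Finset.Icc 1 N, HasSum (fun u => ((if x - u - P.eval (n : ℤ) = 0 then 1 else 0) -
      iwKernel η N₁ N₂ (x - u - P.eval (n : ℤ))) * f u)
      (f (x - P.eval (n : ℤ)) - iwProj η N₁ N₂ f (x - P.eval (n : ℤ))) := fun n _ => by
    simp_rw [sub_mul]
    refine HasSum.sub ?_ ?_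
    · have := hasSum_single (f := fun u => (if x - u - P.eval (n : ℤ) = 0 then (1 : ℂ) else 0) * f u)
        (x - P.eval (n : ℤ)) fun u hu => by
          rw [if_neg (fun h => hu (by linarith)), zero_mul]
      rwa [if_pos (by ring), one_mul] at this
    · have := hasSum_iwProj hη h0 h1 hf (x - P.eval (n : ℤ))
      simpa only [sub_right_comm x] using this
  have := (hasSum_sum h).mul_left (N : ℂ)⁻¹
  unfold minorKernel discPolyAvg
  simpa only [Finset.sum_mul, mul_assoc] using this

end Truncation

theorem lpNormZ_le_of_sum_le {p D : ℝ} (hp : 0 < p) (hD : 0 ≤ D) {f g : ℤ → ℂ}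
    (hf : Summable fun x : ℤ => ‖f x‖ ^ p)
    (h : ∀ X : Finset ℤ, ∑ x ∈ X, ‖g x‖ ^ p ≤ D ^ p * ∑' x, ‖f x‖ ^ p) :
    lpNormZ p g ≤ ENNReal.ofReal D * lpNormZ p f := by
  have e : ∀ z : ℂ, (‖z‖₊ : ℝ≥0∞) ^ p = ENNReal.ofReal (‖z‖ ^ p) := fun z => by
    rw [← ENNReal.ofReal_rpow_of_nonneg (norm_nonneg z) hp.le, ofReal_norm, enorm_eq_nnnorm]
  have hf0 : 0 ≤ ∑' x, ‖f x‖ ^ p := tsum_nonneg fun _ => by positivity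
  unfold lpNormZ
  simp_rw [e]
  rw [← ENNReal.ofReal_tsum_of_nonneg (fun _ => by positivity) hf]
  have h2 : ∑' x, ENNReal.ofReal (‖g x‖ ^ p) ≤ ENNReal.ofReal (D ^ p * ∑' x, ‖f x‖ ^ p) := by
    rw [ENNReal.tsum_eq_iSup_sum]
    refine iSup_le fun X => ?_
    rw [← ENNReal.ofReal_sum_of_nonneg fun _ _ => by positivity]
    exact ENNReal.ofReal_le_ofReal (h X)
  refine (ENNReal.rpow_le_rpow h2 (by positivity)).trans (le_of_eq ?_)
  rw [ENNReal.ofReal_mul (by positivity), ENNReal.mul_rpow_of_nonneg _ _ (by positivity),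
    ENNReal.ofReal_rpow_of_nonneg (by positivity) (by positivity), ← Real.rpow_mul hD,
    mul_one_div_cancel hp.ne', Real.rpow_one]

theorem lpNormZ_minor_le {η : ℝ → ℝ} (hη : Continuous η) {N₁ N₂ : ℝ}
    (h0 : ∀ ξ, 0 ≤ iwSymbol η N₁ N₂ ξ) (h1 : ∀ ξ, iwSymbol η N₁ N₂ ξ ≤ 1) (P : Polynomial ℤ) (N : ℕ)
    {p D : ℝ} (hp : 0 < p) (hD : 0 ≤ D)
    (h : ∀ (U X : Finset ℤ) (f : ℤ → ℂ), ∑ x ∈ X, ‖∑ u ∈ U, minorKernel η P N N₁ N₂ (x - u) * f u‖ ^ p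
      ≤ D ^ p * ∑ u ∈ U, ‖f u‖ ^ p)
    {f : ℤ → ℂ} (hfp : Memℓp f (ENNReal.ofReal p)) (hf2 : Memℓp f 2) :
    lpNormZ p (discPolyAvg P N fun x => f x - iwProj η N₁ N₂ f x) ≤
      ENNReal.ofReal D * lpNormZ p f := by
  have hsp : Summable fun x : ℤ => ‖f x‖ ^ p := by
    have := hfp.summable (by rwa [ENNReal.toReal_ofReal hp.le])
    rwa [ENNReal.toReal_ofReal hp.le] at this
  have hs2 : Summable fun x : ℤ => ‖f x‖ ^ 2 := by
    have := hf2.summable (by norm_num)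
    simpa using this
  refine lpNormZ_le_of_sum_le hp hD hsp fun X => ?_
  have hlim : Tendsto (fun U : Finset ℤ => ∑ x ∈ X,
      ‖∑ u ∈ U, minorKernel η P N N₁ N₂ (x - u) * f u‖ ^ p) atTop
      (nhds (∑ x ∈ X, ‖discPolyAvg P N (fun x => f x - iwProj η N₁ N₂ f x) x‖ ^ p)) :=
    tendsto_finsetSum _ fun x _ =>
      ((hasSum_minorKernel hη h0 h1 P N hs2 x).norm).rpow_const (Or.inr hp.le)
  refine le_of_tendsto hlim (Eventually.of_forall fun U => ?_)
  refine (h U X f).trans ?_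
  gcongr
  exact hsp.sum_le_tsum U fun _ _ => by positivity

/-- **Minor arc estimate for Bourgain's averages.**
Let `P ∈ ℤ[n]` of degree `d ≥ 2`, `p ∈ (1, ∞)`, `p₀ ∈ 2ℤ₊` with `p₀' < p < p₀`,
`α ∈ (0, (10⁶ d p₀)⁻¹)` and `η` a smooth even bump as above.  Then there exist
`C₀ ∈ ℤ₊`, `c_p ∈ (0, 1)` and `C > 0` such that for every integer `N ≥ C₀` and every
`f ∈ ℓ^p(ℤ) ∩ ℓ²(ℤ)`:
`‖ A_N^P (f - Π_{≤ l_N, ≤ -d L_N} f) ‖_{ℓ^p(ℤ)} ≤ C N^{-c_p} ‖f‖_{ℓ^p(ℤ)}`,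
where `l_N = ⌊α log₂ N⌋` and `L_N = ⌊log₂ N⌋ - l_N`. -/
theorem minor_arc_estimate_bourgain
    (P : Polynomial ℤ) (d : ℕ) (hPd : P.natDegree = d) (hd : 2 ≤ d)
    (p : ℝ) (hp1 : 1 < p)
    (p₀ : ℕ) (hp₀even : Even p₀) (hp₀pos : 0 < p₀)
    (hp₀' : (p₀ : ℝ) / ((p₀ : ℝ) - 1) < p) (hpp₀ : p < (p₀ : ℝ))
    (α : ℝ) (hα : 0 < α) (hα' : α < ((10 ^ 6 * d * p₀ : ℕ) : ℝ)⁻¹)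
    (η : ℝ → ℝ) (hηsmooth : ContDiff ℝ (⊤ : ℕ∞) η) (hηeven : ∀ x : ℝ, η (-x) = η x)
    (hη01 : ∀ x : ℝ, η x ∈ Set.Icc (0 : ℝ) 1)
    (hη1 : ∀ x ∈ Set.Icc (-(1 / 4) : ℝ) (1 / 4), η x = 1)
    (hη0 : ∀ x : ℝ, x ∉ Set.Ioo (-(1 / 2) : ℝ) (1 / 2) → η x = 0) :
    ∃ C₀ : ℕ, 0 < C₀ ∧ ∃ c : ℝ, c ∈ Set.Ioo (0 : ℝ) 1 ∧ ∃ C : ℝ, 0 < C ∧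
      ∀ N : ℕ, C₀ ≤ N →
        ∀ f : ℤ → ℂ, Memℓp f (ENNReal.ofReal p) → Memℓp f 2 →
          lpNormZ p
            (discPolyAvg P N (fun x =>
              f x - iwProj η
                ((2 : ℝ) ^ (⌊α * Real.logb 2 N⌋₊ : ℕ))
                ((2 : ℝ) ^ (-(d : ℤ) *
                  ((⌊Real.logb 2 N⌋₊ : ℤ) - (⌊α * Real.logb 2 N⌋₊ : ℤ))))
                f x))
          ≤ ENNReal.ofReal (C * (N : ℝ) ^ (-c)) * lpNormZ p f := by
  have hp0 : 0 < p := by linarith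
  obtain ⟨m, hm, rfl⟩ : ∃ m : ℕ, 1 ≤ m ∧ p₀ = 2 * (m + 1) := by
    obtain ⟨k, rfl⟩ := hp₀even
    rcases Nat.lt_or_ge 1 k with hk | hk
    · exact ⟨k - 1, by omega, by omega⟩
    · obtain rfl : k = 1 := by omega
      norm_num at hp₀' hpp₀
      linarith
  have hcast : ((2 * (m + 1) : ℕ) : ℝ) = 2 * (m + 1) := by push_cast; ring
  rw [hcast] at hp₀' hpp₀
  obtain ⟨N₀, hN₀, hscale⟩ := exists_scale_bounds hd hp₀pos hα hα'
  obtain ⟨N₁, hN₁, c, hc, C, hC, hmain⟩ := exists_sum_minorKernel_rpow_le hPd hd hm hα hα'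
    hηsmooth hη01 hη1 hη0 hp1 hp₀' hpp₀
  refine ⟨max N₀ N₁, lt_max_of_lt_left hN₀, c, hc, C, hC, fun N hN f hfp hf2 => ?_⟩
  have hQ : ((2 : ℝ) ^ (⌊α * Real.logb 2 N⌋₊ : ℕ)) =
      ((2 ^ ⌊α * Real.logb 2 N⌋₊ : ℕ) : ℝ) := by push_cast; rfl
  obtain ⟨hQ1, -, -, hδ0, hQδ, -⟩ := hscale N (le_of_max_le_left hN) _ _ rfl rfl
  have h1 : ∀ ξ, iwSymbol η ((2 : ℝ) ^ (⌊α * Real.logb 2 N⌋₊ : ℕ))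
      ((2 : ℝ) ^ (-(d : ℤ) * ((⌊Real.logb 2 N⌋₊ : ℤ) - (⌊α * Real.logb 2 N⌋₊ : ℤ)))) ξ ≤ 1 := by
    have h2 : ((2 : ℝ) ^ (⌊α * Real.logb 2 N⌋₊ : ℕ)) ^ 2 ≤
        2 * ((2 : ℝ) ^ (⌊α * Real.logb 2 N⌋₊ : ℕ)) ^ (3 * (2 * (m + 1)) + 2) :=
      (pow_le_pow_right₀ hQ1 (by omega)).trans (le_mul_of_one_le_left (by positivity) one_le_two)
    have h3 := (mul_le_mul_of_nonneg_right h2 hδ0.le).trans hQδ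
    rw [hQ] at h3 ⊢
    exact iwSymbol_le_one hη01 hη0 hδ0 h3
  exact lpNormZ_minor_le hηsmooth.continuous (iwSymbol_nonneg hη01 _ _) h1 P N hp0 (by positivity)
    (hmain N (le_of_max_le_right hN) _ _ rfl rfl) hfp hf2
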